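/- arXiv:2409.00901 — 2 statements merged into one kernel-verified Lean document; each statement's English description precedes it below -/
import Mathlib

section
/- Let d ≥ 1, 0 < s < 1, 1 ≤ q < ∞ and 1 ≤ p ≤ ∞ satisfy 1/q − 1/p < s/d (with 1/∞ = 0). Then there exist a constant C > 0 and natural numbers W₀, L₀ (all depending only on s, p, q, d) such that for every W ≥ W₀, every L ≥ L₀ and every measurable f : [0,1]^d → ℝ with ‖f‖_{W^{s,q}([0,1]^d)} < ∞, there exists g ∈ NN_{d,1}(W,L) with ‖f − g‖_{L^p([0,1]^d)} ≤ C · ‖f‖_{W^{s,q}([0,1]^d)} · (WL)^{−2s/d}. -/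
open MeasureTheory ENNReal Finset

noncomputable section

/-- The ReLU activation function. -/
def relu (t : ℝ) : ℝ := max t 0

/-- `A` is an affine map `ℝ^n → ℝ^m`. -/
def IsAffineMap {n m : ℕ} (A : (Fin n → ℝ) → (Fin m → ℝ)) : Prop :=
  ∃ (M : Matrix (Fin m) (Fin n) ℝ) (c : Fin m → ℝ),
    ∀ x i, A x i = (∑ j, M i j * x j) + c i

/-- Auxiliary definition of the ReLU network class, by recursion on the number
of hidden layers. -/
def NNaux (k W : ℕ) : ℕ → (d : ℕ) → Set ((Fin d → ℝ) → (Fin k → ℝ))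
  | 0, _ => {g | IsAffineMap g}
  | (L + 1), d => {g | ∃ N : ℕ, 1 ≤ N ∧ N ≤ W ∧
      ∃ (A : (Fin d → ℝ) → (Fin N → ℝ)) (h : (Fin N → ℝ) → (Fin k → ℝ)),
        IsAffineMap A ∧ h ∈ NNaux k W L N ∧
        g = fun x => h (fun i => relu (A x i))}

/-- The class `NN_{d,k}(W,L)` of functions `ℝ^d → ℝ^k` computed by fully connected
ReLU networks with width at most `W` and `L` hidden layers. -/
def NN (d k W L : ℕ) : Set ((Fin d → ℝ) → (Fin k → ℝ)) := NNaux k W L d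


/-- The unit cube `[0,1]^d`. -/
def unitCube (d : ℕ) : Set (Fin d → ℝ) := Set.Icc 0 1

/-- The fractional Sobolev (Sobolev–Slobodeckij) norm
`‖f‖_{W^{s,q}([0,1]^d)} = (‖f‖_{L^q}^q + ∫∫ |f x − f y|^q / |x−y|^{d+sq} dx dy)^{1/q}`,
where `|x−y|` is the Euclidean distance. The value is `∞` if `f` is not in the space. -/
def sobNorm (d : ℕ) (s q : ℝ) (f : (Fin d → ℝ) → ℝ) : ℝ≥0∞ :=
  ((∫⁻ x in unitCube d, ENNReal.ofReal (|f x| ^ q)) +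
    ∫⁻ x in unitCube d, ∫⁻ y in unitCube d,
      ENNReal.ofReal
        (|f x - f y| ^ q / Real.sqrt (∑ j, (x j - y j) ^ 2) ^ ((d : ℝ) + s * q))) ^ (1 / q)

/-- A scalar function of finitely many real variables is affine. -/
def IsAff {ι : Type} [Fintype ι] (φ : (ι → ℝ) → ℝ) : Prop :=
  ∃ (a : ι → ℝ) (c : ℝ), ∀ x, φ x = ∑ j, a j * x j + c

namespace IsAff

variable {ι κ : Type} [Fintype ι] [Fintype κ]

theorem const (c : ℝ) : IsAff (fun _ : ι → ℝ => c) := ⟨0, c, by simp⟩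

theorem coord (i : ι) : IsAff (fun x : ι → ℝ => x i) := by
  classical
  exact ⟨Pi.single i 1, 0, fun x => by simp [Pi.single_apply]⟩

theorem add {φ ψ : (ι → ℝ) → ℝ} (h : IsAff φ) (h' : IsAff ψ) : IsAff (fun x => φ x + ψ x) := by
  obtain ⟨a, c, h⟩ := h
  obtain ⟨a', c', h'⟩ := h'
  refine ⟨a + a', c + c', fun x => ?_⟩
  simp only [h, h', Pi.add_apply, add_mul, Finset.sum_add_distrib]
  ring

theorem smul {φ : (ι → ℝ) → ℝ} (h : IsAff φ) (b : ℝ) : IsAff (fun x => b * φ x) := by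
  obtain ⟨a, c, h⟩ := h
  refine ⟨fun i => b * a i, b * c, fun x => ?_⟩
  simp only [h, mul_add, Finset.mul_sum, mul_assoc]

theorem neg {φ : (ι → ℝ) → ℝ} (h : IsAff φ) : IsAff (fun x => -φ x) := by
  simpa using h.smul (-1)

theorem sub {φ ψ : (ι → ℝ) → ℝ} (h : IsAff φ) (h' : IsAff ψ) : IsAff (fun x => φ x - ψ x) := by
  simpa [sub_eq_add_neg] using h.add h'.neg

theorem sum {τ : Type*} (s : Finset τ) {φ : τ → (ι → ℝ) → ℝ} (h : ∀ t, IsAff (φ t)) :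
    IsAff (fun x => ∑ t ∈ s, φ t x) := by
  classical
  induction s using Finset.induction_on with
  | empty => simpa using const 0
  | insert t s ht ih => simpa [Finset.sum_insert ht] using (h t).add ih

theorem comp {φ : (κ → ℝ) → ℝ} {A : (ι → ℝ) → κ → ℝ} (h : IsAff φ)
    (hA : ∀ k, IsAff (fun x => A x k)) : IsAff (fun x => φ (A x)) := by
  obtain ⟨a, c, h⟩ := h
  simp only [h]
  exact (sum _ fun k => (hA k).smul (a k)).add (const c)

end IsAff

/-- `IsNet W L g`: the map `g` is computed by a ReLU network with `L` hidden layers whose widths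
are at most `W`; inputs and outputs are indexed by arbitrary types. -/
def IsNet {κ : Type} (W : ℕ) : ℕ → ∀ {ι : Type} [Fintype ι], ((ι → ℝ) → κ → ℝ) → Prop
  | 0, _, _, g => ∀ k, IsAff (fun x => g x k)
  | L + 1, ι, _, g => ∃ (n : ℕ) (A : (ι → ℝ) → Fin n → ℝ) (h : (Fin n → ℝ) → κ → ℝ),
      1 ≤ n ∧ n ≤ W ∧ (∀ i, IsAff (fun x => A x i)) ∧ IsNet W L h ∧
        g = fun x => h (fun i => relu (A x i))

/-- Scalar-valued networks. -/
def IsNet1 {ι : Type} [Fintype ι] (W L : ℕ) (φ : (ι → ℝ) → ℝ) : Prop :=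
  IsNet W L (fun x (_ : Unit) => φ x)

namespace IsNet

variable {ι κ μ : Type} [Fintype ι] [Fintype κ]

theorem mono {W W' L : ℕ} (hW : W ≤ W') {g : (ι → ℝ) → μ → ℝ} (h : IsNet W L g) :
    IsNet W' L g := by
  induction L generalizing ι with
  | zero => exact h
  | succ L ih =>
    obtain ⟨n, A, h', h1, h2, hA, hh, rfl⟩ := h
    exact ⟨n, A, h', h1, h2.trans hW, hA, ih hh, rfl⟩

theorem precomp {W L : ℕ} {g : (κ → ℝ) → μ → ℝ} (h : IsNet W L g) {B : (ι → ℝ) → κ → ℝ}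
    (hB : ∀ k, IsAff (fun x => B x k)) : IsNet W L (fun x => g (B x)) := by
  cases L with
  | zero => exact fun k => (h k).comp hB
  | succ L =>
    obtain ⟨n, A, h', h1, h2, hA, hh, rfl⟩ := h
    exact ⟨n, fun x => A (B x), h', h1, h2, fun i => (hA i).comp hB, hh, rfl⟩

theorem postcomp {W L : ℕ} {g : (ι → ℝ) → κ → ℝ} (h : IsNet W L g) {B : (κ → ℝ) → μ → ℝ}
    (hB : ∀ k, IsAff (fun x => B x k)) : IsNet W L (fun x => B (g x)) := by
  induction L generalizing ι with
  | zero => exact fun k => (hB k).comp h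
  | succ L ih =>
    obtain ⟨n, A, h', h1, h2, hA, hh, rfl⟩ := h
    exact ⟨n, A, fun y => B (h' y), h1, h2, hA, ih hh, rfl⟩

theorem comp {W L₁ L₂ : ℕ} {f : (ι → ℝ) → κ → ℝ} {g : (κ → ℝ) → μ → ℝ} (hf : IsNet W L₁ f)
    (hg : IsNet W L₂ g) : IsNet W (L₁ + L₂) (fun x => g (f x)) := by
  induction L₁ generalizing ι with
  | zero => simpa using hg.precomp hf
  | succ L ih =>
    obtain ⟨n, A, h', h1, h2, hA, hh, rfl⟩ := hf
    rw [Nat.succ_add]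
    exact ⟨n, A, fun y => g (h' y), h1, h2, hA, ih hh, rfl⟩

theorem layer {τ : Type} [Fintype τ] [Nonempty τ] {W L : ℕ} (hW : Fintype.card τ ≤ W)
    {A : (ι → ℝ) → τ → ℝ} (hA : ∀ t, IsAff (fun x => A x t)) {h : (τ → ℝ) → μ → ℝ}
    (hh : IsNet W L h) : IsNet W (L + 1) (fun x => h (fun t => relu (A x t))) := by
  let e := Fintype.equivFin τ
  refine ⟨Fintype.card τ, fun x i => A x (e.symm i), fun y => h (fun t => y (e t)),
    Fintype.card_pos, hW, fun i => hA _, hh.precomp fun t => IsAff.coord _, ?_⟩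
  simp

theorem sigma {J : Type} [Fintype J] [Nonempty J] {L : ℕ} {w : J → ℕ} {ι κ : J → Type}
    [∀ j, Fintype (ι j)] {f : ∀ j, (ι j → ℝ) → κ j → ℝ} (hf : ∀ j, IsNet (w j) L (f j)) :
    IsNet (∑ j, w j) L
      (fun (x : (Σ j, ι j) → ℝ) (k : Σ j, κ j) => f k.1 (fun i => x ⟨k.1, i⟩) k.2) := by
  induction L generalizing ι with
  | zero =>
    intro k
    exact (hf k.1 k.2).comp fun i => IsAff.coord _
  | succ L ih =>
    choose n A h h1 h2 hA hh hfe using hf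
    have hne : Nonempty (Σ j, Fin (n j)) :=
      ⟨⟨Classical.arbitrary J, ⟨0, h1 _⟩⟩⟩
    have := layer (τ := Σ j, Fin (n j)) (W := ∑ j, w j) (L := L)
      (A := fun (x : (Σ j, ι j) → ℝ) t => A t.1 (fun i => x ⟨t.1, i⟩) t.2)
      (h := fun (y : (Σ j, Fin (n j)) → ℝ) (k : Σ j, κ j) => h k.1 (fun i => y ⟨k.1, i⟩) k.2)
      (by simpa using Finset.sum_le_sum fun j _ => h2 j)
      (fun t => (hA t.1 t.2).comp fun i => IsAff.coord _) (ih hh)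
    simpa [hfe] using this

/-- Networks with a common input run side by side. -/
theorem pi {W L : ℕ} {w : κ → ℕ} (hw : ∑ k, w k ≤ W) [Nonempty κ] {φ : κ → (ι → ℝ) → ℝ}
    (h : ∀ k, IsNet1 (w k) L (φ k)) : IsNet W L (fun x k => φ k x) := by
  have h1 := (sigma h).precomp (ι := ι) (B := fun x k => x k.2) fun k => IsAff.coord _
  have h2 := h1.postcomp (μ := κ) (B := fun y k => y ⟨k, ()⟩) fun k => IsAff.coord _
  exact h2.mono hw

theorem coord {W L : ℕ} {g : (ι → ℝ) → κ → ℝ} (h : IsNet W L g) (k : κ) :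
    IsNet1 W L (fun x => g x k) :=
  h.postcomp (B := fun y _ => y k) fun _ => IsAff.coord k

end IsNet

namespace IsNet1

variable {ι κ : Type} [Fintype ι] [Fintype κ]

theorem mono {W W' L : ℕ} (hW : W ≤ W') {φ : (ι → ℝ) → ℝ} (h : IsNet1 W L φ) : IsNet1 W' L φ :=
  IsNet.mono hW h

theorem relu_aff {φ : (ι → ℝ) → ℝ} (h : IsAff φ) : IsNet1 1 1 (fun x => relu (φ x)) :=
  IsNet.layer (τ := Unit) (W := 1) (L := 0) (A := fun x _ => φ x) (h := fun y _ => y ())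
    (by simp) (fun _ => h) fun _ => IsAff.coord ()

theorem sum {J : Type} [Fintype J] [Nonempty J] {W L : ℕ} {w : J → ℕ} (hw : ∑ j, w j ≤ W)
    {φ : J → (ι → ℝ) → ℝ} (h : ∀ j, IsNet1 (w j) L (φ j)) (c : J → ℝ) (c₀ : ℝ) :
    IsNet1 W L (fun x => ∑ j, c j * φ j x + c₀) :=
  (IsNet.pi hw h).postcomp (B := fun y _ => ∑ j, c j * y j + c₀) fun _ => ⟨c, c₀, fun _ => rfl⟩

theorem add {W₁ W₂ L : ℕ} {φ ψ : (ι → ℝ) → ℝ} (h : IsNet1 W₁ L φ) (h' : IsNet1 W₂ L ψ) :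
    IsNet1 (W₁ + W₂) L (fun x => φ x + ψ x) := by
  have := sum (J := Fin 2) (W := W₁ + W₂) (w := ![W₁, W₂]) (φ := ![φ, ψ]) (L := L) (by simp)
    (by intro j; fin_cases j <;> simpa) 1 0
  simpa using this

theorem smul {W L : ℕ} {φ : (ι → ℝ) → ℝ} (h : IsNet1 W L φ) (c : ℝ) :
    IsNet1 W L (fun x => c * φ x) :=
  h.postcomp (B := fun y _ => c * y ()) fun _ => (IsAff.coord ()).smul c

theorem sub {W₁ W₂ L : ℕ} {φ ψ : (ι → ℝ) → ℝ} (h : IsNet1 W₁ L φ) (h' : IsNet1 W₂ L ψ) :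
    IsNet1 (W₁ + W₂) L (fun x => φ x - ψ x) := by
  simpa [sub_eq_add_neg] using h.add (h'.smul (-1))

theorem aff_one {φ : (ι → ℝ) → ℝ} (h : IsAff φ) : IsNet1 2 1 φ := by
  have := (relu_aff h).sub (relu_aff h.neg)
  convert this using 2 with x
  simp only [relu]
  rcases le_total (φ x) 0 with h | h <;> simp [h]

/-- A scalar network with vector-valued inner network. -/
theorem comp {W L₁ L₂ : ℕ} {f : (ι → ℝ) → κ → ℝ} {φ : (κ → ℝ) → ℝ} (hf : IsNet W L₁ f)
    (h : IsNet1 W L₂ φ) : IsNet1 W (L₁ + L₂) (fun x => φ (f x)) :=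
  IsNet.comp hf h

end IsNet1

namespace IsNet

variable {ι κ μ : Type} [Fintype ι] [Fintype κ]

theorem deepen_one [Nonempty κ] {W L : ℕ} {g : (ι → ℝ) → κ → ℝ} (h : IsNet W L g)
    (hW : 2 * Fintype.card κ ≤ W) : IsNet W (L + 1) g := by
  have h1 : IsNet W 1 (fun (y : κ → ℝ) k => y k) :=
    pi (w := fun _ => 2) (by simpa [mul_comm] using hW) fun k => IsNet1.aff_one (IsAff.coord k)
  exact h.comp h1

theorem deepen [Nonempty κ] {W L L' : ℕ} (hL : L ≤ L') {g : (ι → ℝ) → κ → ℝ} (h : IsNet W L g)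
    (hW : 2 * Fintype.card κ ≤ W) : IsNet W L' g := by
  induction L', hL using Nat.le_induction with
  | base => exact h
  | succ L' _ ih => exact ih.deepen_one hW

end IsNet

namespace IsNet1

variable {ι κ : Type} [Fintype ι] [Fintype κ]

theorem deepen {W W' L L' : ℕ} (hL : L ≤ L') (hW : W ≤ W') (hW' : 2 ≤ W') {φ : (ι → ℝ) → ℝ}
    (h : IsNet1 W L φ) : IsNet1 W' L' φ :=
  IsNet.deepen hL (IsNet.mono hW h) (by simpa)

theorem aff {W : ℕ} (hW : 2 ≤ W) (L : ℕ) {φ : (ι → ℝ) → ℝ} (h : IsAff φ) : IsNet1 W L φ :=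
  deepen (W := W) (Nat.zero_le L) le_rfl hW (L := 0) fun _ => h

/-- Networks run one after the other, with the inputs and a running sum carried along. -/
theorem sum_seq {τ : Type*} (s : Finset τ) {W : ℕ} {ℓ : τ → ℕ} {φ : τ → (ι → ℝ) → ℝ}
    (h : ∀ t ∈ s, IsNet1 W (ℓ t) (φ t)) :
    IsNet1 (W + 2 * Fintype.card ι + 2) (∑ t ∈ s, ℓ t) (fun x => ∑ t ∈ s, φ t x) := by
  classical
  suffices H : IsNet (W + 2 * Fintype.card ι + 2) (∑ t ∈ s, ℓ t)
      (fun (y : Option ι → ℝ) (o : Option ι) =>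
        o.elim (y none + ∑ t ∈ s, φ t (fun i => y (some i))) (fun i => y (some i))) by
    have := (H.coord none).precomp (ι := ι)
      (B := fun x o => o.elim 0 x)
      (by rintro (_ | i); exacts [IsAff.const 0, IsAff.coord i])
    simpa [IsNet1] using this
  induction s using Finset.induction_on with
  | empty =>
    rintro (_ | i)
    · simpa using IsAff.coord _
    · exact IsAff.coord _
  | insert t s ht ih =>
    rw [Finset.sum_insert ht, add_comm (ℓ t)]
    have h1 := ih fun t' ht' => h t' (Finset.mem_insert_of_mem ht')
    have h2 : IsNet (W + 2 * Fintype.card ι + 2) (ℓ t)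
        (fun (y : Option ι → ℝ) (o : Option ι) =>
          o.elim (y none + φ t (fun i => y (some i))) (fun i => y (some i))) := by
      refine (IsNet.pi (κ := Option ι) (w := fun o => o.elim (W + 2) fun _ => 2) ?_
        (φ := fun o y => o.elim (y none + φ t (fun i => y (some i))) (fun i => y (some i))) ?_)
      · rw [Fintype.sum_option]
        simp only [Option.elim, Finset.sum_const, smul_eq_mul, Finset.card_univ]
        omega
      · rintro (_ | i)
        · simp only [Option.elim]
          rw [add_comm W]
          have ht' : IsNet1 W (ℓ t) (φ t) := h t (Finset.mem_insert_self t s)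
          exact (aff le_rfl _ (IsAff.coord _)).add
            (IsNet.precomp (B := fun (y : Option ι → ℝ) i => y (some i)) ht'
              fun i => IsAff.coord _)
        · exact aff le_rfl _ (IsAff.coord _)
    have h3 := h1.comp h2
    convert h3 using 1
    funext y o
    rcases o with _ | i
    · simp only [Option.elim, Finset.sum_insert ht]
      ring
    · rfl

theorem mem_NN {d W L : ℕ} {φ : (Fin d → ℝ) → ℝ} (h : IsNet1 W L φ) :
    (fun x (_ : Fin 1) => φ x) ∈ NN d 1 W L := by
  have key : ∀ {L n : ℕ} {g : (Fin n → ℝ) → Unit → ℝ}, IsNet W L g →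
      (fun x (_ : Fin 1) => g x ()) ∈ NNaux 1 W L n := by
    intro L
    induction L with
    | zero =>
      intro n g hg
      obtain ⟨a, c, h⟩ := hg ()
      exact ⟨fun _ j => a j, fun _ => c, fun x i => h x⟩
    | succ L ih =>
      intro n g hg
      obtain ⟨N, A, h', h1, h2, hA, hh, rfl⟩ := hg
      choose a c hac using hA
      exact ⟨N, h1, h2, A, fun y _ => h' y (), ⟨fun i j => a i j, c, fun x i => hac i x⟩,
        ih hh, rfl⟩
  exact key h

end IsNet1

theorem relu_step_int (n : ℤ) : relu ((n : ℝ) + 1) - relu n = if 0 ≤ n then 1 else 0 := by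
  unfold relu
  split_ifs with h
  · have : (0 : ℝ) ≤ n := by exact_mod_cast h
    rw [max_eq_left (by linarith), max_eq_left this]
    ring
  · have : (n : ℝ) + 1 ≤ 0 := by
      have : n + 1 ≤ 0 := by omega
      exact_mod_cast this
    rw [max_eq_right this, max_eq_right (by linarith)]
    ring

/-- The ReLU function of an affine form that agrees with `1_{t ≥ 0}` on integers. -/
def unitStep (t : ℝ) : ℝ := relu (t + 1) - relu t

theorem unitStep_natCast_sub (i j : ℕ) :
    unitStep ((i : ℝ) - j) = if j ≤ i then 1 else 0 := by
  have := relu_step_int ((i : ℤ) - j)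
  push_cast at this
  simpa [unitStep] using this

theorem IsNet1.unitStep {ι : Type} [Fintype ι] {φ : (ι → ℝ) → ℝ} (h : IsAff φ) :
    IsNet1 2 1 (fun x => unitStep (φ x)) :=
  (IsNet1.relu_aff (h.add (IsAff.const 1))).sub (IsNet1.relu_aff h)

theorem telescope_ite (F : ℕ → ℝ) (w b₀ : ℕ) (hb : b₀ ≤ w) :
    F 0 + ∑ b : Fin w, (F (b + 1) - F b) * (if (b : ℕ) < b₀ then 1 else 0) = F b₀ := by
  rw [Fin.sum_univ_eq_sum_range (fun b => (F (b + 1) - F b) * (if b < b₀ then 1 else 0)) w]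
  simp only [mul_ite, mul_one, mul_zero]
  rw [← Finset.sum_filter]
  have : (Finset.range w).filter (fun b => b < b₀) = Finset.range b₀ := by
    ext b
    simp only [Finset.mem_filter, Finset.mem_range]
    omega
  rw [this, Finset.sum_range_sub]
  ring

/-- The value `F b₀`, written as an affine form in the bits `s b = 1_{b < b₀}`. -/
def select {w : ℕ} (F : ℕ → ℝ) (s : Fin w → ℝ) : ℝ :=
  F 0 + ∑ b : Fin w, (F (b + 1) - F b) * s b

/-- A step function on the integers with `(w + 1)²` steps that vanishes outside them, computed with
three hidden layers of width `O(w)`. -/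
theorem exists_net_block_step (w : ℕ) (a : ℕ → ℕ) (ha : StrictMono a) (y : ℕ → ℝ) (B : ℝ)
    (hy0 : ∀ g, 0 ≤ y g) (hyB : ∀ g < (w + 1) * (w + 1), y g ≤ B) :
    ∃ φ : (Unit → ℝ) → ℝ, IsNet1 (4 * (w + 1)) 3 φ ∧
      (∀ i g : ℕ, g < (w + 1) * (w + 1) → a g ≤ i → i < a (g + 1) → φ (fun _ => i) = y g) ∧
      ∀ i : ℕ, i < a 0 ∨ a ((w + 1) * (w + 1)) ≤ i → φ (fun _ => i) = 0 := by
  let f₁ : (Unit → ℝ) → Option (Fin w) → ℝ := fun x o =>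
    o.elim (x ()) fun b => unitStep (x () - (a ((b + 1) * (w + 1)) : ℝ))
  let f₂ : (Option (Fin w) → ℝ) → (Fin (w + 2) ⊕ Fin w) → ℝ := fun x o =>
    Sum.elim
      (fun t : Fin (w + 2) =>
        unitStep (x none - select (fun b => (a (b * (w + 1) + t) : ℝ)) (fun b => x (some b))))
      (fun b => x (some b)) o
  let f₃ : ((Fin (w + 2) ⊕ Fin w) → ℝ) → ℝ := fun x =>
    ∑ t : Fin (w + 1), relu (select (fun b => y (b * (w + 1) + t)) (fun b => x (Sum.inr b)) -
      B * (1 - (x (Sum.inl t.castSucc) - x (Sum.inl t.succ))))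
  have hsel : ∀ (F : ℕ → ℝ) {κ : Type} [Fintype κ] (e : Fin w → κ),
      IsAff (fun x : κ → ℝ => select F (fun b => x (e b))) := fun F κ _ e =>
    (IsAff.const _).add (IsAff.sum _ fun b => (IsAff.coord _).smul _)
  have h₁ : IsNet (4 * (w + 1)) 1 f₁ := by
    refine IsNet.pi (w := fun _ => 2) (by simp; omega) ?_ (φ := fun o x => f₁ x o)
    rintro (_ | b)
    · exact IsNet1.aff_one (IsAff.coord _)
    · exact IsNet1.unitStep ((IsAff.coord _).sub (IsAff.const _))
  have h₂ : IsNet (4 * (w + 1)) 1 f₂ := by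
    refine IsNet.pi (w := fun _ => 2) (by simp; omega) ?_ (φ := fun o x => f₂ x o)
    rintro (t | b)
    · exact IsNet1.unitStep ((IsAff.coord _).sub (hsel _ _))
    · exact IsNet1.aff_one (IsAff.coord _)
  have h₃ : IsNet1 (4 * (w + 1)) 1 f₃ := by
    have := IsNet1.sum (J := Fin (w + 1)) (W := 4 * (w + 1)) (w := fun _ => 1) (by simp)
      (φ := fun t (x : (Fin (w + 2) ⊕ Fin w) → ℝ) =>
        relu (select (fun b => y (b * (w + 1) + t)) (fun b => x (Sum.inr b)) -
          B * (1 - (x (Sum.inl t.castSucc) - x (Sum.inl t.succ))))) (L := 1)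
      (fun t => IsNet1.relu_aff ((hsel _ _).sub
        (((IsAff.const 1).sub ((IsAff.coord _).sub (IsAff.coord _))).smul B))) 1 0
    simpa [f₃] using this
  refine ⟨fun x => f₃ (f₂ (f₁ x)), IsNet1.comp (IsNet.comp h₁ h₂) h₃, ?_⟩
  have key : ∀ i b₀ : ℕ, b₀ ≤ w → (∀ b < w, a ((b + 1) * (w + 1)) ≤ i ↔ b < b₀) →
      f₃ (f₂ (f₁ fun _ => (i : ℝ))) = ∑ t : Fin (w + 1),
        if a (b₀ * (w + 1) + t) ≤ i ∧ i < a (b₀ * (w + 1) + (t + 1)) then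
          y (b₀ * (w + 1) + t) else 0 := by
    intro i b₀ hb₀ hb
    have hsel' : ∀ F : ℕ → ℝ, select F (fun b => f₁ (fun _ => (i : ℝ)) (some b)) = F b₀ := by
      intro F
      have : ∀ b : Fin w, f₁ (fun _ => (i : ℝ)) (some b) = if (b : ℕ) < b₀ then 1 else 0 := by
        intro b
        simp only [f₁, Option.elim]
        rw [unitStep_natCast_sub]
        simp only [hb b b.2]
      simp only [select, this]
      exact telescope_ite F w b₀ hb₀
    simp only [f₃]
    refine Finset.sum_congr rfl fun t _ => ?_
    have e1 : select (fun b => y (b * (w + 1) + t))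
        (fun b => f₂ (f₁ fun _ => (i : ℝ)) (Sum.inr b)) = y (b₀ * (w + 1) + t) := by
      simp only [f₂, Sum.elim_inr]
      exact hsel' _
    have e2 : ∀ t : Fin (w + 2), f₂ (f₁ fun _ => (i : ℝ)) (Sum.inl t) =
        if a (b₀ * (w + 1) + t) ≤ i then 1 else 0 := by
      intro t
      simp only [f₂, Sum.elim_inl]
      rw [hsel', ← unitStep_natCast_sub]
      rfl
    rw [e1, e2, e2]
    simp only [Fin.val_castSucc, Fin.val_succ]
    have hlt : a (b₀ * (w + 1) + t) < a (b₀ * (w + 1) + (t + 1)) := ha (by omega)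
    have hB : y (b₀ * (w + 1) + t) ≤ B := hyB _ (by have := t.2; nlinarith)
    have h0 := hy0 (b₀ * (w + 1) + t)
    unfold relu
    split_ifs with h1 h2 h3 h3 <;> first | omega | skip
    · rw [max_eq_right (by linarith)]
    · rw [max_eq_left (by linarith)]; ring
    · rw [max_eq_right (by linarith)]
  constructor
  · intro i g hg h1 h2
    beta_reduce
    have hdm := Nat.div_add_mod g (w + 1)
    have hml := Nat.mod_lt g (Nat.succ_pos w)
    have hdl : g / (w + 1) < w + 1 := Nat.div_lt_of_lt_mul hg
    have hgg : g / (w + 1) * (w + 1) + g % (w + 1) = g := by rw [mul_comm]; exact hdm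
    rw [key i (g / (w + 1)) (by omega)]
    · rw [Finset.sum_eq_single ⟨g % (w + 1), hml⟩]
      · simp only [← add_assoc, hgg]
        rw [if_pos ⟨h1, h2⟩]
      · intro t _ ht
        rw [if_neg]
        rintro ⟨h3, h4⟩
        apply ht
        ext
        have h5 := ha.lt_iff_lt.1 (h3.trans_lt h2)
        have h6 := ha.lt_iff_lt.1 (h1.trans_lt h4)
        simp only
        omega
      · simp
    · intro b _
      rw [Nat.lt_iff_add_one_le, Nat.le_div_iff_mul_le (by omega : 0 < w + 1)]
      constructor
      · intro h
        have := ha.lt_iff_lt.1 (h.trans_lt h2)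
        omega
      · intro h
        exact (ha.monotone h).trans h1
  · rintro i (h | h)
    · beta_reduce
      rw [key i 0 (by omega)]
      · refine Finset.sum_eq_zero fun t _ => if_neg ?_
        rintro ⟨h1, -⟩
        have := ha.monotone (Nat.zero_le (0 * (w + 1) + t))
        omega
      · intro b _
        have := ha.monotone (Nat.zero_le ((b + 1) * (w + 1)))
        omega
    · beta_reduce
      rw [key i w le_rfl]
      · refine Finset.sum_eq_zero fun t _ => if_neg ?_
        rintro ⟨-, h1⟩
        have : a (w * (w + 1) + (t + 1)) ≤ a ((w + 1) * (w + 1)) :=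
          ha.monotone (by have := t.2; nlinarith)
        omega
      · intro b hb
        have : a ((b + 1) * (w + 1)) ≤ a ((w + 1) * (w + 1)) :=
          ha.monotone (by nlinarith)
        simp only [hb, iff_true]
        omega

/-- A step function on the integers with `W²L` steps. -/
theorem exists_net_step (W L : ℕ) (hW : 1 ≤ W) (a : ℕ → ℕ) (ha : StrictMono a)
    (y : ℕ → ℝ) (hy0 : ∀ g, 0 ≤ y g) :
    ∃ φ : (Unit → ℝ) → ℝ, IsNet1 (4 * W + 4) (3 * L) φ ∧
      ∀ i g : ℕ, g < W * W * L → a g ≤ i → i < a (g + 1) → φ (fun _ => i) = y g := by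
  obtain ⟨w, rfl⟩ : ∃ w, W = w + 1 := ⟨W - 1, by omega⟩
  set V := (w + 1) * (w + 1) with hV
  have hVpos : 0 < V := by positivity
  have hex : ∀ l : ℕ, ∃ φ : (Unit → ℝ) → ℝ, IsNet1 (4 * (w + 1)) 3 φ ∧
      (∀ i g : ℕ, g < V → a (l * V + g) ≤ i → i < a (l * V + (g + 1)) →
        φ (fun _ => i) = y (l * V + g)) ∧
      ∀ i : ℕ, i < a (l * V + 0) ∨ a (l * V + V) ≤ i → φ (fun _ => i) = 0 := fun l =>
    exists_net_block_step w (fun g => a (l * V + g)) (fun g g' h => ha (by simpa using h))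
      (fun g => y (l * V + g)) (∑ g ∈ range V, y (l * V + g)) (fun g => hy0 _)
      (fun g hg => Finset.single_le_sum (f := fun g => y (l * V + g)) (fun i _ => hy0 _)
        (by simpa using hg))
  choose φ h1 h2 h3 using hex
  refine ⟨fun x => ∑ l ∈ range L, φ l x, ?_, ?_⟩
  · have := IsNet1.sum_seq (range L) (fun l _ => h1 l)
    simpa [mul_comm] using this
  · intro i g hg hi hi'
    have hdm : g / V * V + g % V = g := Nat.div_add_mod' g V
    have hml := Nat.mod_lt g hVpos
    beta_reduce
    rw [Finset.sum_eq_single (g / V)]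
    · rw [h2 (g / V) i (g % V) hml (by rwa [hdm]) (by rwa [← add_assoc, hdm]), hdm]
    · intro l _ hl
      apply h3
      rcases lt_or_gt_of_ne hl with h | h
      · right
        refine (ha.monotone ?_).trans hi
        have : (l + 1) * V ≤ g / V * V := Nat.mul_le_mul_right _ h
        rw [add_mul, one_mul] at this
        omega
      · left
        refine hi'.trans_le (ha.monotone ?_)
        have : (g / V + 1) * V ≤ l * V := Nat.mul_le_mul_right _ h
        rw [add_mul, one_mul] at this
        omega
    · intro h
      exact absurd (Nat.div_lt_of_lt_mul hg) (by simpa using h)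

/-- The number with the given binary digits, most significant digit first. -/
def bitCode : List Bool → ℕ
  | [] => 0
  | b :: bs => b.toNat * 2 ^ bs.length + bitCode bs

theorem bitCode_lt (bs : List Bool) : bitCode bs < 2 ^ bs.length := by
  induction bs with
  | nil => simp [bitCode]
  | cons b bs ih =>
    simp only [bitCode, List.length_cons, pow_succ]
    cases b <;> (simp; omega)

/-- A program of pairs `(w, e)` reads one bit per instruction: if the bit is set, it counts a hit
when `e` is set and the register is zero, and then decreases the register by `w`. -/
def scan : List (ℕ × Bool) → List Bool → ℤ → ℝ
  | (w, e) :: ps, b :: bs, r =>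
      (if e = true ∧ b = true ∧ r = 0 then 1 else 0) + scan ps bs (r - if b then (w : ℤ) else 0)
  | _, _, _ => 0

theorem relu_hat_int (b : Bool) (r : ℤ) :
    relu ((r : ℝ) + b.toNat) - 2 * relu r + relu ((r : ℝ) - b.toNat) =
      if b = true ∧ r = 0 then 1 else 0 := by
  cases b
  · simp
    ring
  · have h1 := relu_step_int r
    have h2 := relu_step_int (r - 1)
    push_cast at h2
    rw [sub_add_cancel] at h2
    simp only [Bool.toNat_true, Nat.cast_one, true_and]
    split_ifs at * <;> first | omega | linarith

/-- Running a program takes a network of constant width, two layers per instruction. -/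
theorem exists_net_scan (ps : List (ℕ × Bool)) :
    ∃ Φ : (Fin 3 → ℝ) → ℝ, IsNet1 9 (2 * ps.length) Φ ∧
      ∀ bs : List Bool, bs.length = ps.length → ∀ (r : ℤ) (t : ℝ),
        Φ ![(bitCode bs : ℝ), (r : ℝ), t] = t + scan ps bs r := by
  induction ps with
  | nil =>
    refine ⟨fun x => x 2, fun _ => IsAff.coord 2, fun bs _ r t => ?_⟩
    simp [scan]
  | cons p ps ih =>
    obtain ⟨w, e⟩ := p
    obtain ⟨Φ, hΦ, hval⟩ := ih
    let m : ℕ := 2 ^ ps.length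
    let ε : ℝ := if e then 1 else 0
    let f₁ : (Fin 3 → ℝ) → Fin 4 → ℝ := fun x =>
      ![unitStep (x 0 - (m : ℝ)), x 0, x 1, x 2]
    let f₂ : (Fin 4 → ℝ) → Fin 3 → ℝ := fun x =>
      ![x 1 - m * x 0, x 2 - w * x 0,
        x 3 + ε * (relu (x 2 + x 0) - 2 * relu (x 2) + relu (x 2 - x 0))]
    have h₁ : IsNet 9 1 f₁ := by
      refine IsNet.pi (w := fun _ => 2) (by simp) ?_ (φ := fun o x => f₁ x o)
      intro o
      fin_cases o
      · exact IsNet1.unitStep ((IsAff.coord _).sub (IsAff.const _))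
      all_goals exact IsNet1.aff_one (IsAff.coord _)
    have h₂ : IsNet 9 1 f₂ := by
      refine IsNet.pi (w := ![2, 2, 5]) (by simp [Fin.sum_univ_succ]) ?_ (φ := fun o x => f₂ x o)
      intro o
      fin_cases o
      · exact IsNet1.aff_one ((IsAff.coord 1).sub ((IsAff.coord 0).smul _))
      · exact IsNet1.aff_one ((IsAff.coord 2).sub ((IsAff.coord 0).smul _))
      · exact (IsNet1.aff_one (IsAff.coord 3)).add
          ((((IsNet1.relu_aff ((IsAff.coord 2).add (IsAff.coord 0))).sub
            ((IsNet1.relu_aff (IsAff.coord 2)).smul 2)).add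
              (IsNet1.relu_aff ((IsAff.coord 2).sub (IsAff.coord 0)))).smul ε)
    refine ⟨fun x => Φ (f₂ (f₁ x)), ?_, ?_⟩
    · have := IsNet1.comp (IsNet.comp h₁ h₂) hΦ
      convert this using 1
      simp only [List.length_cons]
      ring
    · rintro (_ | ⟨b, bs⟩) hlen r t
      · simp at hlen
      have hlen' : bs.length = ps.length := by simpa using hlen
      have hlt := bitCode_lt bs
      have e1 : unitStep ((bitCode (b :: bs) : ℝ) - (m : ℝ)) = (b.toNat : ℝ) := by
        rw [unitStep_natCast_sub]
        simp only [bitCode, m, hlen'] at hlt ⊢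
        cases b <;> simp <;> omega
      have e2 : f₂ (f₁ ![(bitCode (b :: bs) : ℝ), (r : ℝ), t]) =
          ![(bitCode bs : ℝ), ((r - if b then (w : ℤ) else 0 : ℤ) : ℝ),
            t + if e = true ∧ b = true ∧ r = 0 then 1 else 0] := by
        have hh := relu_hat_int b r
        have e3 : f₁ ![(bitCode (b :: bs) : ℝ), (r : ℝ), t] =
            ![(b.toNat : ℝ), (bitCode (b :: bs) : ℝ), (r : ℝ), t] := by
          simp only [f₁, ← e1]
          rfl
        rw [e3]
        ext o
        fin_cases o
        · simp [f₂, bitCode, m, hlen']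
          ring
        · simp [f₂]
          cases b <;> simp
        · simp [f₂, hh, ε]
          cases e <;> simp
      beta_reduce
      rw [e2, hval bs hlen']
      simp only [scan]
      ring

/-- The instructions that subtract a `D`-digit binary number from the register. -/
def digitProg : ℕ → List (ℕ × Bool)
  | 0 => []
  | D + 1 => (2 ^ D, false) :: digitProg D

/-- The last `D` binary digits of `g`. -/
def digitBits (g : ℕ) : ℕ → List Bool
  | 0 => []
  | D + 1 => g.testBit D :: digitBits g D

theorem length_digitProg (D : ℕ) : (digitProg D).length = D := by
  induction D <;> simp [digitProg, *]

theorem length_digitBits (g D : ℕ) : (digitBits g D).length = D := by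
  induction D <;> simp [digitBits, *]

theorem mod_two_pow_succ_eq (g D : ℕ) :
    g % 2 ^ (D + 1) = 2 ^ D * (g.testBit D).toNat + g % 2 ^ D := by
  rw [Nat.mod_pow_succ, Nat.toNat_testBit, add_comm]

theorem scan_digits (g D : ℕ) (ps : List (ℕ × Bool)) (bs : List Bool) (r : ℤ) :
    scan (digitProg D ++ ps) (digitBits g D ++ bs) r = scan ps bs (r - (g % 2 ^ D : ℕ)) := by
  induction D generalizing r with
  | zero => simp [digitProg, digitBits, Nat.mod_one]
  | succ D ih =>
    simp only [digitProg, digitBits, List.cons_append, scan, ih, mod_two_pow_succ_eq]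
    simp only [Bool.false_eq_true, false_and, if_false, zero_add]
    congr 1
    cases g.testBit D
    · simp
    · simp only [if_true, Bool.toNat_true, mul_one]
      push_cast
      ring

/-- The program that compares the register with `n` increasing positions. -/
def searchProg (D : ℕ) : ℕ → List (ℕ × Bool)
  | 0 => []
  | n + 1 => (0, true) :: (digitProg D ++ searchProg D n)

/-- The encoding of the positions `e j, …, e (j + n - 1)` and of their marks. -/
def searchBits (D : ℕ) (e : ℕ → ℕ) (mark : ℕ → Bool) : ℕ → ℕ → List Bool
  | _, 0 => []
  | j, n + 1 => mark (e j) :: (digitBits (e (j + 1) - e j) D ++ searchBits D e mark (j + 1) n)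

theorem length_searchProg (D n : ℕ) : (searchProg D n).length = n * (D + 1) := by
  induction n with
  | zero => simp [searchProg]
  | succ n ih => simp [searchProg, ih, length_digitProg]; ring

theorem length_searchBits (D : ℕ) (e : ℕ → ℕ) (mark : ℕ → Bool) (j n : ℕ) :
    (searchBits D e mark j n).length = n * (D + 1) := by
  induction n generalizing j with
  | zero => simp [searchBits]
  | succ n ih => simp [searchBits, ih, length_digitBits]; ring

theorem scan_search (D : ℕ) (e : ℕ → ℕ) (he : StrictMono e) (mark : ℕ → Bool) (n : ℕ)
    (hgap : n ≤ 1 ∨ ∀ j, e (j + 1) - e j < 2 ^ D) (i j : ℕ) :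
    scan (searchProg D n) (searchBits D e mark j n) ((i : ℤ) - e j) =
      ∑ l ∈ range n, if mark (e (j + l)) = true ∧ i = e (j + l) then 1 else 0 := by
  induction n generalizing j with
  | zero => simp [searchProg, searchBits, scan]
  | succ n ih =>
    rw [Finset.sum_range_succ']
    simp only [searchProg, searchBits, scan, scan_digits, true_and, add_zero]
    rw [add_comm]
    congr 1
    · rcases Nat.eq_zero_or_pos n with rfl | hn
      · simp [searchProg, searchBits, scan]
      have hg : ∀ j, e (j + 1) - e j < 2 ^ D := hgap.resolve_left (by omega)
      rw [Nat.mod_eq_of_lt (hg j)]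
      have h1 : e j ≤ e (j + 1) := he.monotone (by omega)
      have h2 : ((i : ℤ) - e j - if mark (e j) = true then ((0 : ℕ) : ℤ) else 0) -
          ((e (j + 1) - e j : ℕ) : ℤ) = (i : ℤ) - e (j + 1) := by
        split_ifs <;> push_cast [h1] <;> ring
      rw [h2, ih (Or.inr hg)]
      refine Finset.sum_congr rfl fun l _ => ?_
      rw [show j + 1 + l = j + (l + 1) by ring]
    · refine if_congr (and_congr Iff.rfl ?_) rfl rfl
      omega

/-- The indicator of a subset of an increasing sequence, grouped into `W²L` blocks of length `n`. -/
theorem exists_net_indicator_of_seq {e : ℕ → ℕ} (he : StrictMono e) (he0 : e 0 = 0) {S : Finset ℕ}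
    (hS : ∀ i ∈ S, ∃ j, e j = i) {n D : ℕ} (hn : 1 ≤ n)
    (hgap : n ≤ 1 ∨ ∀ j, e (j + 1) - e j < 2 ^ D) {W L N : ℕ} (hW : 1 ≤ W)
    (hN : N ≤ e (n * (W * W * L))) :
    ∃ φ : (Unit → ℝ) → ℝ, IsNet1 (20 * W) (3 * L + 2 * (n * (D + 1))) φ ∧
      ∀ i < N, φ (fun _ => (i : ℝ)) = if i ∈ S then 1 else 0 := by
  have ha : StrictMono fun g => e (n * g) := fun g g' h => he (by gcongr)
  obtain ⟨ψ₁, h1, v1⟩ := exists_net_step W L hW _ ha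
    (fun g => (bitCode (searchBits D e (fun i => decide (i ∈ S)) (n * g) n) : ℝ))
    (fun _ => by positivity)
  obtain ⟨ψ₂, h2, v2⟩ := exists_net_step W L hW _ ha (fun g => (e (n * g) : ℝ))
    (fun _ => by positivity)
  obtain ⟨Φ, hΦ, vΦ⟩ := exists_net_scan (searchProg D n)
  rw [length_searchProg] at hΦ vΦ
  let F : (Unit → ℝ) → Fin 3 → ℝ := fun x => ![ψ₁ x, x () - ψ₂ x, 0]
  have hF : IsNet (20 * W) (3 * L) F := by
    refine IsNet.pi (w := ![4 * W + 4, 2 + (4 * W + 4), 2]) ?_ ?_ (φ := fun o x => F x o)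
    · simp only [Fin.sum_univ_three]
      simp
      omega
    · intro o
      fin_cases o
      · exact h1
      · exact (IsNet1.aff le_rfl _ (IsAff.coord ())).sub h2
      · exact IsNet1.aff le_rfl _ (IsAff.const 0)
  refine ⟨fun x => Φ (F x), hF.comp (IsNet1.mono (by omega) hΦ), fun i hi => ?_⟩
  have hex : ∃ g, i < e (n * (g + 1)) := ⟨i, (Nat.lt_succ_self i).trans_le
    ((Nat.le_mul_of_pos_left (i + 1) hn).trans he.le_apply)⟩
  obtain ⟨g, hg, hmin⟩ : ∃ g, i < e (n * (g + 1)) ∧ ∀ g' < g, ¬ i < e (n * (g' + 1)) :=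
    ⟨Nat.find hex, Nat.find_spec hex, fun _ h => Nat.find_min hex h⟩
  have hge : e (n * g) ≤ i := by
    rcases g with _ | g
    · simp [he0]
    · exact not_lt.1 (hmin g (Nat.lt_succ_self g))
  have hgl : g < W * W * L := by
    by_contra! hcon
    have := he.monotone (Nat.mul_le_mul_left n hcon)
    omega
  have hFv : F (fun _ => (i : ℝ)) =
      ![(bitCode (searchBits D e (fun i => decide (i ∈ S)) (n * g) n) : ℝ),
        (((i : ℤ) - (e (n * g) : ℤ) : ℤ) : ℝ), 0] := by
    simp only [F, v1 i g hgl hge hg, v2 i g hgl hge hg]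
    push_cast
    rfl
  beta_reduce
  rw [hFv, vΦ _ (length_searchBits ..), scan_search D e he _ n hgap, zero_add]
  simp only [decide_eq_true_eq]
  split_ifs with hiS
  · obtain ⟨j, rfl⟩ := hS i hiS
    have hj1 := he.le_iff_le.1 hge
    have hj2 := he.lt_iff_lt.1 hg
    rw [mul_add, mul_one] at hj2
    rw [Finset.sum_eq_single (j - n * g)]
    · rw [Nat.add_sub_cancel' hj1]
      simp [hiS]
    · intro l _ hl
      refine if_neg ?_
      rintro ⟨-, h⟩
      have := he.injective h
      omega
    · intro h
      simp at h
      omega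
  · refine Finset.sum_eq_zero fun l _ => if_neg ?_
    rintro ⟨h, rfl⟩
    exact hiS h

theorem exists_net_indicator_of_pred (P : ℕ → Prop) [DecidablePred P]
    (hinf : (Set.ofPred P).Infinite) (h0 : P 0) {S : Finset ℕ} (hS : ∀ i ∈ S, P i) {n D : ℕ}
    (hn : 1 ≤ n) (hgap : n ≤ 1 ∨ ∀ i, ∃ j, P j ∧ i < j ∧ j < i + 2 ^ D) {W L N : ℕ} (hW : 1 ≤ W)
    (hN : Nat.count P N ≤ n * (W * W * L)) :
    ∃ φ : (Unit → ℝ) → ℝ, IsNet1 (20 * W) (3 * L + 2 * (n * (D + 1))) φ ∧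
      ∀ i < N, φ (fun _ => (i : ℝ)) = if i ∈ S then 1 else 0 := by
  refine exists_net_indicator_of_seq (Nat.nth_strictMono hinf) ?_
    (fun i hi => ⟨_, Nat.nth_count (hS i hi)⟩) hn ?_ hW
    ((Nat.count_le_iff_le_nth hinf).1 hN)
  · simpa using Nat.nth_count h0
  · refine hgap.imp_right fun h j => ?_
    obtain ⟨m, hm, h1, h2⟩ := h (Nat.nth P j)
    have h3 : Nat.nth P (j + 1) ≤ m := by
      rw [← Nat.nth_count hm] at h1 ⊢
      exact (Nat.nth_strictMono hinf).monotone ((Nat.nth_strictMono hinf).lt_iff_lt.1 h1)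
    omega

theorem exists_net_indicator_of_card_le {S : Finset ℕ} {W L N : ℕ} (hW : 1 ≤ W) (hL : 1 ≤ L)
    (hM : #S ≤ W * W * L) :
    ∃ φ : (Unit → ℝ) → ℝ, IsNet1 (40 * W) (5 * L) φ ∧
      ∀ i < N, φ (fun _ => (i : ℝ)) = if i ∈ S then 1 else 0 := by
  classical
  have hcount : Nat.count (fun i => i ∈ S ∨ i = 0 ∨ N ≤ i) N ≤ 1 * (2 * W * (2 * W) * L) := by
    rw [Nat.count_eq_card_filter_range]
    have hsub : {i ∈ range N | i ∈ S ∨ i = 0 ∨ N ≤ i} ⊆ insert 0 S := by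
      intro i
      simp only [Finset.mem_filter, Finset.mem_range, Finset.mem_insert]
      rintro ⟨h, h' | h' | h'⟩
      · exact Or.inr h'
      · exact Or.inl h'
      · omega
    have := (Finset.card_le_card hsub).trans (Finset.card_insert_le _ _)
    have : 1 ≤ W * W * L := Nat.mul_pos (Nat.mul_pos hW hW) hL
    nlinarith
  obtain ⟨φ, h1, h2⟩ := exists_net_indicator_of_pred (fun i => i ∈ S ∨ i = 0 ∨ N ≤ i)
    ((Set.Ici_infinite N).mono fun i hi => Or.inr (Or.inr hi)) (Or.inr (Or.inl rfl)) (S := S)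
    (fun i hi => Or.inl hi) (n := 1) (D := 0) le_rfl (Or.inl le_rfl) (W := 2 * W) (L := L) (N := N)
    (by omega) hcount
  exact ⟨φ, h1.deepen (by omega) (by omega) (by omega), h2⟩

theorem exists_net_indicator_of_two_pow {S : Finset ℕ} {W L N b n : ℕ} (hW : 1 ≤ W) (hn : 1 ≤ n)
    (hS : S.Nonempty) (hN : N ≤ 2 ^ b * #S) (hM : 3 * #S ≤ n * (W * W * L)) :
    ∃ φ : (Unit → ℝ) → ℝ, IsNet1 (20 * W) (3 * L + 2 * (n * (b + 2))) φ ∧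
      ∀ i < N, φ (fun _ => (i : ℝ)) = if i ∈ S then 1 else 0 := by
  classical
  have hpos : 0 < 2 ^ b := by positivity
  refine exists_net_indicator_of_pred (fun i => i ∈ S ∨ 2 ^ b ∣ i)
    ?_ (Or.inr (dvd_zero _)) (S := S)
    (fun i hi => Or.inl hi) (n := n) (D := b + 1) hn (Or.inr fun i => ?_) (W := W) (L := L) (N := N)
    hW (le_trans ?_ hM)
  · refine (Set.infinite_range_of_injective (f := fun i : ℕ => 2 ^ b * i) fun i j h => ?_).mono ?_
    · exact Nat.eq_of_mul_eq_mul_left hpos h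
    · rintro _ ⟨i, rfl⟩
      exact Or.inr (dvd_mul_right _ _)
  · refine ⟨2 ^ b * (i / 2 ^ b + 1), Or.inr (dvd_mul_right _ _), ?_, ?_⟩
    · exact Nat.lt_mul_div_succ i hpos
    · have := Nat.mul_div_le i (2 ^ b)
      rw [mul_add, pow_succ]
      omega
  · rw [Nat.count_eq_card_filter_range]
    have hsub : {i ∈ range N | i ∈ S ∨ 2 ^ b ∣ i} ⊆
        S ∪ (range (N / 2 ^ b + 1)).image fun i => 2 ^ b * i := by
      intro i
      simp only [Finset.mem_filter, Finset.mem_range, Finset.mem_union, Finset.mem_image]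
      rintro ⟨h, h' | ⟨c, rfl⟩⟩
      · exact Or.inl h'
      · refine Or.inr ⟨c, Nat.lt_succ_of_le ((Nat.le_div_iff_mul_le hpos).2 ?_), rfl⟩
        rw [mul_comm]
        exact h.le
    have h1 := (Finset.card_le_card hsub).trans (Finset.card_union_le _ _)
    have h2 : #((range (N / 2 ^ b + 1)).image fun i => 2 ^ b * i) ≤ N / 2 ^ b + 1 := by
      simpa using Finset.card_image_le (s := range (N / 2 ^ b + 1)) (f := fun i => 2 ^ b * i)
    have h3 : N / 2 ^ b ≤ #S := Nat.div_le_of_le_mul hN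
    have h4 := hS.card_pos
    omega

/-- A sparse set of integers has an indicator that is cheap to compute. -/
theorem exists_net_indicator {α : ℝ} (hα : 0 < α) :
    ∃ C : ℕ, 1 ≤ C ∧ ∀ (W L N : ℕ) (S : Finset ℕ), 1 ≤ W → 1 ≤ L → S.Nonempty → #S ≤ N →
      (#S : ℝ) ^ (1 - α) * (N : ℝ) ^ α ≤ ((W : ℝ) * L) ^ 2 →
      ∃ φ : (Unit → ℝ) → ℝ, IsNet1 (C * W) (C * L) φ ∧
        ∀ i < N, φ (fun _ => (i : ℝ)) = if i ∈ S then 1 else 0 := by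
  obtain ⟨c, hc⟩ := exists_nat_ge (1 / (α * Real.log 2) + 3)
  have hlog : 0 < Real.log 2 := Real.log_pos one_lt_two
  have hc3 : (3 : ℝ) ≤ c := le_trans (by have : 0 < 1 / (α * Real.log 2) := by positivity
                                         linarith) hc
  have hc3' : 3 ≤ c := by exact_mod_cast hc3
  refine ⟨60 * c, by omega, fun W L N S hW hL hS hSN hM => ?_⟩
  rcases le_or_gt #S (W * W * L) with h | h
  · obtain ⟨φ, h1, h2⟩ := exists_net_indicator_of_card_le (N := N) hW hL h
    exact ⟨φ, h1.deepen (by nlinarith) (by nlinarith) (by nlinarith), h2⟩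
  have hS0 : (0 : ℝ) < #S := by exact_mod_cast hS.card_pos
  have hN0 : (0 : ℝ) < N := hS0.trans_le (by exact_mod_cast hSN)
  set X : ℝ := N / #S with hX
  have hX1 : 1 ≤ X := (one_le_div hS0).2 (by exact_mod_cast hSN)
  have hX0 : 0 < X := by linarith
  have hMX : (#S : ℝ) * X ^ α ≤ ((W : ℝ) * L) ^ 2 := by
    convert hM using 1
    rw [hX, Real.div_rpow hN0.le hS0.le, Real.rpow_sub hS0, Real.rpow_one]
    ring
  have hXα0 : 1 ≤ X ^ α := Real.one_le_rpow hX1 hα.le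
  have hWr : (1 : ℝ) ≤ W := by exact_mod_cast hW
  have hLr : (1 : ℝ) ≤ L := by exact_mod_cast hL
  have hXL : X ^ α ≤ L := by
    have h' : (W : ℝ) * W * L < #S := by exact_mod_cast h
    have h2 : (0 : ℝ) < W * W * L := by positivity
    by_contra! hcon
    nlinarith [mul_lt_mul'' h' hcon h2.le (by positivity)]
  obtain ⟨b, hb1, hb2⟩ := exists_nat_pow_near hX1 one_lt_two
  have hbX : (b : ℝ) + 3 ≤ c * X ^ α := by
    have h1 : (b : ℝ) * (α * Real.log 2) ≤ X ^ α := by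
      calc (b : ℝ) * (α * Real.log 2) ≤ Real.exp (b * (α * Real.log 2)) := by
            linarith [Real.add_one_le_exp (b * (α * Real.log 2))]
        _ = ((2 : ℝ) ^ b) ^ α := by
            rw [← Real.rpow_natCast, ← Real.rpow_mul (by norm_num), Real.rpow_def_of_pos two_pos]
            ring_nf
        _ ≤ X ^ α := Real.rpow_le_rpow (by positivity) hb1 hα.le
    have h2 : (b : ℝ) ≤ 1 / (α * Real.log 2) * X ^ α := by
      rw [one_div_mul_eq_div, le_div_iff₀ (by positivity)]
      exact h1
    nlinarith
  set n := L / (b + 3) + 1 with hn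
  have hnL : (L : ℝ) ≤ n * (b + 3) := by
    have := Nat.lt_mul_div_succ L (show 0 < b + 3 by omega)
    rw [mul_comm] at this
    exact_mod_cast this.le
  have hNb : N ≤ 2 ^ (b + 1) * #S := by
    have : (N : ℝ) ≤ 2 ^ (b + 1) * #S := by
      rw [← div_le_iff₀ hS0]
      exact hb2.le
    exact_mod_cast this
  have hSn : 3 * #S ≤ n * (3 * c * W * (3 * c * W) * L) := by
    have h5 : 3 * (#S : ℝ) ≤ n * (3 * c * W * (3 * c * W) * L) := by
      have h6 : (L : ℝ) ≤ n * (c * X ^ α) := hnL.trans (by gcongr)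
      have h7 : (#S : ℝ) * X ^ α ≤ (W * W * L * (n * c)) * X ^ α := by
        calc (#S : ℝ) * X ^ α ≤ ((W : ℝ) * L) ^ 2 := hMX
          _ = W * W * L * L := by ring
          _ ≤ W * W * L * (n * (c * X ^ α)) := by gcongr
          _ = _ := by ring
      have h8 := le_of_mul_le_mul_right h7 (by linarith)
      have h9 : (0 : ℝ) ≤ W * W * L * (n * c) := by positivity
      nlinarith
    exact_mod_cast h5
  obtain ⟨φ, h1, h2⟩ := exists_net_indicator_of_two_pow (W := 3 * c * W) (L := L) (N := N)
    (b := b + 1) (n := n) (by nlinarith) (Nat.le_add_left _ _) hS hNb hSn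
  refine ⟨φ, h1.deepen ?_ (le_of_eq (by ring)) (by nlinarith), h2⟩
  have h3 : n * (b + 3) ≤ L + (b + 3) := by
    have := Nat.div_mul_le_self L (b + 3)
    rw [hn, add_mul]
    omega
  have h4 : b + 3 ≤ c * L := by
    have : (b : ℝ) + 3 ≤ c * L := hbX.trans (by gcongr)
    exact_mod_cast this
  nlinarith

/-- The index of the dyadic interval of length `2⁻ᵏ` containing `y`, clamped to `[0, 2ᵏ - 1]`. -/
def dyadicIdx (k : ℕ) (y : ℝ) : Fin (2 ^ k) :=
  ⟨min ⌊2 ^ k * y⌋₊ (2 ^ k - 1), by have := Nat.two_pow_pos k; omega⟩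

theorem le_dyadicIdx_iff {k t : ℕ} {y : ℝ} :
    t ≤ (dyadicIdx k y : ℕ) ↔ t = 0 ∨ t < 2 ^ k ∧ (t : ℝ) ≤ 2 ^ k * y := by
  have := Nat.two_pow_pos k
  rcases Nat.eq_zero_or_pos t with rfl | ht
  · simp
  · simp only [dyadicIdx, le_min_iff, Nat.le_floor_iff' ht.ne']
    constructor
    · rintro ⟨h1, h2⟩
      exact Or.inr ⟨by omega, h1⟩
    · rintro (h | ⟨h1, h2⟩)
      · omega
      · exact ⟨h2, by omega⟩

theorem dyadicIdx_le_of_pos {k : ℕ} {y : ℝ} (h : 0 < (dyadicIdx k y : ℕ)) :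
    ((dyadicIdx k y : ℕ) : ℝ) ≤ 2 ^ k * y :=
  ((le_dyadicIdx_iff.1 le_rfl).resolve_left h.ne').2

theorem lt_dyadicIdx_add_one {k : ℕ} {y : ℝ} (h : (dyadicIdx k y : ℕ) + 1 < 2 ^ k) :
    2 ^ k * y < (dyadicIdx k y : ℕ) + 1 := by
  by_contra! hcon
  have := le_dyadicIdx_iff (t := (dyadicIdx k y : ℕ) + 1).2 (Or.inr ⟨h, by exact_mod_cast hcon⟩)
  omega

theorem dyadicIdx_add (m k : ℕ) (y : ℝ) :
    (dyadicIdx (m + k) y : ℕ) =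
      2 ^ k * (dyadicIdx m y : ℕ) + dyadicIdx k (2 ^ m * y - (dyadicIdx m y : ℕ)) := by
  set D := (dyadicIdx m y : ℕ) with hD
  have hDlt : D < 2 ^ m := (dyadicIdx m y).2
  have hk := Nat.two_pow_pos k
  have hkr : (0 : ℝ) < 2 ^ k := by positivity
  refine eq_of_forall_le_iff fun t => ?_
  rw [le_dyadicIdx_iff]
  rcases le_or_gt t (2 ^ k * D) with h | h
  · refine iff_of_true ?_ (by omega)
    rcases Nat.eq_zero_or_pos t with ht | ht
    · exact Or.inl ht
    · have hDpos : 0 < D := Nat.pos_of_ne_zero (by rintro h0; simp [h0] at h; omega)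
      have h1 := dyadicIdx_le_of_pos hDpos
      refine Or.inr ⟨?_, ?_⟩
      · calc t ≤ 2 ^ k * D := h
          _ < 2 ^ k * 2 ^ m := by gcongr
          _ = 2 ^ (m + k) := by ring
      · calc (t : ℝ) ≤ 2 ^ k * D := by exact_mod_cast h
          _ ≤ 2 ^ k * (2 ^ m * y) := by gcongr
          _ = 2 ^ (m + k) * y := by ring
  · obtain ⟨u, rfl⟩ := Nat.exists_eq_add_of_lt h
    rw [add_assoc, add_le_add_iff_left, le_dyadicIdx_iff]
    have e2 : ((2 ^ k * D + (u + 1) : ℕ) : ℝ) ≤ 2 ^ (m + k) * y ↔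
        ((u + 1 : ℕ) : ℝ) ≤ 2 ^ k * (2 ^ m * y - D) := by
      push_cast
      rw [mul_sub, pow_add]
      constructor <;> intro h <;> linarith
    rw [e2]
    simp only [Nat.add_eq_zero_iff, one_ne_zero, and_false, false_or, Nat.mul_eq_zero]
    refine and_congr_left fun h3 => ⟨fun h1 => ?_, fun h1 => ?_⟩
    · by_contra! hcon
      have hy : (D : ℝ) + 1 ≤ 2 ^ m * y := by
        have : (2 : ℝ) ^ k ≤ (u + 1 : ℕ) := by exact_mod_cast hcon
        have : (2 : ℝ) ^ k * 1 ≤ 2 ^ k * (2 ^ m * y - D) := by linarith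
        linarith [le_of_mul_le_mul_left this hkr]
      rcases lt_or_ge (D + 1) (2 ^ m) with h4 | h4
      · linarith [lt_dyadicIdx_add_one h4]
      · have : 2 ^ k * 2 ^ m ≤ 2 ^ k * (D + 1) := by gcongr
        rw [pow_add, mul_comm (2 ^ m), mul_add] at *
        omega
    · calc 2 ^ k * D + (u + 1) < 2 ^ k * D + 2 ^ k := by gcongr
        _ = 2 ^ k * (D + 1) := by ring
        _ ≤ 2 ^ k * 2 ^ m := by gcongr; exact hDlt
        _ = 2 ^ (m + k) := by ring

/-- The points just to the left of an interior breakpoint of the dyadic grid of level `k`. -/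
def trifling (k : ℕ) (ε : ℝ) : Set ℝ :=
  {y | ∃ n : ℕ, 1 ≤ n ∧ n < 2 ^ k ∧ n / 2 ^ k - ε < y ∧ y < n / 2 ^ k}

theorem trifling_mono {k R : ℕ} (h : k ≤ R) (ε : ℝ) : trifling k ε ⊆ trifling R ε := by
  obtain ⟨m, rfl⟩ := Nat.exists_eq_add_of_le h
  rintro y ⟨n, h1, h2, h3, h4⟩
  have e : ((n * 2 ^ m : ℕ) : ℝ) / 2 ^ (k + m) = n / 2 ^ k := by
    push_cast
    rw [pow_add]
    field_simp
  refine ⟨n * 2 ^ m, Nat.mul_pos h1 (by positivity), ?_, ?_, ?_⟩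
  · rw [pow_add]
    gcongr
  · rwa [e]
  · rwa [e]

/-- The clamped linear function that rises from `0` at `-ε` to `1` at `0`. -/
def ramp (ε t : ℝ) : ℝ := relu (ε⁻¹ * t + 1) - relu (ε⁻¹ * t)

theorem IsNet1.ramp {ι : Type} [Fintype ι] (ε : ℝ) {φ : (ι → ℝ) → ℝ} (h : IsAff φ) :
    IsNet1 2 1 (fun x => ramp ε (φ x)) :=
  (IsNet1.relu_aff ((h.smul _).add (IsAff.const 1))).sub (IsNet1.relu_aff (h.smul _))

theorem ramp_eq {ε t : ℝ} (hε : 0 < ε) (h : ¬ (-ε < t ∧ t < 0)) :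
    ramp ε t = if 0 ≤ t then 1 else 0 := by
  have hi : 0 < ε⁻¹ := inv_pos.2 hε
  unfold ramp relu
  split_ifs with ht
  · have : 0 ≤ ε⁻¹ * t := by positivity
    rw [max_eq_left (by linarith), max_eq_left this]
    ring
  · have h1 : t ≤ -ε := by
      by_contra! hcon
      exact h ⟨hcon, by linarith⟩
    have h2 : ε⁻¹ * t ≤ -1 := by
      calc ε⁻¹ * t ≤ ε⁻¹ * -ε := by gcongr
        _ = -1 := by field_simp
    rw [max_eq_right (by linarith), max_eq_right (by linarith)]
    ring

/-- A one-layer network for `dyadicIdx m`. -/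
def rampIdx (m : ℕ) (ε y : ℝ) : ℝ :=
  ∑ t : Fin (2 ^ m), (if (t : ℕ) = 0 then 0 else 1) * ramp ε (y - (t : ℕ) / 2 ^ m)

theorem IsNet1.rampIdx {ι : Type} [Fintype ι] (m : ℕ) (ε : ℝ) {φ : (ι → ℝ) → ℝ} (h : IsAff φ) :
    IsNet1 (2 * 2 ^ m) 1 (fun x => rampIdx m ε (φ x)) := by
  have := IsNet1.sum (J := Fin (2 ^ m)) (W := 2 * 2 ^ m) (L := 1) (w := fun _ => 2)
    (by simp [mul_comm]) (fun t => IsNet1.ramp ε (h.sub (IsAff.const ((t : ℕ) / 2 ^ m))))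
    (fun t => if (t : ℕ) = 0 then 0 else 1) 0
  simpa [_root_.rampIdx] using this

theorem rampIdx_eq {m : ℕ} {ε y : ℝ} (hε : 0 < ε) (hy : y ∉ trifling m ε) :
    rampIdx m ε y = (dyadicIdx m y : ℕ) := by
  have h1 : ∀ t : Fin (2 ^ m), (if (t : ℕ) = 0 then (0 : ℝ) else 1) *
      ramp ε (y - (t : ℕ) / 2 ^ m) =
        if 0 < (t : ℕ) ∧ (t : ℕ) ≤ (dyadicIdx m y : ℕ) then 1 else 0 := by
    intro t
    rcases Nat.eq_zero_or_pos (t : ℕ) with h | h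
    · simp [h]
    · have h2 : (t : ℕ) ≤ (dyadicIdx m y : ℕ) ↔ 0 ≤ y - (t : ℕ) / 2 ^ m := by
        rw [le_dyadicIdx_iff, sub_nonneg, div_le_iff₀ (by positivity), mul_comm y]
        simp [h.ne', t.2]
      rw [ramp_eq hε, if_neg h.ne', one_mul]
      · simp [h2, h]
      · rintro ⟨h3, h4⟩
        exact hy ⟨t, h, t.2, by linarith, by linarith⟩
  unfold rampIdx
  simp only [h1]
  rw [Fin.sum_univ_eq_sum_range
    (fun t => if 0 < t ∧ t ≤ (dyadicIdx m y : ℕ) then (1 : ℝ) else 0), ← Finset.sum_filter]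
  have : (range (2 ^ m)).filter (fun t => 0 < t ∧ t ≤ (dyadicIdx m y : ℕ)) =
      Finset.Icc 1 (dyadicIdx m y : ℕ) := by
    ext t
    have := (dyadicIdx m y).2
    simp only [Finset.mem_filter, Finset.mem_range, Finset.mem_Icc]
    omega
  rw [this]
  simp

/-- Dyadic digits are extracted `m` at a time. -/
theorem exists_net_dyadicIdx (m j k : ℕ) (hk : k ≤ m * j) {ε : ℝ} (hε : 0 < ε) :
    ∃ Φ : (Fin 2 → ℝ) → ℝ, IsNet1 (8 * 2 ^ m) j Φ ∧
      ∀ y a, y ∉ trifling k ε → Φ ![y, a] = a + (dyadicIdx k y : ℕ) := by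
  induction j generalizing k ε with
  | zero =>
    obtain rfl : k = 0 := by simpa using hk
    refine ⟨fun x => x 1, fun _ => IsAff.coord 1, fun y a _ => ?_⟩
    simp
  | succ j ih =>
    obtain ⟨m', k', hm', hk', rfl⟩ : ∃ m' k', m' ≤ m ∧ k' ≤ m * j ∧ k = m' + k' := by
      refine ⟨min k m, k - min k m, min_le_right _ _, ?_, by omega⟩
      rw [mul_add] at hk
      omega
    have hB : (0 : ℝ) < 2 ^ m' := by positivity
    obtain ⟨Φ, hΦ, v⟩ := ih k' hk' (ε := 2 ^ m' * ε) (by positivity)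
    let f : (Fin 2 → ℝ) → Fin 2 → ℝ := fun x =>
      ![2 ^ m' * x 0 - rampIdx m' ε (x 0), x 1 + 2 ^ k' * rampIdx m' ε (x 0)]
    have hpow : 2 ^ m' ≤ 2 ^ m := Nat.pow_le_pow_right (by norm_num) hm'
    have h1 := Nat.two_pow_pos m'
    have hf : IsNet (8 * 2 ^ m) 1 f := by
      refine IsNet.pi (w := fun _ => 2 + 2 * 2 ^ m') ?_ ?_ (φ := fun o x => f x o)
      · simp
        omega
      · intro o
        fin_cases o
        · exact (IsNet1.aff_one ((IsAff.coord 0).smul _)).sub (IsNet1.rampIdx m' ε (IsAff.coord 0))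
        · exact (IsNet1.aff_one (IsAff.coord 1)).add
            ((IsNet1.rampIdx m' ε (IsAff.coord 0)).smul _)
    refine ⟨fun x => Φ (f x), by rw [add_comm]; exact IsNet1.comp hf hΦ, fun y a hy => ?_⟩
    have hr := rampIdx_eq hε (fun h => hy (trifling_mono (Nat.le_add_right m' k') ε h))
    have hfv : f ![y, a] = ![2 ^ m' * y - (dyadicIdx m' y : ℕ), a + 2 ^ k' * (dyadicIdx m' y : ℕ)] := by
      simp [f, hr]
    beta_reduce
    rw [hfv, v, dyadicIdx_add]
    · push_cast
      ring
    · rintro ⟨n, hn1, hn2, hn3, hn4⟩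
      have hD := (dyadicIdx m' y).2
      set D := (dyadicIdx m' y : ℕ)
      have e : ((2 ^ k' * D + n : ℕ) : ℝ) / 2 ^ (m' + k') = (D + n / 2 ^ k') / 2 ^ m' := by
        push_cast
        rw [pow_add]
        field_simp
      refine hy ⟨2 ^ k' * D + n, by omega, ?_, ?_, ?_⟩
      · calc 2 ^ k' * D + n < 2 ^ k' * D + 2 ^ k' := by gcongr
          _ = 2 ^ k' * (D + 1) := by ring
          _ ≤ 2 ^ k' * 2 ^ m' := by gcongr; exact hD
          _ = 2 ^ (m' + k') := by ring
      · rw [e, sub_lt_iff_lt_add, div_lt_iff₀ hB]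
        linarith
      · rw [e, lt_div_iff₀ hB]
        linarith

/-- The dyadic cube of level `k` containing `x`. -/
def dyadicCell {d : ℕ} (k : ℕ) (x : Fin d → ℝ) : Fin d → Fin (2 ^ k) := fun j => dyadicIdx k (x j)

theorem exists_net_dyadicCell_mem {d : ℕ} (hd : 1 ≤ d) {α : ℝ} (hα : 0 < α) (hα1 : α < 1) :
    ∃ C : ℕ, 1 ≤ C ∧ ∀ (W L k : ℕ) (S : Finset (Fin d → Fin (2 ^ k))) (ε : ℝ), 1 ≤ W → 1 ≤ L →
      0 < ε → S.Nonempty → (#S : ℝ) ^ (1 - α) * ((2 : ℝ) ^ (k * d)) ^ α ≤ ((W : ℝ) * L) ^ 2 →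
      ∃ φ : (Fin d → ℝ) → ℝ, IsNet1 (C * W) (C * L) φ ∧
        ∀ x, (∀ j, x j ∉ trifling k ε) → φ x = if dyadicCell k x ∈ S then 1 else 0 := by
  obtain ⟨C, hC, hind⟩ := exists_net_indicator hα
  obtain ⟨c, hc⟩ := exists_nat_ge (4 / α)
  have : Nonempty (Fin d) := ⟨⟨0, hd⟩⟩
  refine ⟨C + 16 * d + c, by omega, fun W L k S ε hW hL hε hS hM => ?_⟩
  let enc : (Fin d → Fin (2 ^ k)) ↪ ℕ := finFunctionFinEquiv.toEmbedding.trans Fin.valEmbedding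
  have hcard : #S ≤ 2 ^ (k * d) := by
    have := Finset.card_le_univ S
    simpa [pow_mul] using this
  obtain ⟨φ, h1, h2⟩ := hind W L (2 ^ (k * d)) (S.map enc) hW hL (by simpa using hS)
    (by simpa using hcard) (by simpa using hM)
  set m := Nat.log 2 W + 1 with hm
  have hm1 : 2 ^ m ≤ 2 * W := by
    rw [hm, pow_succ, mul_comm]
    gcongr
    exact Nat.pow_log_le_self 2 (by omega)
  have hm2 : W ≤ 2 ^ m := (Nat.lt_pow_succ_log_self one_lt_two W).le
  have hkm : k ≤ m * (c * L) := by
    have hS1 : (1 : ℝ) ≤ #S := by exact_mod_cast hS.card_pos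
    have hWm : (W : ℝ) ≤ 2 ^ m := by exact_mod_cast hm2
    have hLL : (L : ℝ) ≤ 2 ^ L := by exact_mod_cast Nat.lt_two_pow_self.le
    have h3 : (2 : ℝ) ^ (((k * d : ℕ) : ℝ) * α) ≤ 2 ^ ((2 * (m + L) : ℕ) : ℝ) := by
      rw [Real.rpow_mul (by norm_num), Real.rpow_natCast, Real.rpow_natCast]
      calc ((2 : ℝ) ^ (k * d)) ^ α ≤ (#S : ℝ) ^ (1 - α) * ((2 : ℝ) ^ (k * d)) ^ α :=
            le_mul_of_one_le_left (by positivity) (Real.one_le_rpow hS1 (by linarith))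
        _ ≤ ((W : ℝ) * L) ^ 2 := hM
        _ ≤ (2 ^ m * 2 ^ L) ^ 2 := by gcongr
        _ = 2 ^ (2 * (m + L)) := by ring
    rw [Real.rpow_le_rpow_left_iff one_lt_two] at h3
    have hd' : (1 : ℝ) ≤ d := by exact_mod_cast hd
    have hL' : (1 : ℝ) ≤ L := by exact_mod_cast hL
    have hm' : (1 : ℝ) ≤ m := by exact_mod_cast (show 1 ≤ m by omega)
    have hc' : 4 ≤ c * α := by rwa [div_le_iff₀ hα] at hc
    push_cast at h3
    have h4 : (k : ℝ) * α ≤ m * (c * L) * α := by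
      calc (k : ℝ) * α ≤ k * d * α := by
            gcongr
            exact le_mul_of_one_le_right (by positivity) hd'
        _ ≤ 2 * (m + L) := h3
        _ ≤ 4 * (m * L) := by nlinarith
        _ ≤ (c * α) * (m * L) := by gcongr
        _ = _ := by ring
    exact_mod_cast le_of_mul_le_mul_right h4 hα
  obtain ⟨Φ, hΦ, v⟩ := exists_net_dyadicIdx m (c * L) k hkm hε
  have hg : IsNet1 (d * (8 * 2 ^ m)) (c * L)
      (fun x : Fin d → ℝ => ∑ j : Fin d, ((2 ^ k) ^ (j : ℕ) : ℝ) * Φ ![x j, 0] + 0) := by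
    refine IsNet1.sum (w := fun _ => 8 * 2 ^ m) (by simp) (fun j => ?_) _ _
    refine IsNet.precomp hΦ (B := fun x => ![x j, 0]) fun o => ?_
    fin_cases o
    · exact IsAff.coord j
    · exact IsAff.const 0
  have hW1 : d * (8 * 2 ^ m) ≤ (C + 16 * d + c) * W := by nlinarith
  have hW2 : C * W ≤ (C + 16 * d + c) * W := by nlinarith
  have hcomp : IsNet1 ((C + 16 * d + c) * W) (c * L + C * L) (fun x : Fin d → ℝ =>
      φ fun _ => ∑ j : Fin d, ((2 ^ k) ^ (j : ℕ) : ℝ) * Φ ![x j, 0] + 0) :=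
    IsNet1.comp (hg.mono hW1) (h1.mono hW2)
  refine ⟨_, hcomp.deepen ?_ le_rfl ?_, fun x hx => ?_⟩
  · nlinarith
  · nlinarith
  · have henc : ∑ j : Fin d, ((2 ^ k) ^ (j : ℕ) : ℝ) * Φ ![x j, 0] + 0 =
        (enc (dyadicCell k x) : ℕ) := by
      simp only [v _ _ (hx _)]
      simp [enc, finFunctionFinEquiv, dyadicCell, mul_comm]
    rw [henc, h2]
    · simp
    · have := (finFunctionFinEquiv (dyadicCell k x)).2
      simpa [enc, pow_mul] using this

theorem exists_nat_sum_le {τ : Type} {s : Finset τ} {μ : τ → ℝ} {C V : ℕ} (hμ : ∀ t ∈ s, 0 ≤ μ t)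
    (hsum : ∑ t ∈ s, μ t ≤ C) (hV : ∀ t ∈ s, 1 ≤ C * (V : ℝ) ^ 4 * μ t ^ 4) :
    ∃ v : τ → ℕ, (∀ t ∈ s, 1 ≤ v t) ∧ (∀ t ∈ s, C * (V : ℝ) * μ t ^ 2 ≤ v t) ∧
      ∑ t ∈ s, v t ≤ C ^ 2 * (C + 1) * V := by
  refine ⟨fun t => ⌈C * (V : ℝ) * μ t ^ 2⌉₊, fun t ht => ?_, fun t _ => Nat.le_ceil _, ?_⟩
  · rw [Nat.one_le_ceil_iff]
    have h := hV t ht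
    by_contra! hcon
    have h0 : C * (V : ℝ) * μ t ^ 2 = 0 := le_antisymm hcon (by positivity)
    have : C * (V : ℝ) ^ 4 * μ t ^ 4 = (C * (V : ℝ) * μ t ^ 2) * ((V : ℝ) ^ 3 * μ t ^ 2) := by ring
    rw [this, h0, zero_mul] at h
    linarith
  · have hone : ∀ t ∈ s, (⌈C * (V : ℝ) * μ t ^ 2⌉₊ : ℝ) ≤ C * (C + 1) * V * μ t := by
      intro t ht
      have hμt := hμ t ht
      have hle : μ t ≤ C := (Finset.single_le_sum hμ ht).trans hsum
      have h1 : 1 ≤ C * (V : ℝ) * μ t := by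
        have h2 := hV t ht
        have hC : (1 : ℝ) ≤ C := by
          have : C ≠ 0 := by
            rintro rfl
            norm_num at h2
          exact_mod_cast Nat.one_le_iff_ne_zero.2 this
        by_contra! hcon
        have h3 : (C * (V : ℝ) * μ t) ^ 4 < 1 := pow_lt_one₀ (by positivity) hcon (by norm_num)
        have h4 : C * (V : ℝ) ^ 4 * μ t ^ 4 ≤ (C * (V : ℝ) * μ t) ^ 4 := by
          rw [mul_pow, mul_pow]
          gcongr
          exact le_self_pow₀ hC (by norm_num)
        linarith
      calc (⌈C * (V : ℝ) * μ t ^ 2⌉₊ : ℝ) ≤ C * (V : ℝ) * μ t ^ 2 + 1 :=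
            (Nat.ceil_lt_add_one (by positivity)).le
        _ ≤ C * (V : ℝ) * (C * μ t) + C * (V : ℝ) * μ t := by
            rw [sq]
            gcongr
        _ = _ := by ring
    have : ((∑ t ∈ s, ⌈C * (V : ℝ) * μ t ^ 2⌉₊ : ℕ) : ℝ) ≤ C ^ 2 * (C + 1) * V := by
      push_cast
      calc ∑ t ∈ s, (⌈C * (V : ℝ) * μ t ^ 2⌉₊ : ℝ) ≤ ∑ t ∈ s, C * (C + 1) * V * μ t :=
            Finset.sum_le_sum hone
        _ = C * (C + 1) * V * ∑ t ∈ s, μ t := by rw [Finset.mul_sum]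
        _ ≤ C * (C + 1) * V * C := by gcongr
        _ = _ := by ring
    exact_mod_cast this

/-- A weighted sum of indicators of sets of dyadic cubes. -/
def cellSum {d : ℕ} {τ : Type} (s : Finset τ) (k : τ → ℕ)
    (S : ∀ t, Finset (Fin d → Fin (2 ^ k t))) (c : τ → ℝ) (x : Fin d → ℝ) : ℝ :=
  ∑ t ∈ s, c t * if dyadicCell (k t) x ∈ S t then 1 else 0

theorem exists_net_cellSum_of_nonempty {d : ℕ} (hd : 1 ≤ d) {α : ℝ} (hα : 0 < α) (hα1 : α < 1)
    (C₀ : ℕ) :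
    ∃ C : ℕ, 1 ≤ C ∧ ∀ (W L : ℕ), 1 ≤ W → 1 ≤ L → ∀ (τ : Type) (s : Finset τ) (k : τ → ℕ)
      (S : ∀ t, Finset (Fin d → Fin (2 ^ k t))) (c μ : τ → ℝ), (∀ t ∈ s, (S t).Nonempty) →
      (∀ t ∈ s, 0 ≤ μ t) → ∑ t ∈ s, μ t ≤ C₀ →
      (∀ t ∈ s, (#(S t) : ℝ) ^ (1 - α) * ((2 : ℝ) ^ (k t * d)) ^ α ≤
        C₀ * ((W : ℝ) * L) ^ 2 * μ t ^ 4) → ∀ ε : ℝ, 0 < ε →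
      ∃ G : (Fin d → ℝ) → ℝ, IsNet1 (C * W) (C * L) G ∧
        ∀ x, (∀ t ∈ s, ∀ j, x j ∉ trifling (k t) ε) → G x = cellSum s k S c x := by
  obtain ⟨C, hC, hnet⟩ := exists_net_dyadicCell_mem hd hα hα1
  refine ⟨C * (C₀ ^ 2 * (C₀ + 1)) + C + 2 * d + 2, by omega,
    fun W L hW hL τ s k S c μ hS hμ hsum hM ε hε => ?_⟩
  set C' := C * (C₀ ^ 2 * (C₀ + 1)) + C + 2 * d + 2
  have hC'W : 2 ≤ C' * W := le_trans (by omega) (Nat.le_mul_of_pos_right C' hW)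
  rcases s.eq_empty_or_nonempty with rfl | hs
  · exact ⟨fun _ => 0, IsNet1.aff hC'W _ (IsAff.const 0), by simp [cellSum]⟩
  have hone : ∀ t ∈ s, 1 ≤ C₀ * ((W : ℝ) * L) ^ 2 * μ t ^ 4 := fun t ht => by
    refine le_trans ?_ (hM t ht)
    have h1 : (1 : ℝ) ≤ #(S t) := by exact_mod_cast (hS t ht).card_pos
    exact one_le_mul_of_one_le_of_one_le (Real.one_le_rpow h1 (by linarith))
      (Real.one_le_rpow (one_le_pow₀ one_le_two) hα.le)
  have hCsq : (C₀ : ℝ) ≤ (C₀ : ℝ) ^ 2 := by exact_mod_cast Nat.le_self_pow two_ne_zero C₀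
  rcases le_total L W with hWL | hWL
  · obtain ⟨v, hv1, hv2, hv3⟩ := exists_nat_sum_le (V := W) hμ hsum fun t ht =>
      (hone t ht).trans (by
        rw [show (W : ℝ) ^ 4 = (W * W) ^ 2 by ring]
        have := hμ t ht
        gcongr)
    have hex : ∀ t : s, ∃ φ : (Fin d → ℝ) → ℝ, IsNet1 (C * v t) (C * L) φ ∧
        ∀ x, (∀ j, x j ∉ trifling (k t) ε) →
          φ x = if dyadicCell (k t) x ∈ S t then 1 else 0 := fun t =>
      hnet (v t) L (k t) (S t) ε (hv1 t t.2) hL hε (hS t t.2) ((hM t t.2).trans (by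
        have := hv2 t t.2
        have := hμ t t.2
        calc C₀ * ((W : ℝ) * L) ^ 2 * μ t ^ 4 ≤ (C₀ : ℝ) ^ 2 * ((W : ℝ) * L) ^ 2 * μ t ^ 4 := by
              gcongr
          _ = ((C₀ * W * μ t ^ 2) * L) ^ 2 := by ring
          _ ≤ _ := by gcongr))
    choose φ h1 h2 using hex
    have := hs.to_subtype
    have hG := IsNet1.sum (J := s) (W := C' * W) (w := fun t => C * v t) ?_ h1 (fun t => c t) 0
    · refine ⟨_, hG.deepen (L' := C' * L) (by gcongr; omega) le_rfl hC'W, fun x hx => ?_⟩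
      rw [add_zero, cellSum, ← Finset.sum_coe_sort s]
      exact Finset.sum_congr rfl fun t _ => by rw [h2 t x (hx t t.2)]
    · rw [Finset.sum_coe_sort s (fun t => C * v t), ← Finset.mul_sum]
      calc C * ∑ t ∈ s, v t ≤ C * (C₀ ^ 2 * (C₀ + 1) * W) := by gcongr
        _ = C * (C₀ ^ 2 * (C₀ + 1)) * W := by ring
        _ ≤ C' * W := by gcongr; omega
  · obtain ⟨v, hv1, hv2, hv3⟩ := exists_nat_sum_le (V := L) hμ hsum fun t ht =>
      (hone t ht).trans (by
        rw [show (L : ℝ) ^ 4 = (L * L) ^ 2 by ring]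
        have := hμ t ht
        gcongr)
    have hex : ∀ t : τ, ∃ φ : (Fin d → ℝ) → ℝ, t ∈ s → IsNet1 (C * W) (C * v t) φ ∧
        ∀ x, (∀ j, x j ∉ trifling (k t) ε) →
          φ x = if dyadicCell (k t) x ∈ S t then 1 else 0 := fun t => by
      by_cases ht : t ∈ s
      · have := hv2 t ht
        have := hμ t ht
        obtain ⟨φ, h⟩ := hnet W (v t) (k t) (S t) ε hW (hv1 t ht) hε (hS t ht) ((hM t ht).trans (by
          calc C₀ * ((W : ℝ) * L) ^ 2 * μ t ^ 4 ≤ (C₀ : ℝ) ^ 2 * ((W : ℝ) * L) ^ 2 * μ t ^ 4 := by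
                gcongr
            _ = (W * (C₀ * L * μ t ^ 2)) ^ 2 := by ring
            _ ≤ _ := by gcongr))
        exact ⟨φ, fun _ => h⟩
      · exact ⟨0, fun h => absurd h ht⟩
    choose φ h12 using hex
    have hG := IsNet1.sum_seq s (φ := fun t x => c t * φ t x) fun t ht => ((h12 t ht).1).smul (c t)
    refine ⟨_, hG.deepen (L' := C' * L) (W' := C' * W) ?_ ?_ hC'W, fun x hx => ?_⟩
    · rw [← Finset.mul_sum]
      calc C * ∑ t ∈ s, v t ≤ C * (C₀ ^ 2 * (C₀ + 1) * L) := by gcongr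
        _ = C * (C₀ ^ 2 * (C₀ + 1)) * L := by ring
        _ ≤ C' * L := by gcongr; omega
    · rw [Fintype.card_fin]
      calc C * W + 2 * d + 2 ≤ C * W + 2 * d * W + 2 * W := by nlinarith
        _ = (C + 2 * d + 2) * W := by ring
        _ ≤ C' * W := by gcongr; omega
    · exact Finset.sum_congr rfl fun t ht => by rw [(h12 t ht).2 x (hx t ht)]

theorem exists_net_cellSum {d : ℕ} (hd : 1 ≤ d) {α : ℝ} (hα : 0 < α) (hα1 : α < 1) (C₀ : ℕ) :
    ∃ C : ℕ, 1 ≤ C ∧ ∀ (W L : ℕ), 1 ≤ W → 1 ≤ L → ∀ (τ : Type) (s : Finset τ) (k : τ → ℕ)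
      (S : ∀ t, Finset (Fin d → Fin (2 ^ k t))) (c μ : τ → ℝ),
      (∀ t ∈ s, 0 ≤ μ t) → ∑ t ∈ s, μ t ≤ C₀ →
      (∀ t ∈ s, (S t).Nonempty → (#(S t) : ℝ) ^ (1 - α) * ((2 : ℝ) ^ (k t * d)) ^ α ≤
        C₀ * ((W : ℝ) * L) ^ 2 * μ t ^ 4) → ∀ ε : ℝ, 0 < ε →
      ∃ G : (Fin d → ℝ) → ℝ, IsNet1 (C * W) (C * L) G ∧
        ∀ x, (∀ t ∈ s, ∀ j, x j ∉ trifling (k t) ε) → G x = cellSum s k S c x := by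
  classical
  obtain ⟨C, hC, hnet⟩ := exists_net_cellSum_of_nonempty hd hα hα1 C₀
  refine ⟨C, hC, fun W L hW hL τ s k S c μ hμ hsum hM ε hε => ?_⟩
  obtain ⟨G, h1, h2⟩ := hnet W L hW hL τ {t ∈ s | (S t).Nonempty} k S c μ
    (fun t ht => (Finset.mem_filter.1 ht).2) (fun t ht => hμ t (Finset.mem_filter.1 ht).1)
    ((Finset.sum_le_sum_of_subset_of_nonneg (Finset.filter_subset _ _)
      fun t ht _ => hμ t ht).trans hsum)
    (fun t ht => hM t (Finset.mem_filter.1 ht).1 (Finset.mem_filter.1 ht).2) ε hε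
  refine ⟨G, h1, fun x hx => ?_⟩
  rw [h2 x fun t ht => hx t (Finset.mem_filter.1 ht).1]
  refine Finset.sum_subset (Finset.filter_subset _ _) fun t ht ht' => ?_
  rw [if_neg, mul_zero]
  exact fun h => ht' (Finset.mem_filter.2 ⟨ht, _, h⟩)

namespace IsNet1

variable {ι : Type} [Fintype ι] {W L : ℕ} {φ ψ χ : (ι → ℝ) → ℝ}

theorem add_relu_sub {W₁ W₂ : ℕ} (h : IsNet1 W₁ L φ) (h' : IsNet1 W₂ L ψ) (hW : 3 ≤ W₁ + W₂)
    (b : ℝ) : IsNet1 (W₁ + W₂) (L + 1) (fun x => φ x + b * relu (b * (ψ x - φ x))) := by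
  have h1 : IsNet (W₁ + W₂) L (fun x => ![φ x, ψ x]) := by
    refine IsNet.pi (w := ![W₁, W₂]) (by simp) (φ := fun o x => (![φ x, ψ x] : Fin 2 → ℝ) o)
      fun o => ?_
    fin_cases o
    · exact h
    · exact h'
  have h2 : IsNet1 3 1 (fun y : Fin 2 → ℝ => y 0 + b * relu (b * (y 1 - y 0))) :=
    (aff_one (IsAff.coord 0)).add
      ((relu_aff (((IsAff.coord 1).sub (IsAff.coord 0)).smul b)).smul b)
  exact IsNet1.comp h1 (h2.mono hW)

theorem max {W₁ W₂ : ℕ} (h : IsNet1 W₁ L φ) (h' : IsNet1 W₂ L ψ) (hW : 3 ≤ W₁ + W₂) :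
    IsNet1 (W₁ + W₂) (L + 1) (fun x => max (φ x) (ψ x)) := by
  convert h.add_relu_sub h' hW 1 using 2 with x
  simp only [relu]
  rcases le_total (φ x) (ψ x) with h | h <;> simp [h]

theorem min {W₁ W₂ : ℕ} (h : IsNet1 W₁ L φ) (h' : IsNet1 W₂ L ψ) (hW : 3 ≤ W₁ + W₂) :
    IsNet1 (W₁ + W₂) (L + 1) (fun x => min (φ x) (ψ x)) := by
  convert h.add_relu_sub h' hW (-1) using 2 with x
  simp only [relu]
  rcases le_total (φ x) (ψ x) with h | h <;> simp [h]

end IsNet1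

/-- The median of three real numbers. -/
def median (a b c : ℝ) : ℝ := max (min a b) (min (max a b) c)

theorem IsNet1.median {ι : Type} [Fintype ι] {W L : ℕ} {φ ψ χ : (ι → ℝ) → ℝ} (hW : 2 ≤ W)
    (h₁ : IsNet1 W L φ) (h₂ : IsNet1 W L ψ) (h₃ : IsNet1 W L χ) :
    IsNet1 (5 * W) (L + 3) (fun x => median (φ x) (ψ x) (χ x)) := by
  have h4 := (h₁.min h₂ (by omega)).deepen (Nat.le_succ _) le_rfl (by omega)
  have h5 := (h₁.max h₂ (by omega)).min (h₃.deepen (Nat.le_succ _) le_rfl hW) (by omega)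
  exact (h4.max h5 (by omega)).mono (by omega)

theorem median_bounds {P Q : ℝ → Prop} (hP : ∀ a b, a ≤ b → P a → P b)
    (hQ : ∀ a b, a ≤ b → Q b → Q a) {a b c : ℝ}
    (h : P a ∧ Q a ∧ P b ∧ Q b ∨ P b ∧ Q b ∧ P c ∧ Q c ∨ P a ∧ Q a ∧ P c ∧ Q c) :
    P (median a b c) ∧ Q (median a b c) := by
  unfold median
  rcases le_total a b with h1 | h1 <;> rcases le_total b c with h2 | h2 <;>
    rcases le_total a c with h3 | h3 <;> simp only [h1, h2, h3, min_eq_left, min_eq_right,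
      max_eq_left, max_eq_right] <;> grind

/-- Taking medians of shifted copies coordinate by coordinate extends the control of a network
from the complement of a bad set to the whole space. -/
theorem exists_net_median {d : ℕ} {bad : Set ℝ} {ε : ℝ} (hε : 0 ≤ ε)
    (hbad : ∀ y, y - ε ∉ bad ∧ y ∉ bad ∨ y ∉ bad ∧ y + ε ∉ bad ∨ y - ε ∉ bad ∧ y + ε ∉ bad)
    {w ℓ : ℕ} (hw : 2 ≤ w) {G h : (Fin d → ℝ) → ℝ} (hG : IsNet1 w ℓ G)
    (hval : ∀ x, (∀ j, x j ∉ bad) → G x = h x) (j : ℕ) :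
    ∃ G' : (Fin d → ℝ) → ℝ, IsNet1 (5 ^ j * w) (ℓ + 3 * j) G' ∧
      ∀ x, (∀ i : Fin d, j ≤ i → x i ∉ bad) →
        (∃ y, ((∀ i, |y i - x i| ≤ ε) ∧ ∀ i : Fin d, j ≤ i → y i = x i) ∧ h y ≤ G' x) ∧
        ∃ y, ((∀ i, |y i - x i| ≤ ε) ∧ ∀ i : Fin d, j ≤ i → y i = x i) ∧ G' x ≤ h y := by
  induction j with
  | zero =>
    refine ⟨G, by simpa using hG, fun x hx => ?_⟩
    have := hval x fun j => hx j (Nat.zero_le _)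
    exact ⟨⟨x, by simp [hε], this.ge⟩, ⟨x, by simp [hε], this.le⟩⟩
  | succ j ih =>
    obtain ⟨G', hG', v⟩ := ih
    let sh : ℝ → (Fin d → ℝ) → Fin d → ℝ := fun δ x i => x i + if (i : ℕ) = j then δ else 0
    have hsh : ∀ δ, IsNet1 (5 ^ j * w) (ℓ + 3 * j) (fun x => G' (sh δ x)) := fun δ =>
      IsNet.precomp hG' fun i => (IsAff.coord i).add (IsAff.const _)
    refine ⟨fun x => median (G' (sh (-ε) x)) (G' (sh 0 x)) (G' (sh ε x)), ?_, fun x hx => ?_⟩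
    · have h5 : 2 ≤ 5 ^ j * w := hw.trans (Nat.le_mul_of_pos_left _ (by positivity))
      convert IsNet1.median h5 (hsh (-ε)) (hsh 0) (hsh ε) using 1
      · rw [pow_succ]
        ring
      · ring
    · have key : ∀ δ, |δ| ≤ ε → (∀ i : Fin d, (i : ℕ) = j → x i + δ ∉ bad) →
          (∃ y, ((∀ i, |y i - x i| ≤ ε) ∧ ∀ i : Fin d, j + 1 ≤ i → y i = x i) ∧
            h y ≤ G' (sh δ x)) ∧
          ∃ y, ((∀ i, |y i - x i| ≤ ε) ∧ ∀ i : Fin d, j + 1 ≤ i → y i = x i) ∧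
            G' (sh δ x) ≤ h y := by
        intro δ hδ hgood
        have hnear : ∀ y : Fin d → ℝ, ((∀ i, |y i - sh δ x i| ≤ ε) ∧ ∀ i : Fin d, j ≤ i → y i = sh δ x i) →
            (∀ i, |y i - x i| ≤ ε) ∧ ∀ i : Fin d, j + 1 ≤ i → y i = x i := by
          rintro y ⟨h1, h2⟩
          refine ⟨fun i => ?_, fun i hi => ?_⟩
          · by_cases hij : (i : ℕ) = j
            · rw [h2 i hij.ge]
              simpa [sh, hij] using hδ
            · simpa [sh, hij] using h1 i
          · rw [h2 i (by omega)]
            simp [sh, show (i : ℕ) ≠ j by omega]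
        obtain ⟨⟨y, hy, hy'⟩, ⟨z, hz, hz'⟩⟩ := v (sh δ x) fun i hi => by
          by_cases hij : (i : ℕ) = j
          · simpa [sh, hij] using hgood i hij
          · simpa [sh, hij] using hx i (by omega)
        exact ⟨⟨y, hnear y hy, hy'⟩, ⟨z, hnear z hz, hz'⟩⟩
      refine median_bounds
        (P := fun a => ∃ y, ((∀ i, |y i - x i| ≤ ε) ∧ ∀ i : Fin d, j + 1 ≤ i → y i = x i) ∧ h y ≤ a)
        (Q := fun a => ∃ y, ((∀ i, |y i - x i| ≤ ε) ∧ ∀ i : Fin d, j + 1 ≤ i → y i = x i) ∧ a ≤ h y)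
        (fun a b hab ⟨y, hy, hy'⟩ => ⟨y, hy, hy'.trans hab⟩)
        (fun a b hab ⟨y, hy, hy'⟩ => ⟨y, hy, hab.trans hy'⟩) ?_
      have k1 := key (-ε) (by simp [abs_of_nonneg hε])
      have k2 := key 0 (by simpa using hε)
      have k3 := key ε (by simp [abs_of_nonneg hε])
      by_cases hj : j < d
      · have hall : ∀ δ, x ⟨j, hj⟩ + δ ∉ bad → ∀ i : Fin d, (i : ℕ) = j → x i + δ ∉ bad := by
          rintro δ h1 i rfl
          exact h1
        rcases hbad (x ⟨j, hj⟩) with ⟨h1, h2⟩ | ⟨h1, h2⟩ | ⟨h1, h2⟩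
        · exact Or.inl ⟨(k1 (hall _ h1)).1, (k1 (hall _ h1)).2,
            (k2 (hall _ (by simpa using h2))).1, (k2 (hall _ (by simpa using h2))).2⟩
        · exact Or.inr (Or.inl ⟨(k2 (hall _ (by simpa using h1))).1,
            (k2 (hall _ (by simpa using h1))).2, (k3 (hall _ h2)).1, (k3 (hall _ h2)).2⟩)
        · exact Or.inr (Or.inr ⟨(k1 (hall _ h1)).1, (k1 (hall _ h1)).2, (k3 (hall _ h2)).1,
            (k3 (hall _ h2)).2⟩)
      · have hvac : ∀ δ, ∀ i : Fin d, (i : ℕ) = j → x i + δ ∉ bad := fun δ i hi =>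
          absurd i.2 (by omega)
        exact Or.inl ⟨(k1 (hvac _)).1, (k1 (hvac _)).2, (k2 (hvac _)).1, (k2 (hvac _)).2⟩

theorem trifling_two_of_three {R : ℕ} {ε : ℝ} (h3 : 3 * ε ≤ 1 / 2 ^ R) (y : ℝ) :
    y - ε ∉ trifling R ε ∧ y ∉ trifling R ε ∨ y ∉ trifling R ε ∧ y + ε ∉ trifling R ε ∨
      y - ε ∉ trifling R ε ∧ y + ε ∉ trifling R ε := by
  have key : ∀ u v, u + ε ≤ v → v ≤ u + 2 * ε → u ∈ trifling R ε → v ∉ trifling R ε := by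
    rintro u v h1 h2 ⟨n, -, -, h5, h6⟩ ⟨m, -, -, h9, h10⟩
    rcases le_or_gt m n with hmn | hmn
    · have : (m : ℝ) / 2 ^ R ≤ n / 2 ^ R := by gcongr
      linarith
    · have h11 : ((n + 1 : ℕ) : ℝ) / 2 ^ R ≤ m / 2 ^ R := by gcongr; exact hmn
      push_cast at h11
      rw [add_div] at h11
      linarith
  have hε : ∀ u, u ∈ trifling R ε → 0 ≤ ε := by
    rintro u ⟨n, -, -, h5, h6⟩
    linarith
  by_cases h1 : y - ε ∈ trifling R ε
  · have := hε _ h1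
    exact Or.inr (Or.inl ⟨key _ _ (by linarith) (by linarith) h1,
      key _ _ (by linarith) (by linarith) h1⟩)
  · by_cases h2 : y ∈ trifling R ε
    · have := hε _ h2
      exact Or.inr (Or.inr ⟨h1, key _ _ (by linarith) (by linarith) h2⟩)
    · exact Or.inl ⟨h1, h2⟩

/-- Sums of sparse indicators are computed by networks up to a small shift of the argument. -/
theorem exists_net_cellSum_shift {d : ℕ} (hd : 1 ≤ d) {α : ℝ} (hα : 0 < α) (hα1 : α < 1)
    (C₀ : ℕ) :
    ∃ C : ℕ, 1 ≤ C ∧ ∀ (W L : ℕ), 1 ≤ W → 1 ≤ L → ∀ (τ : Type) (s : Finset τ) (k : τ → ℕ)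
      (S : ∀ t, Finset (Fin d → Fin (2 ^ k t))) (c μ : τ → ℝ),
      (∀ t ∈ s, 0 ≤ μ t) → ∑ t ∈ s, μ t ≤ C₀ →
      (∀ t ∈ s, (S t).Nonempty → (#(S t) : ℝ) ^ (1 - α) * ((2 : ℝ) ^ (k t * d)) ^ α ≤
        C₀ * ((W : ℝ) * L) ^ 2 * μ t ^ 4) → ∀ R : ℕ, (∀ t ∈ s, k t ≤ R) →
      ∀ ε : ℝ, 0 < ε → 3 * ε ≤ 1 / 2 ^ R →
      ∃ G : (Fin d → ℝ) → ℝ, IsNet1 (C * W) (C * L) G ∧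
        ∀ x, (∃ y, (∀ i, |y i - x i| ≤ ε) ∧ cellSum s k S c y ≤ G x) ∧
          ∃ y, (∀ i, |y i - x i| ≤ ε) ∧ G x ≤ cellSum s k S c y := by
  obtain ⟨C, hC, hnet⟩ := exists_net_cellSum hd hα hα1 C₀
  refine ⟨5 ^ d * (C + 2) + 3 * d, by have : 0 < 5 ^ d * (C + 2) := by positivity
                                      omega,
    fun W L hW hL τ s k S c μ hμ hsum hM R hR ε hε h3 => ?_⟩
  obtain ⟨G, h1, h2⟩ := hnet W L hW hL τ s k S c μ hμ hsum hM ε hε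
  have hw : 2 ≤ (C + 2) * W := by nlinarith
  obtain ⟨G', h4, h5⟩ := exists_net_median hε.le (trifling_two_of_three h3) hw
    (h1.mono (W' := (C + 2) * W) (by gcongr; omega))
    (fun x hx => h2 x fun t ht j hj => hx j (trifling_mono (hR t ht) ε hj)) d
  have h6 : C ≤ 5 ^ d * (C + 2) := le_trans (by omega)
    (Nat.le_mul_of_pos_left (C + 2) (by positivity : 0 < 5 ^ d))
  refine ⟨G', h4.deepen ?_ ?_ ?_, fun x => ?_⟩
  · calc C * L + 3 * d ≤ C * L + 3 * d * L := by nlinarith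
      _ ≤ 5 ^ d * (C + 2) * L + 3 * d * L := by gcongr
      _ = _ := by ring
  · nlinarith
  · have : 0 < 5 ^ d := by positivity
    nlinarith
  · obtain ⟨⟨y, hy, hy'⟩, ⟨z, hz, hz'⟩⟩ := h5 x fun i hi => absurd i.2 (by omega)
    exact ⟨⟨y, hy.1, hy'⟩, ⟨z, hz.1, hz'⟩⟩

theorem sum_range_dist_le {g : ℕ → ℝ} {M : ℝ} (hg : ∀ n, 0 ≤ g n)
    (hM : ∀ n, ∑ i ∈ range n, g i ≤ M) (K n : ℕ) :
    ∑ k ∈ range n, g (K - k + (k - K)) ≤ 2 * M := by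
  calc ∑ k ∈ range n, g (K - k + (k - K))
      ≤ ∑ k ∈ range (K + 1 + n), g (K - k + (k - K)) :=
        Finset.sum_le_sum_of_subset_of_nonneg (Finset.range_subset_range.2 (by omega))
          fun _ _ _ => hg _
    _ = ∑ k ∈ range (K + 1), g (K - k) + ∑ i ∈ range n, g (i + 1) := by
        rw [Finset.sum_range_add]
        congr 1
        · refine Finset.sum_congr rfl fun k hk => ?_
          rw [Finset.mem_range] at hk
          rw [show K - k + (k - K) = K - k by omega]
        · refine Finset.sum_congr rfl fun k _ => ?_
          rw [show K - (K + 1 + k) + (K + 1 + k - K) = k + 1 by omega]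
    _ ≤ M + M := by
        refine add_le_add ?_ ?_
        · have := Finset.sum_range_reflect g (K + 1)
          simp only [Nat.add_sub_cancel] at this
          rw [this]
          exact hM _
        · have h1 := hM (n + 1)
          rw [Finset.sum_range_succ'] at h1
          linarith [hg 0]
    _ = 2 * M := by ring

theorem geom_sum_range_le {r : ℝ} (h0 : 0 ≤ r) (h1 : r < 1) (n : ℕ) :
    ∑ i ∈ range n, r ^ i ≤ (1 - r)⁻¹ := by
  rw [← tsum_geometric_of_lt_one h0 h1]
  exact (summable_geometric_of_lt_one h0 h1).sum_le_tsum _ fun i _ => by positivity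

theorem rpow_interpolate {N u v α τ : ℝ} (hN : 0 < N) (hτ : 0 ≤ τ) (hτα : τ ≤ 1 - α)
    (h1 : N ≤ 2 ^ u) (h2 : N ≤ 2 ^ (u + v)) :
    N ^ (1 - α) * ((2 : ℝ) ^ u) ^ α ≤ 2 ^ (u + τ * v) := by
  calc N ^ (1 - α) * ((2 : ℝ) ^ u) ^ α
      = N ^ (1 - α - τ) * N ^ τ * ((2 : ℝ) ^ u) ^ α := by
        rw [← Real.rpow_add hN]
        ring_nf
    _ ≤ ((2 : ℝ) ^ u) ^ (1 - α - τ) * ((2 : ℝ) ^ (u + v)) ^ τ * ((2 : ℝ) ^ u) ^ α := by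
        have h3 : 0 ≤ 1 - α - τ := by linarith
        gcongr
    _ = 2 ^ (u + τ * v) := by
        rw [← Real.rpow_mul two_pos.le, ← Real.rpow_mul two_pos.le, ← Real.rpow_mul two_pos.le,
          ← Real.rpow_add two_pos, ← Real.rpow_add two_pos]
        ring_nf

theorem sum_testBit (x J : ℕ) :
    ∑ j ∈ range J, 2 ^ j * (x.testBit j).toNat = x % 2 ^ J := by
  induction J with
  | zero => simp [Nat.mod_one]
  | succ J ih => rw [Finset.sum_range_succ, ih, mod_two_pow_succ_eq, add_comm]

/-- The multiple of `δ` next to `t`, towards zero. -/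
def roundTo (δ t : ℝ) : ℝ := (if 0 ≤ t then 1 else -1) * (δ * ⌊|t| / δ⌋₊)

theorem abs_sub_roundTo {δ : ℝ} (hδ : 0 < δ) (t : ℝ) :
    |t - roundTo δ t| ≤ δ ∧ |t - roundTo δ t| ≤ |t| := by
  have h1 : δ * ⌊|t| / δ⌋₊ ≤ |t| := by
    have := Nat.floor_le (show 0 ≤ |t| / δ by positivity)
    rwa [le_div_iff₀ hδ, mul_comm] at this
  have h2 : |t| < δ * ⌊|t| / δ⌋₊ + δ := by
    have := Nat.lt_floor_add_one (|t| / δ)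
    rw [div_lt_iff₀ hδ] at this
    linarith
  have h0 : 0 ≤ δ * ⌊|t| / δ⌋₊ := by positivity
  unfold roundTo
  split_ifs with ht
  · rw [abs_of_nonneg ht] at *
    constructor <;> rw [abs_le] <;> constructor <;> linarith
  · rw [abs_of_neg (not_le.1 ht)] at *
    constructor <;> rw [abs_le] <;> constructor <;> linarith

/-- The cells in which the quantized coefficient has binary digit `j` set and sign `b`. -/
def bitCells {d k : ℕ} (δ : ℝ) (D : (Fin d → Fin (2 ^ k)) → ℝ) (j : ℕ) (b : Bool) :
    Finset (Fin d → Fin (2 ^ k)) :=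
  {c | ⌊|D c| / δ⌋₊.testBit j = true ∧ (b = true ↔ 0 ≤ D c)}

theorem sum_bitCells {d k : ℕ} {δ : ℝ} {D : (Fin d → Fin (2 ^ k)) → ℝ} {J : ℕ}
    {c : Fin d → Fin (2 ^ k)} (hJ : ⌊|D c| / δ⌋₊ < 2 ^ J) :
    ∑ j ∈ range J, ∑ b : Bool, (if b then 1 else -1) * (δ * 2 ^ j) *
      (if c ∈ bitCells δ D j b then 1 else 0) = roundTo δ (D c) := by
  have h1 : ∀ j, ∑ b : Bool, (if b then (1 : ℝ) else -1) * (δ * 2 ^ j) *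
      (if c ∈ bitCells δ D j b then 1 else 0) =
        (if 0 ≤ D c then 1 else -1) * δ * ((2 ^ j * (⌊|D c| / δ⌋₊.testBit j).toNat : ℕ) : ℝ) := by
    intro j
    simp only [Fintype.sum_bool, bitCells, Finset.mem_filter, Finset.mem_univ, true_and]
    cases ⌊|D c| / δ⌋₊.testBit j <;> by_cases h : 0 ≤ D c <;> simp [h]
  simp only [h1, ← Finset.mul_sum]
  rw [← Nat.cast_sum, sum_testBit, Nat.mod_eq_of_lt hJ, roundTo]
  ring

theorem card_bitCells_le {d k : ℕ} {δ : ℝ} (hδ : 0 < δ) {D : (Fin d → Fin (2 ^ k)) → ℝ} {q M : ℝ}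
    (hq : 0 ≤ q) (hM : ∑ c, |D c| ^ q ≤ M) (j : ℕ) (b : Bool) :
    (#(bitCells δ D j b) : ℝ) * (2 ^ j * δ) ^ q ≤ M := by
  refine le_trans ?_ hM
  rw [← nsmul_eq_mul]
  refine (Finset.card_nsmul_le_sum (bitCells δ D j b) (fun c => |D c| ^ q) _ fun c hc => ?_).trans
    (Finset.sum_le_sum_of_subset_of_nonneg (Finset.subset_univ _) fun c _ _ => by positivity)
  have h1 : 2 ^ j ≤ ⌊|D c| / δ⌋₊ :=
    Nat.ge_two_pow_of_testBit ((Finset.mem_filter.1 hc).2.1)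
  have h2 : (2 : ℝ) ^ j ≤ |D c| / δ := by
    have := (Nat.le_floor_iff (by positivity)).1 h1
    exact_mod_cast this
  gcongr
  rwa [← le_div_iff₀ hδ]

/-- The quantization step at level `k`, when `2 ^ (d * K)` numbers can be stored. -/
def quantum (s ρ B : ℝ) (K k : ℕ) : ℝ :=
  B * 2 ^ (-(K * s) - s * (K - k : ℕ) + ρ * (k - K : ℕ))

theorem quantum_pos {s ρ B : ℝ} (hB : 0 < B) (K k : ℕ) : 0 < quantum s ρ B K k := by
  unfold quantum
  positivity

theorem exists_card_bound {d s q γ : ℝ} (hd : 0 < d) (hs : 0 < s) (hq : 1 ≤ q) (hγ : 0 < γ) :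
    ∃ α η : ℝ, 0 < α ∧ α < 1 ∧ 0 < η ∧ ∀ (K k j : ℕ) (N B : ℝ), 0 < N → 0 < B →
      N ≤ (2 : ℝ) ^ (k * d) →
      N * (2 ^ j * quantum s (d / q - s + γ / 2) B K k) ^ q ≤
        (2 : ℝ) ^ (k * d) * (B * 2 ^ (-(k * s))) ^ q →
      N ^ (1 - α) * ((2 : ℝ) ^ (k * d)) ^ α ≤
        2 ^ (K * d - η * ((K - k : ℕ) + (k - K : ℕ) + j)) := by
  have hq0 : 0 < q := by linarith
  have hqγ : 0 < q * γ := by positivity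
  set α := (q * γ / 4) / (d + q * γ / 2) with hα
  have hα0 : 0 < α := by positivity
  have hα1 : α ≤ 1 / 2 := by
    rw [hα, div_le_iff₀ (by positivity)]
    linarith
  have hαe : (1 - α) * (d + q * γ / 2) = d + q * γ / 4 := by
    rw [hα]
    field_simp
    ring
  set τ := min (1 / 2) (d / (4 * s * q)) with hτ
  have hτ0 : 0 < τ := by positivity
  have hτ1 : τ ≤ 1 / 2 := min_le_left _ _
  have hτ2 : τ * (2 * s * q) ≤ d / 2 := by
    have : τ ≤ d / (4 * s * q) := min_le_right _ _
    rw [le_div_iff₀ (by positivity)] at this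
    linarith
  set η := min (min (d / 2) (τ * q)) (min (q * γ / 4) (q / 2)) with hη
  have hη1 : η ≤ d / 2 := (min_le_left _ _).trans (min_le_left _ _)
  have hη2 : η ≤ τ * q := (min_le_left _ _).trans (min_le_right _ _)
  have hη3 : η ≤ q * γ / 4 := (min_le_right _ _).trans (min_le_left _ _)
  have hη4 : η ≤ q / 2 := (min_le_right _ _).trans (min_le_right _ _)
  refine ⟨α, η, hα0, by linarith, by positivity, fun K k j N B hN hB h1 h2 => ?_⟩
  have h3 : N ≤ 2 ^ (k * d + q * (-(k * s) - j + K * s + s * (K - k : ℕ) -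
      (d / q - s + γ / 2) * (k - K : ℕ))) := by
    have e1 : (2 ^ j * quantum s (d / q - s + γ / 2) B K k) ^ q = B ^ q *
        2 ^ (q * (j - K * s - s * (K - k : ℕ) + (d / q - s + γ / 2) * (k - K : ℕ))) := by
      rw [quantum, ← Real.rpow_natCast, mul_left_comm, ← Real.rpow_add two_pos,
        Real.mul_rpow hB.le (by positivity), ← Real.rpow_mul two_pos.le]
      ring_nf
    have e2 : (2 : ℝ) ^ (k * d) * (B * 2 ^ (-(k * s))) ^ q =
        B ^ q * 2 ^ (k * d + q * (-(k * s))) := by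
      rw [Real.mul_rpow hB.le (by positivity), ← Real.rpow_mul two_pos.le, Real.rpow_add two_pos]
      ring_nf
    rw [e1, e2, mul_left_comm, mul_le_mul_iff_right₀ (by positivity), ← le_div_iff₀ (by positivity),
      ← Real.rpow_sub two_pos] at h2
    refine h2.trans_eq ?_
    ring_nf
  rcases le_or_gt k K with hk | hk
  · obtain ⟨m, rfl⟩ := Nat.exists_eq_add_of_le hk
    refine (rpow_interpolate hN hτ0.le (by linarith) h1 h3).trans ?_
    refine Real.rpow_le_rpow_of_exponent_le one_le_two ?_
    rw [show k + m - k = m by omega, show k - (k + m) = 0 by omega]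
    push_cast
    have m0 : (0 : ℝ) ≤ m := by positivity
    have j0 : (0 : ℝ) ≤ j := by positivity
    nlinarith [mul_le_mul_of_nonneg_right hτ2 m0, mul_le_mul_of_nonneg_right hη1 m0,
      mul_le_mul_of_nonneg_right hη2 j0]
  · obtain ⟨m, rfl⟩ := Nat.exists_eq_add_of_lt hk
    refine (rpow_interpolate hN (by linarith) le_rfl h1 h3).trans ?_
    refine Real.rpow_le_rpow_of_exponent_le one_le_two ?_
    rw [show K + m + 1 - K = m + 1 by omega, show K - (K + m + 1) = 0 by omega]
    have e : ((K + m + 1 : ℕ) : ℝ) * d + (1 - α) * (q * (-((K + m + 1 : ℕ) * s) - j + K * s +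
        s * (0 : ℕ) - (d / q - s + γ / 2) * (m + 1 : ℕ))) =
        (K + m + 1) * d - ((1 - α) * (d + q * γ / 2)) * (m + 1) - (1 - α) * q * j := by
      push_cast
      field_simp
      ring
    rw [e, hαe]
    push_cast
    have m0 : (0 : ℝ) ≤ (m : ℝ) + 1 := by positivity
    have j0 : (0 : ℝ) ≤ j := by positivity
    have h5 : η ≤ (1 - α) * q := by nlinarith
    nlinarith [mul_le_mul_of_nonneg_right hη3 m0, mul_le_mul_of_nonneg_right h5 j0]

theorem cellSum_bitCells {d n J : ℕ} {δ : ℕ → ℝ} {D : ∀ k : ℕ, (Fin d → Fin (2 ^ k)) → ℝ}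
    (hJ : ∀ k ∈ range n, ∀ c, ⌊|D k c| / δ k⌋₊ < 2 ^ J) (y : Fin d → ℝ) :
    cellSum (range n ×ˢ range J ×ˢ Finset.univ) (fun t => t.1)
      (fun t : ℕ × ℕ × Bool => bitCells (δ t.1) (D t.1) t.2.1 t.2.2)
      (fun t => (if t.2.2 then 1 else -1) * (δ t.1 * 2 ^ t.2.1)) y =
      ∑ k ∈ range n, roundTo (δ k) (D k (dyadicCell k y)) := by
  rw [cellSum, Finset.sum_product]
  refine Finset.sum_congr rfl fun k hk => ?_
  rw [Finset.sum_product, ← sum_bitCells (hJ k hk _)]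

theorem exists_net_quantized {d : ℕ} (hd : 1 ≤ d) {s q γ : ℝ} (hs : 0 < s) (hq : 1 ≤ q)
    (hγ : 0 < γ) :
    ∃ C : ℕ, 1 ≤ C ∧ ∀ (W L : ℕ), 1 ≤ W → 1 ≤ L → ∀ K : ℕ, (2 : ℝ) ^ (K * d) ≤ ((W : ℝ) * L) ^ 2 →
      ∀ B : ℝ, 0 < B → ∀ D : ∀ k : ℕ, (Fin d → Fin (2 ^ k)) → ℝ,
      (∀ k, ∑ c, |D k c| ^ q ≤ (2 : ℝ) ^ (k * d) * (B * 2 ^ (-(k * s))) ^ q) →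
      ∀ (R : ℕ) (ε : ℝ), 0 < ε → 3 * ε ≤ 1 / 2 ^ R →
      ∃ G : (Fin d → ℝ) → ℝ, IsNet1 (C * W) (C * L) G ∧ ∀ x,
        (∃ y, (∀ i, |y i - x i| ≤ ε) ∧ ∑ k ∈ range (R + 1),
          roundTo (quantum s (d / q - s + γ / 2) B K k) (D k (dyadicCell k y)) ≤ G x) ∧
        ∃ y, (∀ i, |y i - x i| ≤ ε) ∧ G x ≤ ∑ k ∈ range (R + 1),
          roundTo (quantum s (d / q - s + γ / 2) B K k) (D k (dyadicCell k y)) := by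
  have hd0 : (0 : ℝ) < d := by exact_mod_cast hd
  obtain ⟨α, η, hα0, hα1, hη, hcard⟩ := exists_card_bound hd0 hs hq hγ
  set r : ℝ := 2 ^ (-(η / 4)) with hr
  have hr0 : 0 < r := by positivity
  have hr1 : r < 1 := Real.rpow_lt_one_of_one_lt_of_neg one_lt_two (by linarith)
  set M := (1 - r)⁻¹ with hM
  have hM0 : 0 < M := inv_pos.2 (by linarith)
  obtain ⟨C, hC, H⟩ := exists_net_cellSum_shift hd hα0 hα1 (max 1 ⌈4 * M ^ 2⌉₊)
  refine ⟨C, hC, fun W L hW hL K hK B hB D hD R ε hε hεR => ?_⟩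
  set δ := fun k => quantum s (d / q - s + γ / 2) B K k with hδ
  have hδ0 : ∀ k, 0 < δ k := fun k => quantum_pos hB K k
  obtain ⟨J, hJ⟩ : ∃ J : ℕ, ∀ k ∈ range (R + 1), ∀ c, ⌊|D k c| / δ k⌋₊ < 2 ^ J := by
    refine ⟨∑ k ∈ range (R + 1), ∑ c, ⌊|D k c| / δ k⌋₊, fun k hk c => ?_⟩
    refine lt_of_le_of_lt ?_ Nat.lt_two_pow_self
    exact (Finset.single_le_sum (f := fun c => ⌊|D k c| / δ k⌋₊) (fun _ _ => Nat.zero_le _)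
      (Finset.mem_univ c)).trans
      (Finset.single_le_sum (f := fun k => ∑ c, ⌊|D k c| / δ k⌋₊) (fun _ _ => Nat.zero_le _) hk)
  let t : Finset (ℕ × ℕ × Bool) := range (R + 1) ×ˢ range J ×ˢ Finset.univ
  let S : ∀ t : ℕ × ℕ × Bool, Finset (Fin d → Fin (2 ^ t.1)) :=
    fun t => bitCells (δ t.1) (D t.1) t.2.1 t.2.2
  let c : ℕ × ℕ × Bool → ℝ := fun t => (if t.2.2 then 1 else -1) * (δ t.1 * 2 ^ t.2.1)
  let μ : ℕ × ℕ × Bool → ℝ := fun t => r ^ ((K - t.1 + (t.1 - K)) + t.2.1)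
  have hμsum : ∑ i ∈ t, μ i ≤ (max 1 ⌈4 * M ^ 2⌉₊ : ℕ) := by
    have e : ∑ i ∈ t, μ i = (∑ k ∈ range (R + 1), r ^ (K - k + (k - K))) *
        ((∑ j ∈ range J, r ^ j) * 2) := by
      simp only [t, μ, Finset.sum_product, Finset.sum_const, Finset.card_univ, Fintype.card_bool,
        pow_add, ← Finset.mul_sum, ← Finset.sum_mul, nsmul_eq_mul]
      push_cast
      ring
    have h1 := sum_range_dist_le (g := fun i => r ^ i) (fun n => by positivity)
      (geom_sum_range_le hr0.le hr1) K (R + 1)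
    have h2 := geom_sum_range_le hr0.le hr1 J
    calc ∑ i ∈ t, μ i ≤ (2 * M) * (M * 2) := by
          rw [e]
          gcongr
      _ = 4 * M ^ 2 := by ring
      _ ≤ ⌈4 * M ^ 2⌉₊ := Nat.le_ceil _
      _ ≤ _ := by exact_mod_cast le_max_right _ _
  have hcost : ∀ i ∈ t, (S i).Nonempty → (#(S i) : ℝ) ^ (1 - α) * ((2 : ℝ) ^ (i.1 * d)) ^ α ≤
      (max 1 ⌈4 * M ^ 2⌉₊ : ℕ) * ((W : ℝ) * L) ^ 2 * μ i ^ 4 := by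
    rintro ⟨k, j, b⟩ - hne
    have e : ∀ k : ℕ, (2 : ℝ) ^ ((k : ℝ) * d) = 2 ^ (k * d) := fun k => by
      rw [← Real.rpow_natCast]
      push_cast
      rfl
    have hN : (0 : ℝ) < #(S (k, j, b)) := by exact_mod_cast hne.card_pos
    have h1 : (#(S (k, j, b)) : ℝ) ≤ 2 ^ ((k : ℝ) * d) := by
      rw [e]
      have := Finset.card_le_univ (S (k, j, b))
      rw [Fintype.card_fun, Fintype.card_fin, Fintype.card_fin, ← pow_mul] at this
      exact_mod_cast this
    have h2 := hcard K k j _ B hN hB h1 (by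
      rw [e]
      exact card_bitCells_le (hδ0 k) (by linarith) (hD k) j b)
    rw [e] at h2
    refine h2.trans ?_
    have e2 : (2 : ℝ) ^ (K * d - η * ((K - k : ℕ) + (k - K : ℕ) + j)) =
        2 ^ (K * d) * μ (k, j, b) ^ 4 := by
      rw [sub_eq_add_neg, Real.rpow_add two_pos, e]
      simp only [μ]
      rw [← pow_mul, hr, ← Real.rpow_mul_natCast two_pos.le]
      push_cast
      ring_nf
    rw [e2]
    have h3 : (1 : ℝ) ≤ (max 1 ⌈4 * M ^ 2⌉₊ : ℕ) := by exact_mod_cast le_max_left _ _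
    refine mul_le_mul_of_nonneg_right ?_ (by positivity)
    nlinarith [sq_nonneg ((W : ℝ) * L)]
  obtain ⟨G, hG, hGx⟩ := H W L hW hL _ t (fun t => t.1) S c μ (fun i _ => by positivity) hμsum hcost
    R (fun i hi => by
      have := (Finset.mem_product.1 hi).1
      rw [Finset.mem_range] at this
      omega) ε hε hεR
  have hsum : ∀ y, cellSum t (fun t => t.1) S c y =
      ∑ k ∈ range (R + 1), roundTo (δ k) (D k (dyadicCell k y)) := cellSum_bitCells hJ
  simp only [hsum] at hGx
  exact ⟨G, hG, hGx⟩

theorem dyadicIdx_le {k : ℕ} {y : ℝ} (h : 0 ≤ y) : ((dyadicIdx k y : ℕ) : ℝ) ≤ 2 ^ k * y := by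
  rcases Nat.eq_zero_or_pos (dyadicIdx k y : ℕ) with h0 | h0
  · rw [h0, Nat.cast_zero]
    positivity
  · exact dyadicIdx_le_of_pos h0

theorem le_dyadicIdx_add_one {k : ℕ} {y : ℝ} (h : y ≤ 1) :
    2 ^ k * y ≤ (dyadicIdx k y : ℕ) + 1 := by
  rcases lt_or_ge ((dyadicIdx k y : ℕ) + 1) (2 ^ k) with h0 | h0
  · exact (lt_dyadicIdx_add_one h0).le
  · have h0' : (2 : ℝ) ^ k ≤ (dyadicIdx k y : ℕ) + 1 := by exact_mod_cast h0
    have : (0 : ℝ) < 2 ^ k := by positivity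
    nlinarith

theorem dyadicIdx_eq {k : ℕ} {y : ℝ} {i : Fin (2 ^ k)} (h1 : (i : ℕ) ≤ 2 ^ k * y)
    (h2 : 2 ^ k * y < (i : ℕ) + 1) : dyadicIdx k y = i := by
  have e1 : (i : ℕ) ≤ dyadicIdx k y := le_dyadicIdx_iff.2 (by
    rcases Nat.eq_zero_or_pos (i : ℕ) with h | h
    · exact Or.inl h
    · exact Or.inr ⟨i.2, h1⟩)
  have e2 : ¬ (i : ℕ) + 1 ≤ dyadicIdx k y := fun h => by
    rcases le_dyadicIdx_iff.1 h with h | ⟨-, h⟩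
    · omega
    · push_cast at h
      linarith
  exact Fin.ext (by omega)

theorem monotone_dyadicIdx (k : ℕ) : Monotone (dyadicIdx k) := by
  intro x y h
  have h1 := le_dyadicIdx_iff.1 (le_refl (dyadicIdx k x : ℕ))
  refine Fin.le_def.2 (le_dyadicIdx_iff.2 (h1.imp_right fun h2 => ⟨h2.1, h2.2.trans ?_⟩))
  gcongr

theorem measurable_dyadicIdx (k : ℕ) : Measurable (dyadicIdx k) :=
  (monotone_dyadicIdx k).measurable

theorem measurable_dyadicCell {d : ℕ} (k : ℕ) : Measurable (dyadicCell (d := d) k) :=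
  measurable_pi_lambda _ fun i => (measurable_dyadicIdx k).comp (measurable_pi_apply i)

theorem dyadicIdx_dist_le_one {k : ℕ} {x y : ℝ} (h : |y - x| ≤ 1 / 2 ^ k) :
    (dyadicIdx k y : ℕ) ≤ dyadicIdx k x + 1 := by
  rw [← Nat.sub_le_iff_le_add, le_dyadicIdx_iff]
  have hy := (dyadicIdx k y).2
  rcases Nat.eq_zero_or_pos ((dyadicIdx k y : ℕ) - 1) with h0 | h0
  · exact Or.inl h0
  · refine Or.inr ⟨by omega, ?_⟩
    have h1 := dyadicIdx_le_of_pos (k := k) (y := y) (by omega)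
    rw [Nat.cast_sub (by omega), Nat.cast_one, sub_le_iff_le_add]
    have h2 : 2 ^ k * (y - x) ≤ 1 := by
      calc 2 ^ k * (y - x) ≤ 2 ^ k * (1 / 2 ^ k) := by
            gcongr
            exact (le_abs_self _).trans h
        _ = 1 := by field_simp
    linarith

/-- Lebesgue measure on the unit cube. -/
def cubeMeasure (d : ℕ) : Measure (Fin d → ℝ) := volume.restrict (unitCube d)

theorem volume_dyadicIdx_preimage (k : ℕ) (i : Fin (2 ^ k)) :
    volume (Set.Icc 0 1 ∩ dyadicIdx k ⁻¹' {i}) = (2 ^ k)⁻¹ := by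
  have h2 : (0 : ℝ) < 2 ^ k := by positivity
  have hlen : ENNReal.ofReal (((i : ℕ) + 1) / 2 ^ k - (i : ℕ) / 2 ^ k) = (2 ^ k)⁻¹ := by
    rw [← sub_div, add_sub_cancel_left, one_div, ENNReal.ofReal_inv_of_pos h2,
      ENNReal.ofReal_pow two_pos.le, ENNReal.ofReal_ofNat]
  have hi : ((i : ℕ) : ℝ) + 1 ≤ 2 ^ k := by exact_mod_cast i.2
  refine le_antisymm ?_ ?_
  · rw [← hlen, ← Real.volume_Icc]
    refine measure_mono fun y hy => ?_
    obtain ⟨⟨h0, h1⟩, rfl⟩ := hy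
    have e1 := dyadicIdx_le (k := k) h0
    have e2 := le_dyadicIdx_add_one (k := k) h1
    exact ⟨by rw [div_le_iff₀ h2]; linarith, by rw [le_div_iff₀ h2]; linarith⟩
  · rw [← hlen, ← Real.volume_Ico]
    refine measure_mono fun y hy => ?_
    obtain ⟨h0, h1⟩ := hy
    rw [div_le_iff₀ h2] at h0
    rw [lt_div_iff₀ h2] at h1
    refine ⟨⟨?_, ?_⟩, dyadicIdx_eq (by linarith) (by linarith)⟩
    · have : (0 : ℝ) ≤ (i : ℕ) := by positivity
      by_contra! h
      nlinarith
    · by_contra! h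
      nlinarith

theorem cubeMeasure_dyadicCell_preimage {d : ℕ} (k : ℕ) (c : Fin d → Fin (2 ^ k)) :
    cubeMeasure d (dyadicCell k ⁻¹' {c}) = (2 ^ (k * d))⁻¹ := by
  have e : dyadicCell k ⁻¹' {c} ∩ unitCube d =
      Set.univ.pi fun j => Set.Icc 0 1 ∩ dyadicIdx k ⁻¹' {c j} := by
    ext x
    simp only [unitCube, dyadicCell, Set.mem_inter_iff, Set.mem_preimage, Set.mem_singleton_iff,
      Set.mem_Icc, Set.mem_univ_pi, funext_iff, Pi.le_def, Pi.zero_apply, Pi.one_apply]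
    exact ⟨fun h j => ⟨⟨h.2.1 j, h.2.2 j⟩, h.1 j⟩,
      fun h => ⟨fun j => (h j).2, fun j => (h j).1.1, fun j => (h j).1.2⟩⟩
  rw [cubeMeasure, Measure.restrict_apply (measurable_dyadicCell k (measurableSet_singleton _)), e,
    volume_pi_pi]
  simp only [volume_dyadicIdx_preimage, Finset.prod_const, Finset.card_univ, Fintype.card_fin]
  rw [← ENNReal.inv_pow, pow_mul]

instance (d : ℕ) : IsProbabilityMeasure (cubeMeasure d) := by
  refine ⟨?_⟩
  rw [cubeMeasure, Measure.restrict_apply_univ, unitCube, ← Set.pi_univ_Icc, volume_pi_pi]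
  simp

theorem ae_eventually_dyadicCell_eq (d k : ℕ) :
    ∀ᵐ x ∂cubeMeasure d, ∀ᶠ y in nhds x, dyadicCell k y = dyadicCell k x := by
  have h1 : ∀ᵐ x ∂cubeMeasure d, ∀ (j : Fin d) (i : ℤ), x j ≠ (i : ℝ) / 2 ^ k := by
    refine ae_restrict_of_ae ?_
    rw [ae_all_iff]
    intro j
    rw [ae_all_iff]
    intro i
    rw [ae_iff]
    simp only [not_not]
    exact Measure.pi_hyperplane (fun _ : Fin d => (volume : Measure ℝ)) j _
  have h2 : ∀ᵐ x ∂cubeMeasure d, x ∈ unitCube d := ae_restrict_mem measurableSet_Icc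
  filter_upwards [h1, h2] with x hx hx1
  have h3 : ∀ j, ∀ᶠ y in nhds x, dyadicIdx k (y j) = dyadicIdx k (x j) := by
    intro j
    have hi1 := dyadicIdx_le (k := k) (hx1.1 j)
    have hi2 := le_dyadicIdx_add_one (k := k) (hx1.2 j)
    have hp : (0 : ℝ) < 2 ^ k := by positivity
    have hc : Continuous fun y : Fin d → ℝ => 2 ^ k * y j := by fun_prop
    have n1 := hx j (dyadicIdx k (x j) : ℕ)
    have n2 := hx j ((dyadicIdx k (x j) : ℕ) + 1 : ℕ)
    rw [ne_eq, eq_div_iff hp.ne'] at n1 n2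
    push_cast at n1 n2
    filter_upwards [hc.continuousAt.eventually (lt_mem_nhds (hi1.lt_of_ne fun h => n1 (by linarith))),
      hc.continuousAt.eventually (gt_mem_nhds (hi2.lt_of_ne fun h => n2 (by linarith)))] with y h1 h2
    exact dyadicIdx_eq h1.le h2
  filter_upwards [Filter.eventually_all.2 h3] with y hy
  exact funext hy

theorem abs_sub_le_of_dyadicIdx {k : ℕ} {x y : ℝ} (hx : 0 ≤ x) (hy : y ≤ 1)
    (h : (dyadicIdx k y : ℕ) ≤ dyadicIdx k x + 1) : y - x ≤ 2 / 2 ^ k := by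
  have e1 := dyadicIdx_le (k := k) hx
  have e2 := le_dyadicIdx_add_one (k := k) hy
  have h' : ((dyadicIdx k y : ℕ) : ℝ) ≤ (dyadicIdx k x : ℕ) + 1 := by exact_mod_cast h
  rw [le_div_iff₀ (by positivity)]
  linarith

/-- Two dyadic cells of the same level which agree or touch each other. -/
def AdjacentCells {d k : ℕ} (c c' : Fin d → Fin (2 ^ k)) : Prop :=
  ∀ j, (c j : ℕ) ≤ c' j + 1 ∧ (c' j : ℕ) ≤ c j + 1

theorem sqrt_sum_sq_le {d k : ℕ} {x y : Fin d → ℝ} (hx : x ∈ unitCube d) (hy : y ∈ unitCube d)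
    (h : AdjacentCells (dyadicCell k x) (dyadicCell k y)) :
    √(∑ j, (x j - y j) ^ 2) ≤ 2 * √d / 2 ^ k := by
  have h1 : ∀ j, (x j - y j) ^ 2 ≤ (2 / 2 ^ k) ^ 2 := by
    intro j
    refine sq_le_sq' ?_ ?_
    · have := abs_sub_le_of_dyadicIdx (hx.1 j) (hy.2 j) (h j).2
      linarith
    · exact abs_sub_le_of_dyadicIdx (hy.1 j) (hx.2 j) (h j).1
  calc √(∑ j, (x j - y j) ^ 2) ≤ √(∑ j : Fin d, (2 / 2 ^ k) ^ 2) :=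
        Real.sqrt_le_sqrt (Finset.sum_le_sum fun j _ => h1 j)
    _ = 2 * √d / 2 ^ k := by
        rw [Finset.sum_const, Finset.card_univ, Fintype.card_fin, nsmul_eq_mul,
          Real.sqrt_mul (by positivity), Real.sqrt_sq (by positivity)]
        ring

/-- The dyadic cell of the previous level containing a given one. -/
def parentCell {d k : ℕ} (c : Fin d → Fin (2 ^ (k + 1))) : Fin d → Fin (2 ^ k) :=
  fun j => ⟨c j / 2, Nat.div_lt_of_lt_mul ((c j).2.trans_eq (pow_succ' 2 k))⟩

theorem parentCell_dyadicCell {d k : ℕ} (x : Fin d → ℝ) :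
    parentCell (dyadicCell (k + 1) x) = dyadicCell k x := by
  funext j
  have h := dyadicIdx_add k 1 (x j)
  have h2 := (dyadicIdx 1 (2 ^ k * x j - (dyadicIdx k (x j) : ℕ))).2
  refine Fin.ext ?_
  change (dyadicIdx (k + 1) (x j) : ℕ) / 2 = dyadicIdx k (x j)
  omega

theorem enorm_integral_sub_rpow_le {X : Type*} [MeasurableSpace X] {ν : Measure X}
    [IsProbabilityMeasure ν] {f : X → ℝ} (hf : Integrable f ν) {q : ℝ} (hq : 1 ≤ q) (c : ℝ) :
    ‖∫ x, f x ∂ν - c‖ₑ ^ q ≤ ∫⁻ x, ‖f x - c‖ₑ ^ q ∂ν := by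
  have hq0 : 0 < q := by linarith
  have h1 : ∫ x, f x ∂ν - c = ∫ x, (f x - c) ∂ν := by
    rw [integral_sub hf (integrable_const c)]
    simp
  have hm : AEStronglyMeasurable (fun x => f x - c) ν :=
    hf.aestronglyMeasurable.sub aestronglyMeasurable_const
  have h2 := eLpNorm_le_eLpNorm_of_exponent_le (μ := ν) (p := 1) (q := ENNReal.ofReal q)
    (by rwa [← ENNReal.ofReal_one, ENNReal.ofReal_le_ofReal_iff hq0.le]) hm
  rw [eLpNorm_one_eq_lintegral_enorm, eLpNorm_eq_lintegral_rpow_enorm_toReal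
    (by simpa using hq0) ENNReal.ofReal_ne_top, ENNReal.toReal_ofReal hq0.le] at h2
  rw [h1]
  calc ‖∫ x, (f x - c) ∂ν‖ₑ ^ q ≤ ((∫⁻ x, ‖f x - c‖ₑ ^ q ∂ν) ^ (1 / q)) ^ q := by
        gcongr
        exact (enorm_integral_le_lintegral_enorm _).trans h2
    _ = ∫⁻ x, ‖f x - c‖ₑ ^ q ∂ν := by
        rw [← ENNReal.rpow_mul, one_div_mul_cancel hq0.ne', ENNReal.rpow_one]

/-- The uniform distribution on a dyadic cell. -/
def cellMeasure {d : ℕ} (k : ℕ) (c : Fin d → Fin (2 ^ k)) : Measure (Fin d → ℝ) :=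
  ProbabilityTheory.cond (cubeMeasure d) (dyadicCell k ⁻¹' {c})

instance {d : ℕ} (k : ℕ) (c : Fin d → Fin (2 ^ k)) : IsProbabilityMeasure (cellMeasure k c) := by
  refine ProbabilityTheory.cond_isProbabilityMeasure ?_
  rw [cubeMeasure_dyadicCell_preimage]
  simp

theorem lintegral_cellMeasure {d : ℕ} (k : ℕ) (c : Fin d → Fin (2 ^ k)) (h : (Fin d → ℝ) → ℝ≥0∞) :
    ∫⁻ x, h x ∂cellMeasure k c = 2 ^ (k * d) * ∫⁻ x in dyadicCell k ⁻¹' {c}, h x ∂cubeMeasure d := by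
  rw [cellMeasure, ProbabilityTheory.cond, lintegral_smul_measure, cubeMeasure_dyadicCell_preimage,
    inv_inv, smul_eq_mul]

theorem ae_cellMeasure {d : ℕ} (k : ℕ) (c : Fin d → Fin (2 ^ k)) :
    ∀ᵐ x ∂cellMeasure k c, x ∈ unitCube d ∧ dyadicCell k x = c := by
  refine Filter.Eventually.and ?_ ?_
  · exact (ProbabilityTheory.cond_absolutelyContinuous).ae_le (ae_restrict_mem measurableSet_Icc)
  · exact ProbabilityTheory.ae_cond_mem (measurable_dyadicCell k (measurableSet_singleton c))

theorem integrable_cellMeasure {d : ℕ} (k : ℕ) (c : Fin d → Fin (2 ^ k)) {f : (Fin d → ℝ) → ℝ}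
    (hf : Integrable f (cubeMeasure d)) : Integrable f (cellMeasure k c) := by
  refine Integrable.smul_measure hf.restrict ?_
  rw [cubeMeasure_dyadicCell_preimage]
  simp

/-- The averages of a function over the dyadic cells of level `k`. -/
def cellAvg {d : ℕ} (f : (Fin d → ℝ) → ℝ) (k : ℕ) (c : Fin d → Fin (2 ^ k)) : ℝ :=
  ∫ x, f x ∂cellMeasure k c

/-- The inner integral in the Sobolev–Slobodeckij seminorm. -/
def sobDensity (d : ℕ) (s q : ℝ) (f : (Fin d → ℝ) → ℝ) (x : Fin d → ℝ) : ℝ≥0∞ :=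
  ∫⁻ y, ENNReal.ofReal
    (|f x - f y| ^ q / √(∑ j, (x j - y j) ^ 2) ^ ((d : ℝ) + s * q)) ∂cubeMeasure d

section
variable {d : ℕ} {s q : ℝ} {f : (Fin d → ℝ) → ℝ}

theorem enorm_rpow (hq : 0 ≤ q) (t : ℝ) : ‖t‖ₑ ^ q = ENNReal.ofReal (|t| ^ q) := by
  rw [Real.enorm_eq_ofReal_abs, ENNReal.ofReal_rpow_of_nonneg (abs_nonneg t) hq]

theorem sobNorm_rpow (hq : 1 ≤ q) :
    sobNorm d s q f ^ q = ∫⁻ x, ‖f x‖ₑ ^ q ∂cubeMeasure d +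
      ∫⁻ x, sobDensity d s q f x ∂cubeMeasure d := by
  have hq0 : 0 < q := by linarith
  rw [sobNorm, ← ENNReal.rpow_mul, one_div_mul_cancel hq0.ne', ENNReal.rpow_one]
  simp only [enorm_rpow hq0.le]
  rfl

theorem enorm_sub_rpow_le (hs : 0 < s) (hq : 1 ≤ q) {k : ℕ} {x y : Fin d → ℝ}
    (hx : x ∈ unitCube d) (hy : y ∈ unitCube d)
    (h : AdjacentCells (dyadicCell k x) (dyadicCell k y)) :
    ‖f y - f x‖ₑ ^ q ≤ ENNReal.ofReal ((2 * √d / 2 ^ k) ^ (d + s * q)) * ENNReal.ofReal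
      (|f x - f y| ^ q / √(∑ j, (x j - y j) ^ 2) ^ ((d : ℝ) + s * q)) := by
  have hq0 : 0 < q := by linarith
  have he : 0 < (d : ℝ) + s * q := by positivity
  rw [enorm_rpow hq0.le, ← ENNReal.ofReal_mul (by positivity), abs_sub_comm]
  refine ENNReal.ofReal_le_ofReal ?_
  rcases (Real.sqrt_nonneg (∑ j, (x j - y j) ^ 2)).eq_or_lt' with h0 | h0
  · have : x = y := by
      rw [Real.sqrt_eq_zero (by positivity),
        Finset.sum_eq_zero_iff_of_nonneg fun _ _ => by positivity] at h0
      funext j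
      have := h0 j (Finset.mem_univ j)
      rw [sq_eq_zero_iff] at this
      linarith
    rw [this, sub_self, abs_zero, Real.zero_rpow hq0.ne', zero_div, mul_zero]
  · rw [mul_div_assoc', le_div_iff₀ (by positivity), mul_comm]
    have := sqrt_sum_sq_le hx hy h
    gcongr

theorem two_pow_mul_rpow (k : ℕ) (a : ℝ) (ha : 0 ≤ a) :
    (2 : ℝ) ^ (k * d) * (a / 2 ^ k) ^ (d + s * q) = a ^ (d + s * q) * 2 ^ (-(k * s * q)) := by
  rw [Real.div_rpow ha (by positivity), ← Real.rpow_natCast, ← Real.rpow_natCast,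
    ← Real.rpow_mul two_pos.le, mul_div_left_comm, ← Real.rpow_sub two_pos]
  push_cast
  ring_nf

theorem enorm_sub_cellAvg_rpow_le (hs : 0 < s) (hq : 1 ≤ q) (hf : Integrable f (cubeMeasure d))
    {k : ℕ} {x : Fin d → ℝ} (hx : x ∈ unitCube d) {c : Fin d → Fin (2 ^ k)}
    (h : AdjacentCells (dyadicCell k x) c) :
    ‖f x - cellAvg f k c‖ₑ ^ q ≤
      ENNReal.ofReal ((2 * √d) ^ (d + s * q) * 2 ^ (-(k * s * q))) * sobDensity d s q f x := by
  rw [← two_pow_mul_rpow k _ (by positivity), ← neg_sub, enorm_neg]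
  calc ‖cellAvg f k c - f x‖ₑ ^ q ≤ ∫⁻ y, ‖f y - f x‖ₑ ^ q ∂cellMeasure k c :=
        enorm_integral_sub_rpow_le (integrable_cellMeasure k c hf) hq _
    _ ≤ ∫⁻ y, ENNReal.ofReal ((2 * √d / 2 ^ k) ^ (d + s * q)) * ENNReal.ofReal
          (|f x - f y| ^ q / √(∑ j, (x j - y j) ^ 2) ^ ((d : ℝ) + s * q)) ∂cellMeasure k c := by
        refine lintegral_mono_ae ?_
        filter_upwards [ae_cellMeasure k c] with y hy
        exact enorm_sub_rpow_le hs hq hx hy.1 (hy.2 ▸ h)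
    _ = 2 ^ (k * d) * (ENNReal.ofReal ((2 * √d / 2 ^ k) ^ (d + s * q)) *
          ∫⁻ y in dyadicCell k ⁻¹' {c}, ENNReal.ofReal
          (|f x - f y| ^ q / √(∑ j, (x j - y j) ^ 2) ^ ((d : ℝ) + s * q)) ∂cubeMeasure d) := by
        rw [lintegral_cellMeasure, lintegral_const_mul' _ _ ENNReal.ofReal_ne_top]
    _ ≤ 2 ^ (k * d) * (ENNReal.ofReal ((2 * √d / 2 ^ k) ^ (d + s * q)) * sobDensity d s q f x) := by
        gcongr
        exact setLIntegral_le_lintegral _ _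
    _ = _ := by
        rw [← mul_assoc, ENNReal.ofReal_mul (by positivity), ENNReal.ofReal_pow two_pos.le,
          ENNReal.ofReal_ofNat]

theorem enorm_cellAvg_sub_rpow_le (hs : 0 < s) (hq : 1 ≤ q) (hf : Integrable f (cubeMeasure d))
    {k m : ℕ} {c : Fin d → Fin (2 ^ k)} {b : Fin d → Fin (2 ^ m)}
    (h : ∀ x, dyadicCell m x = b → AdjacentCells (dyadicCell k x) c) :
    ‖cellAvg f m b - cellAvg f k c‖ₑ ^ q ≤ 2 ^ (m * d) *
      (ENNReal.ofReal ((2 * √d) ^ (d + s * q) * 2 ^ (-(k * s * q))) *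
        ∫⁻ x in dyadicCell m ⁻¹' {b}, sobDensity d s q f x ∂cubeMeasure d) := by
  calc ‖cellAvg f m b - cellAvg f k c‖ₑ ^ q
      ≤ ∫⁻ x, ‖f x - cellAvg f k c‖ₑ ^ q ∂cellMeasure m b :=
        enorm_integral_sub_rpow_le (integrable_cellMeasure m b hf) hq _
    _ ≤ ∫⁻ x, ENNReal.ofReal ((2 * √d) ^ (d + s * q) * 2 ^ (-(k * s * q))) * sobDensity d s q f x
          ∂cellMeasure m b := by
        refine lintegral_mono_ae ?_
        filter_upwards [ae_cellMeasure m b] with x hx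
        exact enorm_sub_cellAvg_rpow_le hs hq hf hx.1 (h x hx.2)
    _ = _ := by rw [lintegral_cellMeasure, lintegral_const_mul' _ _ ENNReal.ofReal_ne_top]

theorem adjacentCells_self {d k : ℕ} (c : Fin d → Fin (2 ^ k)) : AdjacentCells c c :=
  fun _ => ⟨Nat.le_succ _, Nat.le_succ _⟩

theorem lintegral_enorm_sub_cellAvg_rpow_le (hs : 0 < s) (hq : 1 ≤ q)
    (hf : Integrable f (cubeMeasure d)) (k : ℕ) :
    ∫⁻ x, ‖f x - cellAvg f k (dyadicCell k x)‖ₑ ^ q ∂cubeMeasure d ≤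
      ENNReal.ofReal ((2 * √d) ^ (d + s * q) * 2 ^ (-(k * s * q))) * sobNorm d s q f ^ q := by
  rw [sobNorm_rpow hq]
  refine le_trans ?_ (mul_le_mul_right le_add_self _)
  rw [← lintegral_const_mul' _ _ ENNReal.ofReal_ne_top]
  refine lintegral_mono_ae ?_
  filter_upwards [ae_restrict_mem measurableSet_Icc] with x hx
  exact enorm_sub_cellAvg_rpow_le hs hq hf hx (adjacentCells_self _)

theorem enorm_cellAvg_sub_rpow_le_of_adjacent (hs : 0 < s) (hq : 1 ≤ q)
    (hf : Integrable f (cubeMeasure d)) {k : ℕ} {b c : Fin d → Fin (2 ^ k)}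
    (h : AdjacentCells b c) :
    ‖cellAvg f k b - cellAvg f k c‖ₑ ^ q ≤ 2 ^ (k * d) *
      (ENNReal.ofReal ((2 * √d) ^ (d + s * q) * 2 ^ (-(k * s * q))) * sobNorm d s q f ^ q) := by
  refine (enorm_cellAvg_sub_rpow_le hs hq hf (fun x hx => hx ▸ h)).trans ?_
  gcongr
  rw [sobNorm_rpow hq]
  exact (setLIntegral_le_lintegral _ _).trans le_add_self

theorem sum_enorm_cellAvg_sub_parent_rpow_le (hs : 0 < s) (hq : 1 ≤ q)
    (hf : Integrable f (cubeMeasure d)) (k : ℕ) :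
    ∑ b, ‖cellAvg f (k + 1) b - cellAvg f k (parentCell b)‖ₑ ^ q ≤ 2 ^ ((k + 1) * d) *
      (ENNReal.ofReal ((2 * √d) ^ (d + s * q) * 2 ^ (-(k * s * q))) * sobNorm d s q f ^ q) := by
  refine (Finset.sum_le_sum fun b _ => enorm_cellAvg_sub_rpow_le hs hq hf (c := parentCell b)
    (fun x hx => ?_)).trans ?_
  · rw [← hx, parentCell_dyadicCell]
    exact adjacentCells_self _
  rw [← Finset.mul_sum, ← Finset.mul_sum]
  gcongr
  rw [sobNorm_rpow hq, ← lintegral_biUnion_finset]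
  · exact (setLIntegral_le_lintegral _ _).trans le_add_self
  · exact fun b _ c _ hbc => Disjoint.preimage _ (Set.disjoint_singleton.2 hbc)
  · exact fun b _ => measurable_dyadicCell (k + 1) (measurableSet_singleton b)

theorem enorm_cellAvg_zero_rpow_le (hq : 1 ≤ q) (hf : Integrable f (cubeMeasure d))
    (c : Fin d → Fin (2 ^ 0)) : ‖cellAvg f 0 c‖ₑ ^ q ≤ sobNorm d s q f ^ q := by
  have h := enorm_integral_sub_rpow_le (integrable_cellMeasure 0 c hf) hq 0
  simp only [sub_zero, lintegral_cellMeasure, zero_mul, pow_zero, one_mul] at h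
  rw [sobNorm_rpow hq]
  exact h.trans ((setLIntegral_le_lintegral _ _).trans le_self_add)

end

theorem eLpNorm_le_of_enorm_le {X : Type*} [MeasurableSpace X] {ν : Measure X} {h : X → ℝ} {q : ℝ}
    {p D b : ℝ≥0∞} (hq : 1 ≤ q) (hqp : ENNReal.ofReal q ≤ p) (hDtop : D ≠ ⊤) (hD : ∀ x, ‖h x‖ₑ ≤ D)
    (hb : eLpNorm h (ENNReal.ofReal q) ν ≤ b) :
    eLpNorm h p ν ≤ D ^ (1 - q / p.toReal) * b ^ (q / p.toReal) := by
  have hq0 : 0 < q := by linarith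
  rcases eq_or_ne p ⊤ with rfl | hp
  · simp only [ENNReal.toReal_top, _root_.div_zero, _root_.sub_zero, ENNReal.rpow_one,
      ENNReal.rpow_zero, _root_.mul_one]
    exact eLpNormEssSup_le_of_ae_enorm_bound (Filter.Eventually.of_forall hD)
  have hp1 : q ≤ p.toReal := (ENNReal.ofReal_le_iff_le_toReal hp).1 hqp
  have hp0 : 0 < p.toReal := by linarith
  have hp2 : p ≠ 0 := fun h => by simp [h] at hp0
  rw [eLpNorm_eq_lintegral_rpow_enorm_toReal (by simpa using hq0) ENNReal.ofReal_ne_top,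
    ENNReal.toReal_ofReal hq0.le] at hb
  rw [eLpNorm_eq_lintegral_rpow_enorm_toReal hp2 hp]
  have hb' : ∫⁻ x, ‖h x‖ₑ ^ q ∂ν ≤ b ^ q := by
    rwa [one_div, ENNReal.rpow_inv_le_iff hq0] at hb
  calc (∫⁻ x, ‖h x‖ₑ ^ p.toReal ∂ν) ^ (1 / p.toReal)
      ≤ (∫⁻ x, D ^ (p.toReal - q) * ‖h x‖ₑ ^ q ∂ν) ^ (1 / p.toReal) := by
        gcongr with x
        calc ‖h x‖ₑ ^ p.toReal = ‖h x‖ₑ ^ (p.toReal - q) * ‖h x‖ₑ ^ q := by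
              rw [← ENNReal.rpow_add_of_nonneg _ _ (by linarith) hq0.le, sub_add_cancel]
          _ ≤ _ := by
              gcongr
              exact hD x
    _ ≤ (D ^ (p.toReal - q) * b ^ q) ^ (1 / p.toReal) := by
        rw [lintegral_const_mul' _ _ (ENNReal.rpow_ne_top_of_nonneg (sub_nonneg.2 hp1) hDtop)]
        gcongr
    _ = _ := by
        rw [ENNReal.mul_rpow_of_nonneg _ _ (by positivity), ← ENNReal.rpow_mul, ← ENNReal.rpow_mul]
        congr 2
        · field_simp
        · field_simp

theorem div_toReal_le_one {q : ℝ} {p : ℝ≥0∞} (hqp : ENNReal.ofReal q ≤ p) : q / p.toReal ≤ 1 := by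
  rcases eq_or_ne p ⊤ with rfl | hp
  · simp
  · exact div_le_one_of_le₀ ((ENNReal.ofReal_le_iff_le_toReal hp).1 hqp) ENNReal.toReal_nonneg

theorem eLpNorm_comp_dyadicCell_le {d k : ℕ} {U : (Fin d → Fin (2 ^ k)) → ℝ} {q Δ b : ℝ} {p : ℝ≥0∞}
    (hq : 1 ≤ q) (hqp : ENNReal.ofReal q ≤ p) (hΔ : ∀ c, |U c| ≤ Δ) (hΔ0 : 0 ≤ Δ) (hb : 0 ≤ b)
    (hU : ∑ c, |U c| ^ q ≤ 2 ^ (k * d) * b ^ q) :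
    eLpNorm (fun x => U (dyadicCell k x)) p (cubeMeasure d) ≤
      ENNReal.ofReal (Δ ^ (1 - q / p.toReal) * b ^ (q / p.toReal)) := by
  have hq0 : 0 < q := by linarith
  have hθ := div_toReal_le_one hqp
  rw [ENNReal.ofReal_mul (by positivity), ← ENNReal.ofReal_rpow_of_nonneg hΔ0 (by linarith),
    ← ENNReal.ofReal_rpow_of_nonneg hb (by positivity)]
  refine eLpNorm_le_of_enorm_le hq hqp ENNReal.ofReal_ne_top (fun x => ?_) ?_
  · rw [Real.enorm_eq_ofReal_abs]
    exact ENNReal.ofReal_le_ofReal (hΔ _)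
  rw [eLpNorm_eq_lintegral_rpow_enorm_toReal (by simpa using hq0) ENNReal.ofReal_ne_top,
    ENNReal.toReal_ofReal hq0.le, one_div, ENNReal.rpow_inv_le_iff hq0]
  have h1 : ∫⁻ x, ‖U (dyadicCell k x)‖ₑ ^ q ∂cubeMeasure d =
      ∫⁻ c, ‖U c‖ₑ ^ q ∂(cubeMeasure d).map (dyadicCell k) :=
    (lintegral_map (f := fun c => ‖U c‖ₑ ^ q) (measurable_of_finite _) (measurable_dyadicCell k)).symm
  rw [h1, lintegral_fintype]
  simp only [Measure.map_apply (measurable_dyadicCell k) (measurableSet_singleton _),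
    cubeMeasure_dyadicCell_preimage, enorm_rpow hq0.le]
  rw [← Finset.sum_mul, ← ENNReal.ofReal_sum_of_nonneg fun _ _ => by positivity,
    ENNReal.ofReal_rpow_of_nonneg hb hq0.le, ← div_eq_mul_inv]
  refine ENNReal.div_le_of_le_mul' ?_
  rw [← ENNReal.ofReal_ofNat, ← ENNReal.ofReal_pow zero_le_two, ← ENNReal.ofReal_mul (by positivity)]
  exact ENNReal.ofReal_le_ofReal hU

/-- The differences between averages over cells and over their parents. -/
def cellDetail {d : ℕ} (f : (Fin d → ℝ) → ℝ) : ∀ k : ℕ, (Fin d → Fin (2 ^ k)) → ℝ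
  | 0 => cellAvg f 0
  | k + 1 => fun c => cellAvg f (k + 1) c - cellAvg f k (parentCell c)

theorem sum_cellDetail {d : ℕ} (f : (Fin d → ℝ) → ℝ) (R : ℕ) (x : Fin d → ℝ) :
    ∑ k ∈ range (R + 1), cellDetail f k (dyadicCell k x) = cellAvg f R (dyadicCell R x) := by
  induction R with
  | zero => simp [cellDetail]
  | succ R ih =>
    rw [Finset.sum_range_succ, ih]
    simp only [cellDetail, parentCell_dyadicCell, add_sub_cancel]

/-- The ratio between the size of the details and the Sobolev norm. -/
def detailConst (d : ℕ) (s q : ℝ) : ℝ := (1 + (2 * √d) ^ (d + s * q)) * 2 ^ s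

section
variable {d : ℕ} {s q A : ℝ} {f : (Fin d → ℝ) → ℝ}

theorem detailConst_pos : 0 < detailConst d s q := by
  unfold detailConst
  positivity

theorem le_detailConst_rpow (hq : 1 ≤ q) :
    (2 * √d) ^ (d + s * q) * 2 ^ (s * q) ≤ detailConst d s q ^ q := by
  rw [detailConst, Real.mul_rpow (x := 1 + _) (by positivity) (by positivity),
    ← Real.rpow_mul two_pos.le]
  gcongr
  have h : (0 : ℝ) ≤ (2 * √d) ^ (d + s * q) := by positivity
  calc (2 * √d) ^ (d + s * q) ≤ (1 + (2 * √d) ^ (d + s * q)) ^ (1 : ℝ) := by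
        rw [Real.rpow_one]
        linarith
    _ ≤ _ := Real.rpow_le_rpow_of_exponent_le (by linarith) hq

theorem detail_rpow_bound (hq : 1 ≤ q) (hA : 0 ≤ A) (k : ℕ) :
    (2 * √d) ^ (d + s * q) * 2 ^ (-(k * s * q)) * A ^ q ≤
      (detailConst d s q * A * 2 ^ (-((k + 1 : ℕ) * s))) ^ q := by
  have h0 : 0 ≤ detailConst d s q := detailConst_pos.le
  calc (2 * √d) ^ (d + s * q) * 2 ^ (-(k * s * q)) * A ^ q
      = (2 * √d) ^ (d + s * q) * 2 ^ (s * q) * A ^ q * 2 ^ (-((k + 1 : ℕ) * s * q)) := by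
        rw [mul_right_comm _ _ (A ^ q), mul_right_comm _ _ (A ^ q), mul_assoc _ (2 ^ (s * q)),
          ← Real.rpow_add two_pos]
        push_cast
        ring_nf
    _ ≤ detailConst d s q ^ q * A ^ q * 2 ^ (-((k + 1 : ℕ) * s * q)) := by
        gcongr
        exact le_detailConst_rpow hq
    _ = _ := by
        rw [Real.mul_rpow (by positivity) (by positivity), Real.mul_rpow h0 hA,
          ← Real.rpow_mul two_pos.le]
        ring_nf

theorem sum_abs_cellDetail_rpow_le (hs : 0 < s) (hq : 1 ≤ q) (hf : Integrable f (cubeMeasure d))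
    (hA : 0 ≤ A) (hfA : sobNorm d s q f = ENNReal.ofReal A) (k : ℕ) :
    ∑ c, |cellDetail f k c| ^ q ≤
      2 ^ (k * d) * (detailConst d s q * A * 2 ^ (-(k * s))) ^ q := by
  have hq0 : 0 < q := by linarith
  have h0 : 0 ≤ detailConst d s q := detailConst_pos.le
  rw [← ENNReal.ofReal_le_ofReal_iff (by positivity), ENNReal.ofReal_sum_of_nonneg
    fun _ _ => by positivity]
  simp only [← enorm_rpow hq0.le]
  rw [ENNReal.ofReal_mul (by positivity), ENNReal.ofReal_pow two_pos.le, ENNReal.ofReal_ofNat]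
  cases k with
  | zero =>
    have h1 : 1 ≤ detailConst d s q := by
      have h2 : (0 : ℝ) ≤ (2 * √d) ^ (d + s * q) := by positivity
      have h3 : (1 : ℝ) ≤ 2 ^ s := Real.one_le_rpow one_le_two hs.le
      unfold detailConst
      nlinarith
    have : Subsingleton (Fin (2 ^ 0)) := inferInstanceAs (Subsingleton (Fin 1))
    have hc : ∀ c : Fin d → Fin (2 ^ 0), c = fun _ => 0 := fun c => Subsingleton.elim _ _
    rw [Fintype.sum_eq_single (fun _ => 0) fun c h => absurd (hc c) h]
    refine (enorm_cellAvg_zero_rpow_le (s := s) hq hf _).trans ?_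
    rw [hfA, ENNReal.ofReal_rpow_of_nonneg hA hq0.le]
    simp only [zero_mul, pow_zero, one_mul, Nat.cast_zero, neg_zero, Real.rpow_zero, mul_one]
    refine ENNReal.ofReal_le_ofReal ?_
    gcongr
    nlinarith
  | succ k =>
    refine (sum_enorm_cellAvg_sub_parent_rpow_le hs hq hf k).trans ?_
    gcongr
    rw [hfA, ENNReal.ofReal_rpow_of_nonneg hA hq0.le, ← ENNReal.ofReal_mul (by positivity)]
    exact ENNReal.ofReal_le_ofReal (detail_rpow_bound hq hA k)

theorem eLpNorm_sub_cellAvg_le (hs : 0 < s) (hq : 1 ≤ q) (hf : Integrable f (cubeMeasure d))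
    (hA : 0 ≤ A) (hfA : sobNorm d s q f = ENNReal.ofReal A) (k : ℕ) :
    eLpNorm (fun x => f x - cellAvg f k (dyadicCell k x)) (ENNReal.ofReal q) (cubeMeasure d) ≤
      ENNReal.ofReal (detailConst d s q * A * 2 ^ (-((k + 1 : ℕ) * s))) := by
  have hq0 : 0 < q := by linarith
  have h0 : 0 ≤ detailConst d s q := detailConst_pos.le
  rw [eLpNorm_eq_lintegral_rpow_enorm_toReal (by simpa using hq0) ENNReal.ofReal_ne_top,
    ENNReal.toReal_ofReal hq0.le, one_div, ENNReal.rpow_inv_le_iff hq0,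
    ENNReal.ofReal_rpow_of_nonneg (by positivity) hq0.le]
  refine (lintegral_enorm_sub_cellAvg_rpow_le hs hq hf k).trans ?_
  rw [hfA, ENNReal.ofReal_rpow_of_nonneg hA hq0.le, ← ENNReal.ofReal_mul (by positivity)]
  exact ENNReal.ofReal_le_ofReal (detail_rpow_bound hq hA k)

theorem le_of_rpow_le_two_pow_mul (hq : 1 ≤ q) {t b : ℝ} (hb : 0 ≤ b) {k : ℕ} (ht : 0 ≤ t)
    (h : t ^ q ≤ 2 ^ (k * d) * b ^ q) : t ≤ 2 ^ (k * (d / q)) * b := by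
  have hq0 : 0 < q := by linarith
  rw [← Real.rpow_le_rpow_iff ht (by positivity) hq0, Real.mul_rpow (by positivity) hb,
    ← Real.rpow_mul two_pos.le]
  refine h.trans_eq ?_
  rw [← Real.rpow_natCast]
  push_cast
  field_simp

theorem abs_cellAvg_sub_le_of_adjacent (hs : 0 < s) (hq : 1 ≤ q) (hf : Integrable f (cubeMeasure d))
    (hA : 0 ≤ A) (hfA : sobNorm d s q f = ENNReal.ofReal A) {k : ℕ} {b c : Fin d → Fin (2 ^ k)}
    (h : AdjacentCells b c) :
    |cellAvg f k b - cellAvg f k c| ≤ detailConst d s q * A * 2 ^ (k * (d / q - s)) := by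
  have hq0 : 0 < q := by linarith
  have h0 : 0 ≤ detailConst d s q := detailConst_pos.le
  have h1 : |cellAvg f k b - cellAvg f k c| ^ q ≤
      2 ^ (k * d) * (detailConst d s q * A * 2 ^ (-((k + 1 : ℕ) * s))) ^ q := by
    rw [← ENNReal.ofReal_le_ofReal_iff (by positivity), ← enorm_rpow hq0.le,
      ENNReal.ofReal_mul (by positivity), ENNReal.ofReal_pow two_pos.le, ENNReal.ofReal_ofNat]
    refine (enorm_cellAvg_sub_rpow_le_of_adjacent hs hq hf h).trans ?_
    gcongr
    rw [hfA, ENNReal.ofReal_rpow_of_nonneg hA hq0.le, ← ENNReal.ofReal_mul (by positivity)]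
    exact ENNReal.ofReal_le_ofReal (detail_rpow_bound hq hA k)
  refine (le_of_rpow_le_two_pow_mul hq (by positivity) (abs_nonneg _) h1).trans ?_
  rw [mul_left_comm, ← Real.rpow_add two_pos]
  refine mul_le_mul_of_nonneg_left (Real.rpow_le_rpow_of_exponent_le one_le_two ?_) (by positivity)
  push_cast
  linarith

end

section
variable {d : ℕ} {s q γ B : ℝ} {p : ℝ≥0∞}

theorem eLpNorm_detail_le (hq : 1 ≤ q) (hqp : ENNReal.ofReal q ≤ p)
    (hγ : γ = s - d / q * (1 - q / p.toReal)) (hB : 0 < B) {k : ℕ} {D : (Fin d → Fin (2 ^ k)) → ℝ}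
    (hD : ∑ c, |D c| ^ q ≤ 2 ^ (k * d) * (B * 2 ^ (-(k * s))) ^ q) :
    eLpNorm (fun x => D (dyadicCell k x)) p (cubeMeasure d) ≤
      ENNReal.ofReal (B * (2 ^ (-γ)) ^ k) := by
  have hb : 0 < B * 2 ^ (-(k * s)) := by positivity
  have hsup : ∀ c, |D c| ≤ 2 ^ (k * (d / q)) * (B * 2 ^ (-(k * s))) := fun c =>
    le_of_rpow_le_two_pow_mul hq hb.le (abs_nonneg _)
      ((Finset.single_le_sum (f := fun c => |D c| ^ q) (fun _ _ => by positivity)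
        (Finset.mem_univ c)).trans hD)
  refine (eLpNorm_comp_dyadicCell_le hq hqp hsup (by positivity) hb.le hD).trans_eq ?_
  congr 1
  rw [Real.mul_rpow (by positivity) hb.le, mul_assoc, ← Real.rpow_add hb, sub_add_cancel,
    Real.rpow_one, ← Real.rpow_mul two_pos.le, mul_left_comm, ← Real.rpow_add two_pos,
    ← Real.rpow_mul_natCast two_pos.le, hγ]
  ring_nf

theorem eLpNorm_sub_cellAvg_le_geometric (hs : 0 < s) (hq : 1 ≤ q) (hqp : ENNReal.ofReal q ≤ p)
    (hγ : γ = s - d / q * (1 - q / p.toReal)) (hγ0 : 0 < γ) {A : ℝ} {f : (Fin d → ℝ) → ℝ}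
    (hf : Measurable f) (hfi : Integrable f (cubeMeasure d)) (hA : 0 < A)
    (hfA : sobNorm d s q f = ENNReal.ofReal A) (R : ℕ) :
    eLpNorm (fun x => f x - cellAvg f R (dyadicCell R x)) p (cubeMeasure d) ≤
      ENNReal.ofReal (detailConst d s q * A * ((2 ^ (-γ)) ^ R * (1 - 2 ^ (-γ))⁻¹)) := by
  have hq0 : 0 < q := by linarith
  have hB : 0 < detailConst d s q * A := mul_pos detailConst_pos hA
  have hp1 : 1 ≤ p := le_trans (by simpa using hq) hqp
  have hr0 : (0 : ℝ) < 2 ^ (-γ) := by positivity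
  have hr1 : (2 : ℝ) ^ (-γ) < 1 := Real.rpow_lt_one_of_one_lt_of_neg one_lt_two (by linarith)
  have hU : ∀ (k : ℕ) (U : (Fin d → Fin (2 ^ k)) → ℝ), Measurable fun x => U (dyadicCell k x) :=
    fun k U => (measurable_of_finite U).comp (measurable_dyadicCell k)
  have hlim : Filter.Tendsto (fun n => eLpNorm ((fun x => cellAvg f n (dyadicCell n x)) - f)
      (ENNReal.ofReal q) (cubeMeasure d)) Filter.atTop (nhds 0) := by
    have h1 : Filter.Tendsto (fun n : ℕ => ENNReal.ofReal (detailConst d s q * A *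
        ((2 : ℝ) ^ (-s)) ^ (n + 1))) Filter.atTop (nhds 0) := by
      rw [← ENNReal.ofReal_zero, ← mul_zero (detailConst d s q * A)]
      refine ENNReal.tendsto_ofReal (Filter.Tendsto.const_mul _ ?_)
      exact (_root_.tendsto_pow_atTop_nhds_zero_of_lt_one (by positivity)
        (Real.rpow_lt_one_of_one_lt_of_neg one_lt_two (by linarith))).comp
        (Filter.tendsto_add_atTop_nat 1)
    refine tendsto_of_tendsto_of_tendsto_of_le_of_le tendsto_const_nhds h1
      (fun _ => bot_le) fun n => ?_
    rw [eLpNorm_sub_comm]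
    refine (eLpNorm_sub_cellAvg_le hs hq hfi hA.le hfA n).trans_eq ?_
    rw [← Real.rpow_mul_natCast two_pos.le]
    ring_nf
  obtain ⟨ns, hns, hae⟩ := (tendstoInMeasure_of_tendsto_eLpNorm (by simpa using hq0)
    (fun n => (hU n _).aestronglyMeasurable) hf.aestronglyMeasurable hlim).exists_seq_tendsto_ae
  have hbound : ∀ i, R ≤ i → eLpNorm (fun x => cellAvg f (ns i) (dyadicCell (ns i) x) -
      cellAvg f R (dyadicCell R x)) p (cubeMeasure d) ≤
      ENNReal.ofReal (detailConst d s q * A * ((2 ^ (-γ)) ^ R * (1 - 2 ^ (-γ))⁻¹)) := by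
    intro i hi
    have hRn : R ≤ ns i := hi.trans (hns.id_le i)
    have e : (fun x => cellAvg f (ns i) (dyadicCell (ns i) x) - cellAvg f R (dyadicCell R x)) =
        ∑ k ∈ Finset.Ico (R + 1) (ns i + 1), fun x : Fin d → ℝ => cellDetail f k (dyadicCell k x) := by
      funext x
      rw [Finset.sum_apply, Finset.sum_Ico_eq_sub _ (by omega), sum_cellDetail, sum_cellDetail]
    rw [e]
    refine (eLpNorm_sum_le (fun k _ => (hU k _).aestronglyMeasurable) hp1).trans ?_
    refine (Finset.sum_le_sum fun k _ => eLpNorm_detail_le hq hqp hγ hB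
      (sum_abs_cellDetail_rpow_le hs hq hfi hA.le hfA k)).trans ?_
    rw [← ENNReal.ofReal_sum_of_nonneg fun _ _ => by positivity, ← Finset.mul_sum,
      Finset.sum_Ico_eq_sum_range]
    refine ENNReal.ofReal_le_ofReal ?_
    simp only [pow_add, ← Finset.mul_sum]
    have := geom_sum_range_le hr0.le hr1 (ns i + 1 - (R + 1))
    have h2 : (2 : ℝ) ^ (-γ) * ∑ j ∈ range (ns i + 1 - (R + 1)), (2 ^ (-γ)) ^ j ≤
        1 * (1 - 2 ^ (-γ))⁻¹ := by gcongr
    rw [pow_one, mul_assoc ((2 ^ (-γ)) ^ R), one_mul] at *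
    gcongr
  refine (Lp.eLpNorm_lim_le_liminf_eLpNorm (fun i => ((hU (ns i) _).sub (hU R _)).aestronglyMeasurable)
    _ (hae.mono fun x hx => hx.sub_const _)).trans ?_
  refine Filter.liminf_le_of_frequently_le' (Filter.Eventually.frequently ?_)
  filter_upwards [Filter.eventually_ge_atTop R] with i hi
  exact hbound i hi

theorem quantum_le {ρ κ : ℝ} (hB : 0 < B) (hκ : κ ≤ s) (K k : ℕ)
    (hρ : ρ ≤ -κ ∨ k ≤ K) :
    quantum s ρ B K k ≤ B * 2 ^ (-(K * s)) * (2 ^ (-κ)) ^ (K - k + (k - K)) := by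
  rw [quantum, mul_assoc, ← Real.rpow_mul_natCast two_pos.le, ← Real.rpow_add two_pos]
  refine mul_le_mul_of_nonneg_left (Real.rpow_le_rpow_of_exponent_le one_le_two ?_) hB.le
  rcases le_or_gt k K with h | h
  · rw [show k - K = 0 by omega]
    push_cast
    have h1 : (0 : ℝ) ≤ (K - k : ℕ) := by positivity
    nlinarith
  · rw [show K - k = 0 by omega]
    push_cast
    have h1 : (0 : ℝ) ≤ (k - K : ℕ) := by positivity
    have h2 : ρ ≤ -κ := hρ.resolve_right (by omega)
    nlinarith

theorem eLpNorm_sub_roundTo_le (hq : 1 ≤ q) (hqp : ENNReal.ofReal q ≤ p)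
    (hγ : γ = s - d / q * (1 - q / p.toReal)) (hγ0 : 0 < γ) (hB : 0 < B) (K : ℕ) {k : ℕ}
    {D : (Fin d → Fin (2 ^ k)) → ℝ}
    (hD : ∑ c, |D c| ^ q ≤ 2 ^ (k * d) * (B * 2 ^ (-(k * s))) ^ q) :
    eLpNorm (fun x => D (dyadicCell k x) -
        roundTo (quantum s (d / q - s + γ / 2) B K k) (D (dyadicCell k x))) p (cubeMeasure d) ≤
      ENNReal.ofReal (B * 2 ^ (-(K * s)) * (2 ^ (-(min s (γ / 2)))) ^ (K - k + (k - K))) := by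
  have hδ := quantum_pos (s := s) (ρ := d / q - s + γ / 2) hB K k
  set δ := quantum s (d / q - s + γ / 2) B K k with hδd
  have hr := fun c => abs_sub_roundTo hδ (D c)
  rcases le_or_gt k K with hk | hk
  · have h1 : ∀ᵐ x ∂cubeMeasure d, ‖D (dyadicCell k x) - roundTo δ (D (dyadicCell k x))‖ ≤ δ :=
      Filter.Eventually.of_forall fun x => (hr _).1
    refine (eLpNorm_le_of_ae_bound h1).trans ?_
    simp only [measure_univ, ENNReal.one_rpow, one_mul]
    exact ENNReal.ofReal_le_ofReal (quantum_le hB (min_le_left _ _) K k (Or.inr hk))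
  · have hθ := div_toReal_le_one hqp
    have hθ0 : 0 ≤ q / p.toReal := by positivity
    have hb : 0 < B * 2 ^ (-(k * s)) := by positivity
    have hU : ∑ c, |D c - roundTo δ (D c)| ^ q ≤ 2 ^ (k * d) * (B * 2 ^ (-(k * s))) ^ q :=
      (Finset.sum_le_sum fun c _ => by
        have := (hr c).2
        gcongr).trans hD
    refine (eLpNorm_comp_dyadicCell_le (U := fun c => D c - roundTo δ (D c)) hq hqp
      (fun c => (hr c).1) hδ.le hb.le hU).trans (ENNReal.ofReal_le_ofReal ?_)
    rw [hδd, quantum, Real.mul_rpow hB.le (by positivity), Real.mul_rpow hB.le (by positivity),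
      mul_mul_mul_comm, ← Real.rpow_add hB, sub_add_cancel, Real.rpow_one, mul_assoc,
      ← Real.rpow_mul two_pos.le, ← Real.rpow_mul two_pos.le, ← Real.rpow_mul_natCast two_pos.le,
      ← Real.rpow_add two_pos, ← Real.rpow_add two_pos]
    obtain ⟨m, rfl⟩ := Nat.exists_eq_add_of_lt hk
    rw [show K - (K + m + 1) = 0 by omega, show K + m + 1 - K = m + 1 by omega]
    refine mul_le_mul_of_nonneg_left (Real.rpow_le_rpow_of_exponent_le one_le_two ?_) hB.le
    have h2 : min s (γ / 2) ≤ γ / 2 := min_le_right _ _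
    set θ := q / p.toReal with hθd
    have e : (-(K * s) - s * (0 : ℕ) + (d / q - s + γ / 2) * (m + 1 : ℕ)) * (1 - θ) +
        -((K + m + 1 : ℕ) * s) * θ =
        -(K * s) + (d / q * (1 - θ) - s + γ / 2 * (1 - θ)) * (m + 1) := by
      push_cast
      ring
    rw [e]
    push_cast
    have h3 : d / q * (1 - θ) - s + γ / 2 * (1 - θ) ≤ -min s (γ / 2) := by
      nlinarith
    have h4 : (0 : ℝ) ≤ m + 1 := by positivity
    nlinarith [mul_le_mul_of_nonneg_right h3 h4]

end

section
variable {d : ℕ} {s q γ B : ℝ} {p : ℝ≥0∞}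

theorem sum_geometric_dist_le {κ : ℝ} (hκ : 0 < κ) (K n : ℕ) :
    ∑ k ∈ range n, ((2 : ℝ) ^ (-κ)) ^ (K - k + (k - K)) ≤ 2 * (1 - 2 ^ (-κ))⁻¹ :=
  sum_range_dist_le (g := fun i => ((2 : ℝ) ^ (-κ)) ^ i) (fun _ => by positivity)
    (geom_sum_range_le (by positivity)
      (Real.rpow_lt_one_of_one_lt_of_neg one_lt_two (by linarith))) K n

theorem eLpNorm_sub_quantized_le (hs : 0 < s) (hq : 1 ≤ q) (hqp : ENNReal.ofReal q ≤ p)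
    (hγ : γ = s - d / q * (1 - q / p.toReal)) (hγ0 : 0 < γ) (hB : 0 < B) (K R : ℕ)
    {D : ∀ k : ℕ, (Fin d → Fin (2 ^ k)) → ℝ}
    (hD : ∀ k, ∑ c, |D k c| ^ q ≤ 2 ^ (k * d) * (B * 2 ^ (-(k * s))) ^ q) :
    eLpNorm (fun x => ∑ k ∈ range (R + 1), D k (dyadicCell k x) - ∑ k ∈ range (R + 1),
        roundTo (quantum s (d / q - s + γ / 2) B K k) (D k (dyadicCell k x))) p (cubeMeasure d) ≤
      ENNReal.ofReal (B * 2 ^ (-(K * s)) * (2 * (1 - 2 ^ (-(min s (γ / 2))))⁻¹)) := by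
  have hp1 : 1 ≤ p := le_trans (by simpa using hq) hqp
  have hκ : 0 < min s (γ / 2) := lt_min hs (by linarith)
  have e : (fun x => ∑ k ∈ range (R + 1), D k (dyadicCell k x) - ∑ k ∈ range (R + 1),
        roundTo (quantum s (d / q - s + γ / 2) B K k) (D k (dyadicCell k x))) =
      ∑ k ∈ range (R + 1), fun x : Fin d → ℝ => D k (dyadicCell k x) -
        roundTo (quantum s (d / q - s + γ / 2) B K k) (D k (dyadicCell k x)) := by
    funext x
    rw [Finset.sum_apply, Finset.sum_sub_distrib]
  rw [e]
  refine (eLpNorm_sum_le (fun k _ => ?_) hp1).trans ((Finset.sum_le_sum fun k _ =>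
    eLpNorm_sub_roundTo_le hq hqp hγ hγ0 hB K (hD k)).trans ?_)
  · exact ((measurable_of_finite (fun c => D k c -
      roundTo (quantum s (d / q - s + γ / 2) B K k) (D k c))).comp
      (measurable_dyadicCell k)).aestronglyMeasurable
  · rw [← ENNReal.ofReal_sum_of_nonneg fun _ _ => by positivity, ← Finset.mul_sum]
    exact ENNReal.ofReal_le_ofReal (by gcongr; exact sum_geometric_dist_le hκ K _)

theorem abs_sub_quantized_le {ρ κ : ℝ} (hB : 0 < B) (hκ0 : 0 < κ) (hκ : κ ≤ s) (hρ : ρ ≤ -κ)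
    (K n : ℕ) (a : ℕ → ℝ) :
    |∑ k ∈ range n, a k - ∑ k ∈ range n, roundTo (quantum s ρ B K k) (a k)| ≤
      B * 2 ^ (-(K * s)) * (2 * (1 - 2 ^ (-κ))⁻¹) := by
  rw [← Finset.sum_sub_distrib]
  calc |∑ k ∈ range n, (a k - roundTo (quantum s ρ B K k) (a k))|
      ≤ ∑ k ∈ range n, |a k - roundTo (quantum s ρ B K k) (a k)| := Finset.abs_sum_le_sum_abs _ _
    _ ≤ ∑ k ∈ range n, B * 2 ^ (-(K * s)) * (2 ^ (-κ)) ^ (K - k + (k - K)) :=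
        Finset.sum_le_sum fun k _ => (abs_sub_roundTo (quantum_pos hB K k) _).1.trans
          (quantum_le hB hκ K k (Or.inl hρ))
    _ ≤ _ := by
        rw [← Finset.mul_sum]
        gcongr
        exact sum_geometric_dist_le hκ0 K n

end

theorem exists_eLpNorm_sub_le_of_hull {d : ℕ} {p : ℝ≥0∞} (hp1 : 1 ≤ p) (hp : p ≠ ⊤)
    {h : (Fin d → ℝ) → ℝ} (hm : Measurable h) {H : ℝ} (hH : ∀ x, |h x| ≤ H)
    (hloc : ∀ᵐ x ∂cubeMeasure d, ∀ᶠ y in nhds x, h y = h x) {P : ((Fin d → ℝ) → ℝ) → Prop}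
    (hPm : ∀ G, P G → Measurable G) {ε₀ : ℝ} (hε₀ : 0 < ε₀)
    (hG : ∀ ε, 0 < ε → ε ≤ ε₀ → ∃ G, P G ∧ ∀ x, (∃ y, (∀ i, |y i - x i| ≤ ε) ∧ h y ≤ G x) ∧
      ∃ y, (∀ i, |y i - x i| ≤ ε) ∧ G x ≤ h y) {η : ℝ} (hη : 0 < η) :
    ∃ G, P G ∧ eLpNorm (fun x => h x - G x) p (cubeMeasure d) ≤ ENNReal.ofReal η := by
  have hε : ∀ n : ℕ, 0 < ε₀ / (n + 1) ∧ ε₀ / (n + 1) ≤ ε₀ := fun n =>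
    ⟨by positivity, div_le_self hε₀.le (by simp)⟩
  choose G hP hlo hhi using fun n : ℕ =>
    (hG _ (hε n).1 (hε n).2).imp fun G hG => And.intro hG.1 (forall_and.1 hG.2)
  have hlim : ∀ᵐ x ∂cubeMeasure d, Filter.Tendsto (fun n => G n x) Filter.atTop (nhds (h x)) := by
    filter_upwards [hloc] with x hx
    obtain ⟨δ, hδ, hball⟩ := Metric.eventually_nhds_iff.1 hx
    have h1 : ∀ᶠ n : ℕ in Filter.atTop, ε₀ / (n + 1) < δ := by
      have : Filter.Tendsto (fun n : ℕ => ε₀ / ((n : ℝ) + 1)) Filter.atTop (nhds 0) :=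
        tendsto_const_div_atTop_nhds_zero_nat ε₀ |>.comp (Filter.tendsto_add_atTop_nat 1) |>.congr
          fun n => by simp
      exact this.eventually_lt_const hδ
    refine tendsto_const_nhds.congr' (h1.mono fun n hn => ?_)
    have key : ∀ y : Fin d → ℝ, (∀ i, |y i - x i| ≤ ε₀ / (n + 1)) → h y = h x := fun y hy =>
      hball (((dist_pi_le_iff (hε n).1.le).2 fun i => by rw [Real.dist_eq]; exact hy i).trans_lt hn)
    obtain ⟨y, hy, hy'⟩ := hlo n x
    obtain ⟨z, hz, hz'⟩ := hhi n x
    rw [key y hy] at hy'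
    rw [key z hz] at hz'
    exact le_antisymm hy' hz'
  have hbd : ∀ n x, |G n x| ≤ H := fun n x => by
    obtain ⟨y, -, hy'⟩ := hlo n x
    obtain ⟨z, -, hz'⟩ := hhi n x
    exact abs_le.2 ⟨(abs_le.1 (hH y)).1.trans hy', hz'.trans (abs_le.1 (hH z)).2⟩
  have hT : Filter.Tendsto (fun n => eLpNorm (G n - h) p (cubeMeasure d)) Filter.atTop (nhds 0) := by
    refine tendsto_Lp_finite_of_tendsto_ae hp1 hp
      (fun n => (hPm _ (hP n)).aestronglyMeasurable) (MemLp.of_bound hm.aestronglyMeasurable H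
        (Filter.Eventually.of_forall hH)) ?_ hlim
    refine unifIntegrable_of hp1 hp (fun n => (hPm _ (hP n)).aestronglyMeasurable) fun _ _ =>
      ⟨(H + 1).toNNReal, fun n => ?_⟩
    have e : {x | (H + 1).toNNReal ≤ ‖G n x‖₊} = ∅ := by
      refine Set.eq_empty_of_forall_notMem fun x hx => ?_
      have h1 := (Real.toNNReal_le_iff_le_coe.1 hx).trans (hbd n x)
      linarith
    rw [e, Set.indicator_empty, eLpNorm_zero']
    exact bot_le
  obtain ⟨n, hn⟩ := (hT.eventually_lt_const (ENNReal.ofReal_pos.2 hη)).exists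
  exact ⟨G n, hP n, (eLpNorm_sub_comm _ _ _ _).trans_le hn.le⟩

theorem IsAff.measurable {ι : Type} [Fintype ι] {φ : (ι → ℝ) → ℝ} (h : IsAff φ) :
    Measurable φ := by
  obtain ⟨a, c, h⟩ := h
  rw [funext h]
  fun_prop

theorem IsNet.measurable {ι κ : Type} [Fintype ι] {W L : ℕ} {g : (ι → ℝ) → κ → ℝ}
    (h : IsNet W L g) (k : κ) : Measurable fun x => g x k := by
  induction L generalizing ι with
  | zero => exact (h k).measurable
  | succ L ih =>
    obtain ⟨n, A, h, -, -, hA, hh, rfl⟩ := h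
    exact (ih hh).comp (measurable_pi_lambda _ fun i => (hA i).measurable.max measurable_const)

theorem ae_eventually_eq_of_dyadicCell {d : ℕ} (a : ∀ k : ℕ, (Fin d → Fin (2 ^ k)) → ℝ) (n : ℕ) :
    ∀ᵐ x ∂cubeMeasure d, ∀ᶠ y in nhds x, ∑ k ∈ range n, a k (dyadicCell k y) =
      ∑ k ∈ range n, a k (dyadicCell k x) := by
  filter_upwards [ae_all_iff.2 (ae_eventually_dyadicCell_eq d)] with x hx
  filter_upwards [(Filter.eventually_all_finset (range n)).2 fun k _ => hx k] with y hy
  exact Finset.sum_congr rfl fun k hk => by rw [hy k hk]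

theorem adjacentCells_dyadicCell {d k : ℕ} {x y : Fin d → ℝ} (h : ∀ i, |y i - x i| ≤ 1 / 2 ^ k) :
    AdjacentCells (dyadicCell k y) (dyadicCell k x) := fun i =>
  ⟨dyadicIdx_dist_le_one (h i), dyadicIdx_dist_le_one (abs_sub_comm (y i) (x i) ▸ h i)⟩

section
variable {d : ℕ} {s q γ : ℝ} {p : ℝ≥0∞}

theorem exists_net_sub_cellAvg_le (hd : 1 ≤ d) (hs : 0 < s) (hq : 1 ≤ q)
    (hqp : ENNReal.ofReal q ≤ p) (hγ : γ = s - d / q * (1 - q / p.toReal)) (hγ0 : 0 < γ) :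
    ∃ C : ℕ, 1 ≤ C ∧ ∀ W L : ℕ, 1 ≤ W → 1 ≤ L → ∀ K : ℕ, (2 : ℝ) ^ (K * d) ≤ ((W : ℝ) * L) ^ 2 →
      ∀ R : ℕ, K * s ≤ R * γ → ∀ A : ℝ, 0 < A → ∀ f : (Fin d → ℝ) → ℝ,
      Integrable f (cubeMeasure d) → sobNorm d s q f = ENNReal.ofReal A →
      ∃ G, IsNet1 (C * W) (C * L) G ∧
        eLpNorm (fun x => cellAvg f R (dyadicCell R x) - G x) p (cubeMeasure d) ≤
          ENNReal.ofReal (detailConst d s q * A * 2 ^ (-(K * s)) *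
            (2 * (1 - 2 ^ (-(min s (γ / 2))))⁻¹ + 1)) := by
  obtain ⟨C, hC, hnet⟩ := exists_net_quantized hd hs hq hγ0
  refine ⟨C, hC, fun W L hW hL K hK R hR A hA f hf hfA => ?_⟩
  have hB : 0 < detailConst d s q * A := mul_pos detailConst_pos hA
  have hκ : 0 < min s (γ / 2) := lt_min hs (by linarith)
  have hκ1 : (2 : ℝ) ^ (-(min s (γ / 2))) < 1 :=
    Real.rpow_lt_one_of_one_lt_of_neg one_lt_two (by linarith)
  have hM : 0 < (1 - (2 : ℝ) ^ (-(min s (γ / 2))))⁻¹ := inv_pos.2 (by linarith)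
  have hD := fun k => sum_abs_cellDetail_rpow_le hs hq hf hA.le hfA k
  have hG := hnet W L hW hL K hK _ hB (cellDetail f) hD R
  have hp1 : 1 ≤ p := le_trans (by simpa using hq) hqp
  have hε₀ : (0 : ℝ) < 1 / 2 ^ R / 3 := by positivity
  simp only [← sum_cellDetail f R]
  rcases eq_or_ne p ⊤ with rfl | hp
  · have hγ' : γ = s - d / q := by simpa using hγ
    obtain ⟨G, hGnet, hGh⟩ := hG _ hε₀ (by linarith)
    refine ⟨G, hGnet, ?_⟩
    rw [eLpNorm_exponent_top]
    refine eLpNormEssSup_le_of_ae_bound (Filter.Eventually.of_forall fun x => ?_)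
    have hstep : (detailConst d s q * A) * 2 ^ (R * (d / q - s)) ≤
        detailConst d s q * A * 2 ^ (-(K * s)) := by
      refine mul_le_mul_of_nonneg_left (Real.rpow_le_rpow_of_exponent_le one_le_two ?_) hB.le
      rw [hγ'] at hR
      linarith
    have hclose : ∀ y : Fin d → ℝ, (∀ i, |y i - x i| ≤ 1 / 2 ^ R / 3) →
        |∑ k ∈ range (R + 1), roundTo (quantum s (d / q - s + γ / 2) (detailConst d s q * A) K k)
          (cellDetail f k (dyadicCell k y)) -
          ∑ k ∈ range (R + 1), cellDetail f k (dyadicCell k x)| ≤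
        detailConst d s q * A * 2 ^ (-(K * s)) * (2 * (1 - 2 ^ (-(min s (γ / 2))))⁻¹ + 1) := by
      intro y hy
      have h1 := abs_sub_quantized_le hB hκ (min_le_left _ _) (ρ := d / q - s + γ / 2)
        (by linarith [min_le_right s (γ / 2)]) K (R + 1) fun k => cellDetail f k (dyadicCell k y)
      have h2 := (abs_cellAvg_sub_le_of_adjacent hs hq hf hA.le hfA (adjacentCells_dyadicCell
        (k := R) fun i => (hy i).trans (div_le_self (by positivity) (by norm_num)))).trans hstep
      rw [← sum_cellDetail, ← sum_cellDetail] at h2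
      rw [abs_sub_comm] at h1
      refine (abs_sub_le _ _ _).trans ((add_le_add h1 h2).trans_eq ?_)
      ring
    obtain ⟨⟨y, hy, hy'⟩, z, hz, hz'⟩ := hGh x
    have h1 := (abs_le.1 (hclose y hy)).1
    have h2 := (abs_le.1 (hclose z hz)).2
    rw [Real.norm_eq_abs, abs_sub_comm]
    exact abs_le.2 ⟨by linarith, by linarith⟩
  · set a : ∀ k : ℕ, (Fin d → Fin (2 ^ k)) → ℝ := fun k c =>
      roundTo (quantum s (d / q - s + γ / 2) (detailConst d s q * A) K k) (cellDetail f k c) with ha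
    have hm : Measurable fun x : Fin d → ℝ => ∑ k ∈ range (R + 1), a k (dyadicCell k x) :=
      Finset.measurable_sum _ fun k _ =>
        (measurable_of_finite (a k)).comp (measurable_dyadicCell k)
    have hH : ∀ x : Fin d → ℝ, |∑ k ∈ range (R + 1), a k (dyadicCell k x)| ≤
        ∑ k ∈ range (R + 1), ∑ c, |a k c| := fun x =>
      (Finset.abs_sum_le_sum_abs _ _).trans (Finset.sum_le_sum fun k _ =>
        Finset.single_le_sum (f := fun c => |a k c|) (fun _ _ => abs_nonneg _) (Finset.mem_univ _))
    have hη : 0 < detailConst d s q * A * 2 ^ (-(K * s)) := by positivity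
    obtain ⟨G, hGnet, hGerr⟩ := exists_eLpNorm_sub_le_of_hull hp1 hp hm hH
      (ae_eventually_eq_of_dyadicCell a _) (P := IsNet1 (C * W) (C * L))
      (fun G h => IsNet.measurable h ()) hε₀ (fun ε h1 h2 => hG ε h1 (by linarith)) hη
    refine ⟨G, hGnet, ?_⟩
    have hm' : Measurable fun x : Fin d → ℝ =>
        ∑ k ∈ range (R + 1), cellDetail f k (dyadicCell k x) :=
      Finset.measurable_sum _ fun k _ =>
        (measurable_of_finite (cellDetail f k)).comp (measurable_dyadicCell k)
    have hGm : Measurable G := IsNet.measurable hGnet ()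
    have e : (fun x : Fin d → ℝ => ∑ k ∈ range (R + 1), cellDetail f k (dyadicCell k x) - G x) =
        (fun x => ∑ k ∈ range (R + 1), cellDetail f k (dyadicCell k x) -
          ∑ k ∈ range (R + 1), a k (dyadicCell k x)) +
        fun x => ∑ k ∈ range (R + 1), a k (dyadicCell k x) - G x := by
      funext x
      simp
    rw [e, mul_add, mul_one, ENNReal.ofReal_add (by positivity) hη.le]
    exact (eLpNorm_add_le (hm'.sub hm).aestronglyMeasurable (hm.sub hGm).aestronglyMeasurable
      hp1).trans (add_le_add (eLpNorm_sub_quantized_le hs hq hqp hγ hγ0 hB K R hD) hGerr)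

end

section
variable {d : ℕ} {s q : ℝ} {p : ℝ≥0∞} {f : (Fin d → ℝ) → ℝ}

theorem memLp_of_sobNorm_lt_top (hq : 1 ≤ q) (hf : Measurable f) (h : sobNorm d s q f < ⊤) :
    MemLp f (ENNReal.ofReal q) (cubeMeasure d) := by
  have hq0 : 0 < q := by linarith
  refine ⟨hf.aestronglyMeasurable, ?_⟩
  rw [eLpNorm_lt_top_iff_lintegral_rpow_enorm_lt_top (by simpa using hq0) ENNReal.ofReal_ne_top,
    ENNReal.toReal_ofReal hq0.le]
  exact (le_self_add.trans (sobNorm_rpow hq).ge).trans_lt (ENNReal.rpow_lt_top_of_nonneg hq0.le h.ne)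

theorem ae_eq_zero_of_sobNorm_eq_zero (hq : 1 ≤ q) (hf : Measurable f) (h : sobNorm d s q f = 0) :
    f =ᵐ[cubeMeasure d] 0 := by
  have hq0 : 0 < q := by linarith
  have h1 := sobNorm_rpow (d := d) (s := s) (f := f) hq
  rw [h, ENNReal.zero_rpow_of_pos hq0, eq_comm, add_eq_zero,
    lintegral_eq_zero_iff (hf.enorm.pow_const q)] at h1
  exact h1.1.mono fun x hx => by simpa [hq0, hq0.le, hq0.not_gt] using hx

theorem exists_net_approx (hd : 1 ≤ d) (hs : 0 < s) (hq : 1 ≤ q) (hqp : ENNReal.ofReal q ≤ p)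
    (hemb : 1 / q - 1 / p.toReal < s / d) :
    ∃ C : ℕ, 1 ≤ C ∧ ∃ M : ℝ, 0 < M ∧ ∀ W L : ℕ, 1 ≤ W → 1 ≤ L → ∀ f : (Fin d → ℝ) → ℝ,
      Measurable f → ∀ A : ℝ, 0 < A → sobNorm d s q f = ENNReal.ofReal A →
      ∃ G, IsNet1 (C * W) (C * L) G ∧ eLpNorm (fun x => f x - G x) p (cubeMeasure d) ≤
        ENNReal.ofReal (M * A * ((W : ℝ) * L) ^ (-(2 * s) / d)) := by
  have hd0 : (0 : ℝ) < d := by exact_mod_cast hd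
  have hq0 : 0 < q := by linarith
  obtain ⟨γ, hγ⟩ : ∃ γ, γ = s - d / q * (1 - q / p.toReal) := ⟨_, rfl⟩
  have hγ0 : 0 < γ := by
    have h1 : d / q * (1 - q / p.toReal) = (1 / q - 1 / p.toReal) * d := by
      field_simp
    rw [lt_div_iff₀ hd0] at hemb
    linarith
  have hγ1 : 0 < (1 - (2 : ℝ) ^ (-γ))⁻¹ := inv_pos.2 (by
    linarith [Real.rpow_lt_one_of_one_lt_of_neg _root_.one_lt_two (neg_lt_zero.2 hγ0)])
  have hκ1 : 0 < (1 - (2 : ℝ) ^ (-(min s (γ / 2))))⁻¹ := inv_pos.2 (by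
    linarith [Real.rpow_lt_one_of_one_lt_of_neg _root_.one_lt_two
      (neg_lt_zero.2 (lt_min hs (half_pos hγ0)))])
  have hB : 0 < detailConst d s q := detailConst_pos
  have hp1 : 1 ≤ p := le_trans (by simpa using hq) hqp
  obtain ⟨C, hC, hnet⟩ := exists_net_sub_cellAvg_le hd hs hq hqp hγ hγ0
  refine ⟨C, hC, detailConst d s q * 2 ^ s *
    ((1 - (2 : ℝ) ^ (-γ))⁻¹ + (2 * (1 - 2 ^ (-(min s (γ / 2))))⁻¹ + 1)), by positivity,
    fun W L hW hL f hf A hA hfA => ?_⟩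
  have hfi : Integrable f (cubeMeasure d) := (memLp_of_sobNorm_lt_top hq hf
    (hfA ▸ ENNReal.ofReal_lt_top)).integrable (by simpa using hq)
  have hWL : (1 : ℝ) ≤ W * L := by exact_mod_cast Nat.mul_pos hW hL
  obtain ⟨K, hK1, hK2⟩ := exists_nat_pow_near (one_le_pow₀ hWL (n := 2))
    (one_lt_pow₀ (_root_.one_lt_two (α := ℝ)) (by omega : d ≠ 0))
  rw [← pow_mul, mul_comm d] at hK1 hK2
  obtain ⟨R, hR⟩ := exists_nat_ge (K * s / γ)
  rw [div_le_iff₀ hγ0] at hR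
  obtain ⟨G, hGnet, hG⟩ := hnet W L hW hL K hK1 R hR A hA f hfi hfA
  refine ⟨G, hGnet, ?_⟩
  have hGm : Measurable G := IsNet.measurable hGnet ()
  have ha : Measurable fun x : Fin d → ℝ => cellAvg f R (dyadicCell R x) :=
    (measurable_of_finite (cellAvg f R)).comp (measurable_dyadicCell R)
  have e : (fun x : Fin d → ℝ => f x - G x) = (fun x => f x - cellAvg f R (dyadicCell R x)) +
      fun x => cellAvg f R (dyadicCell R x) - G x := by
    funext x
    simp
  have hpowR : ((2 : ℝ) ^ (-γ)) ^ R ≤ 2 ^ (-(K * s)) := by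
    rw [← Real.rpow_mul_natCast two_pos.le]
    exact Real.rpow_le_rpow_of_exponent_le one_le_two (by linarith)
  have hpowK : (2 : ℝ) ^ (-(K * s)) ≤ 2 ^ s * ((W : ℝ) * L) ^ (-(2 * s) / d) := by
    have h1 : ((2 : ℝ) ^ ((K + 1) * d)) ^ (-(s / d)) ≤ (((W : ℝ) * L) ^ 2) ^ (-(s / d)) :=
      Real.rpow_le_rpow_of_nonpos (by positivity) hK2.le (neg_nonpos.2 (by positivity))
    rw [← Real.rpow_natCast, ← Real.rpow_natCast, ← Real.rpow_mul two_pos.le,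
      ← Real.rpow_mul (by positivity)] at h1
    calc (2 : ℝ) ^ (-(K * s)) = 2 ^ s * 2 ^ (((K + 1) * d : ℕ) * -(s / d)) := by
          rw [← Real.rpow_add two_pos]
          congr 1
          push_cast
          field_simp
          ring
      _ ≤ 2 ^ s * ((W : ℝ) * L) ^ ((2 : ℕ) * -(s / d)) := by gcongr
      _ = _ := by
          congr 2
          push_cast
          ring
  rw [e]
  refine (eLpNorm_add_le (hf.sub ha).aestronglyMeasurable (ha.sub hGm).aestronglyMeasurable
    hp1).trans ((add_le_add (eLpNorm_sub_cellAvg_le_geometric hs hq hqp hγ hγ0 hf hfi hA hfA R)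
      hG).trans ?_)
  rw [← ENNReal.ofReal_add (by positivity) (by positivity)]
  refine ENNReal.ofReal_le_ofReal ?_
  calc _ ≤ detailConst d s q * A * (2 ^ (-(K * s)) * (1 - 2 ^ (-γ))⁻¹) +
        detailConst d s q * A * 2 ^ (-(K * s)) *
          (2 * (1 - 2 ^ (-(min s (γ / 2))))⁻¹ + 1) := by gcongr
    _ = detailConst d s q * A * 2 ^ (-(K * s)) * ((1 - (2 : ℝ) ^ (-γ))⁻¹ +
          (2 * (1 - 2 ^ (-(min s (γ / 2))))⁻¹ + 1)) := by ring
    _ ≤ detailConst d s q * A * (2 ^ s * ((W : ℝ) * L) ^ (-(2 * s) / d)) *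
          ((1 - (2 : ℝ) ^ (-γ))⁻¹ + (2 * (1 - 2 ^ (-(min s (γ / 2))))⁻¹ + 1)) := by gcongr
    _ = _ := by ring

end

theorem mul_rpow_rescale_le {C W L : ℕ} (hC : 1 ≤ C) (hW : C ≤ W) (hL : C ≤ L) {t : ℝ}
    (ht : 0 ≤ t) : (((W / C : ℕ) : ℝ) * (L / C : ℕ)) ^ (-t) ≤
      (4 * (C : ℝ) ^ 2) ^ t * ((W : ℝ) * L) ^ (-t) := by
  have key : ∀ n : ℕ, C ≤ n → (0 : ℝ) < (n / C : ℕ) ∧ (n : ℝ) ≤ 2 * C * (n / C : ℕ) := by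
    intro n hn
    have h1 : 1 ≤ n / C := Nat.div_pos hn hC
    have h2 : n ≤ 2 * C * (n / C) := by
      have := Nat.div_add_mod n C
      have := Nat.mod_lt n hC
      nlinarith
    exact ⟨by exact_mod_cast h1, by exact_mod_cast h2⟩
  obtain ⟨hW0, hW1⟩ := key W hW
  obtain ⟨hL0, hL1⟩ := key L hL
  have hC0 : (0 : ℝ) < C := by exact_mod_cast hC
  have hWL : (0 : ℝ) < W * L := by
    have : 0 < W * L := Nat.mul_pos (by omega) (by omega)
    exact_mod_cast this
  rw [Real.rpow_neg (by positivity), Real.rpow_neg hWL.le, ← div_eq_mul_inv,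
    ← Real.div_rpow (by positivity) hWL.le, ← Real.inv_rpow (by positivity)]
  refine Real.rpow_le_rpow (by positivity) ?_ ht
  rw [inv_le_iff_one_le_mul₀ (by positivity), ← mul_div_right_comm, one_le_div hWL]
  calc (W : ℝ) * L ≤ (2 * C * (W / C : ℕ)) * (2 * C * (L / C : ℕ)) := by gcongr
    _ = _ := by ring

theorem sobolev_approximation (d : ℕ) (hd : 1 ≤ d) (s q : ℝ) (p : ℝ≥0∞)
    (hs0 : 0 < s) (hs1 : s < 1) (hq : 1 ≤ q) (hp : 1 ≤ p)
    (hemb : 1 / q - 1 / p.toReal < s / d) :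
    ∃ (C : ℝ) (W₀ L₀ : ℕ), 0 < C ∧ 1 ≤ W₀ ∧ 1 ≤ L₀ ∧
      ∀ W L : ℕ, W₀ ≤ W → L₀ ≤ L →
        ∀ f : (Fin d → ℝ) → ℝ, Measurable f → sobNorm d s q f < ⊤ →
          ∃ g ∈ NN d 1 W L,
            eLpNorm (fun x => f x - g x 0) p (volume.restrict (unitCube d)) ≤
              ENNReal.ofReal C * sobNorm d s q f *
                ENNReal.ofReal (((W : ℝ) * (L : ℝ)) ^ (-(2 * s) / d)) := by
  have hd0 : (0 : ℝ) < d := by exact_mod_cast hd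
  have hq0 : 0 < q := by linarith
  have hemb' : 1 / q - 1 / (max p (ENNReal.ofReal q)).toReal < s / d := by
    rcases le_total p (ENNReal.ofReal q) with h | h
    · rw [max_eq_right h, ENNReal.toReal_ofReal hq0.le, sub_self]
      positivity
    · rwa [max_eq_left h]
  obtain ⟨C, hC, M, hM, hnet⟩ := exists_net_approx hd hs0 hq (le_max_right p _) hemb'
  refine ⟨M * (4 * (C : ℝ) ^ 2) ^ (2 * s / d), 2 * C, C, by positivity, by omega, hC,
    fun W L hW hL f hf hfin => ?_⟩
  rcases eq_or_ne (sobNorm d s q f) 0 with h0 | h0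
  · refine ⟨_, (IsNet1.aff (by omega : 2 ≤ W) L (IsAff.const 0)).mem_NN, ?_⟩
    refine le_of_eq_of_le ?_ bot_le
    simp only [_root_.sub_zero]
    exact eLpNorm_eq_zero_of_ae_zero (ae_eq_zero_of_sobNorm_eq_zero hq hf h0)
  · have hA : 0 < (sobNorm d s q f).toReal := ENNReal.toReal_pos h0 hfin.ne
    have hfA := (ENNReal.ofReal_toReal hfin.ne).symm
    obtain ⟨G, hGnet, hG⟩ := hnet (W / C) (L / C) (Nat.div_pos (by omega) hC)
      (Nat.div_pos hL hC) f hf _ hA hfA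
    refine ⟨_, (hGnet.deepen (Nat.mul_div_le L C) (Nat.mul_div_le W C) (by omega)).mem_NN, ?_⟩
    have hGm : Measurable G := IsNet.measurable hGnet ()
    refine (eLpNorm_le_eLpNorm_of_exponent_le (μ := cubeMeasure d) (le_max_left p _)
      (hf.sub hGm).aestronglyMeasurable).trans (hG.trans ?_)
    have h1 := mul_rpow_rescale_le hC (by omega : C ≤ W) hL (t := 2 * s / d) (by positivity)
    rw [← neg_div] at h1
    conv_rhs => rw [hfA]
    rw [← ENNReal.ofReal_mul (by positivity), ← ENNReal.ofReal_mul (by positivity)]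
    refine ENNReal.ofReal_le_ofReal ?_
    calc _ ≤ M * (sobNorm d s q f).toReal *
          ((4 * (C : ℝ) ^ 2) ^ (2 * s / d) * ((W : ℝ) * L) ^ (-(2 * s) / d)) := by gcongr
      _ = _ := by ring
end
end

section
/- (Summation) Let n ≥ 1 and let f_i ∈ NN_{d,k}(W_i, L_i) for i = 1,…,n. Then the sum Σ_{i=1}^n f_i belongs both to NN_{d,k}(Σ_{i=1}^n W_i, max_{1≤i≤n} L_i) and to NN_{d,k}(max_{1≤i≤n} W_i + 2d + 2k, Σ_{i=1}^n L_i). -/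
open MeasureTheory ENNReal Finset

/-- `g` is an affine function `ℝ^n → ℝ`. -/
def IsAffineFun {n : ℕ} (g : (Fin n → ℝ) → ℝ) : Prop :=
  ∃ (a : Fin n → ℝ) (c : ℝ), ∀ x, g x = (∑ j, a j * x j) + c

theorem isAffineMap_iff {n m : ℕ} {A : (Fin n → ℝ) → (Fin m → ℝ)} :
    IsAffineMap A ↔ ∀ i, IsAffineFun fun x => A x i := by
  constructor
  · rintro ⟨M, c, h⟩ i
    exact ⟨M i, c i, fun x => h x i⟩
  · intro h
    choose M c h using h
    exact ⟨M, c, fun x i => h i x⟩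

namespace IsAffineFun

variable {n m : ℕ} {g h : (Fin n → ℝ) → ℝ}

theorem const (c : ℝ) : IsAffineFun fun _ : Fin n → ℝ => c := ⟨0, c, by simp⟩

theorem coord (i : Fin n) : IsAffineFun fun x : Fin n → ℝ => x i :=
  ⟨Pi.single i 1, 0, fun x => by simp [Pi.single_apply]⟩

theorem add (hg : IsAffineFun g) (hh : IsAffineFun h) : IsAffineFun fun x => g x + h x := by
  obtain ⟨a, c, hg⟩ := hg
  obtain ⟨b, e, hh⟩ := hh
  refine ⟨a + b, c + e, fun x => ?_⟩
  simp only [hg, hh, Pi.add_apply, add_mul, Finset.sum_add_distrib]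
  ring

theorem const_mul (r : ℝ) (hg : IsAffineFun g) : IsAffineFun fun x => r * g x := by
  obtain ⟨a, c, hg⟩ := hg
  refine ⟨fun j => r * a j, r * c, fun x => ?_⟩
  simp only [hg, mul_add, Finset.mul_sum, mul_assoc]

theorem neg (hg : IsAffineFun g) : IsAffineFun fun x => -g x := by
  simpa using hg.const_mul (-1)

theorem sub (hg : IsAffineFun g) (hh : IsAffineFun h) : IsAffineFun fun x => g x - h x := by
  simpa only [sub_eq_add_neg] using hg.add hh.neg

theorem sum {ι : Type*} (s : Finset ι) {u : ι → (Fin n → ℝ) → ℝ}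
    (hu : ∀ i, IsAffineFun (u i)) : IsAffineFun fun x => ∑ i ∈ s, u i x := by
  classical
  induction s using Finset.induction_on with
  | empty => simpa using const 0
  | insert i s hi ih => simpa only [Finset.sum_insert hi] using (hu i).add ih

theorem comp {A : (Fin m → ℝ) → (Fin n → ℝ)} (hg : IsAffineFun g) (hA : IsAffineMap A) :
    IsAffineFun fun x => g (A x) := by
  obtain ⟨a, c, hg⟩ := hg
  simp only [hg]
  exact (sum _ fun j => (isAffineMap_iff.1 hA j).const_mul (a j)).add (const c)

end IsAffineFun

namespace IsAffineMap

variable {n m p : ℕ}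

theorem id : IsAffineMap fun x : Fin n → ℝ => x := isAffineMap_iff.2 IsAffineFun.coord

theorem comp {B : (Fin n → ℝ) → (Fin m → ℝ)} {A : (Fin p → ℝ) → (Fin n → ℝ)}
    (hB : IsAffineMap B) (hA : IsAffineMap A) : IsAffineMap fun x => B (A x) :=
  isAffineMap_iff.2 fun i => (isAffineMap_iff.1 hB i).comp hA

theorem add {A B : (Fin n → ℝ) → (Fin m → ℝ)} (hA : IsAffineMap A) (hB : IsAffineMap B) :
    IsAffineMap fun x i => A x i + B x i :=
  isAffineMap_iff.2 fun i => (isAffineMap_iff.1 hA i).add (isAffineMap_iff.1 hB i)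

theorem neg {A : (Fin n → ℝ) → (Fin m → ℝ)} (hA : IsAffineMap A) :
    IsAffineMap fun x i => -A x i :=
  isAffineMap_iff.2 fun i => (isAffineMap_iff.1 hA i).neg

theorem sub {A B : (Fin n → ℝ) → (Fin m → ℝ)} (hA : IsAffineMap A) (hB : IsAffineMap B) :
    IsAffineMap fun x i => A x i - B x i :=
  isAffineMap_iff.2 fun i => (isAffineMap_iff.1 hA i).sub (isAffineMap_iff.1 hB i)

theorem append {A : (Fin p → ℝ) → (Fin n → ℝ)} {B : (Fin p → ℝ) → (Fin m → ℝ)}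
    (hA : IsAffineMap A) (hB : IsAffineMap B) : IsAffineMap fun x => Fin.append (A x) (B x) := by
  refine isAffineMap_iff.2 fun i => ?_
  induction i using Fin.addCases with
  | left i => simpa using isAffineMap_iff.1 hA i
  | right i => simpa using isAffineMap_iff.1 hB i

theorem reindex (σ : Fin m → Fin n) : IsAffineMap fun (x : Fin n → ℝ) i => x (σ i) :=
  isAffineMap_iff.2 fun i => IsAffineFun.coord (σ i)

theorem const (c : Fin m → ℝ) : IsAffineMap fun _ : Fin n → ℝ => c :=
  isAffineMap_iff.2 fun i => IsAffineFun.const (c i)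

end IsAffineMap

theorem relu_relu (t : ℝ) : relu (relu t) = relu t := by simp [relu]

theorem relu_sub_relu_neg (t : ℝ) : relu t - relu (-t) = t := by
  unfold relu
  rcases le_total t 0 with h | h <;> simp [h]

theorem NNaux_comp_affine {k W L d p : ℕ} {g : (Fin d → ℝ) → (Fin k → ℝ)}
    (hg : g ∈ NNaux k W L d) {Z : (Fin p → ℝ) → (Fin d → ℝ)} (hZ : IsAffineMap Z) :
    (fun x => g (Z x)) ∈ NNaux k W L p := by
  cases L with
  | zero => exact IsAffineMap.comp hg hZ
  | succ L =>
    obtain ⟨N, h1, hN, A, h, hA, hh, rfl⟩ := hg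
    exact ⟨N, h1, hN, fun x => A (Z x), h, hA.comp hZ, hh, rfl⟩

/-- A hidden layer may be repeated, since `relu` fixes nonnegative values. -/
theorem NNaux_depth_succ {k W L d : ℕ} {g : (Fin d → ℝ) → (Fin k → ℝ)}
    (hg : g ∈ NNaux k W (L + 1) d) : g ∈ NNaux k W (L + 2) d := by
  obtain ⟨N, h1, hN, A, h, hA, hh, rfl⟩ := hg
  exact ⟨N, h1, hN, A, fun y => h fun i => relu (y i), hA,
    ⟨N, h1, hN, fun y => y, h, IsAffineMap.id, hh, rfl⟩, by simp only [relu_relu]⟩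

theorem NNaux_depth_mono {k W L L' d : ℕ} {g : (Fin d → ℝ) → (Fin k → ℝ)}
    (hL : 1 ≤ L) (hLL' : L ≤ L') (hg : g ∈ NNaux k W L d) : g ∈ NNaux k W L' d := by
  induction L', hLL' using Nat.le_induction with
  | base => exact hg
  | succ l hl ih =>
    obtain ⟨l, rfl⟩ := Nat.exists_eq_add_of_le' (hL.trans hl)
    exact NNaux_depth_succ ih

/-- Two networks of equal depth run in parallel. -/
theorem NNaux_add_comp {k W₁ W₂ L m₁ m₂ p : ℕ}
    {f : (Fin m₁ → ℝ) → (Fin k → ℝ)} {g : (Fin m₂ → ℝ) → (Fin k → ℝ)}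
    (hf : f ∈ NNaux k W₁ L m₁) (hg : g ∈ NNaux k W₂ L m₂)
    {Z₁ : (Fin p → ℝ) → (Fin m₁ → ℝ)} {Z₂ : (Fin p → ℝ) → (Fin m₂ → ℝ)}
    (hZ₁ : IsAffineMap Z₁) (hZ₂ : IsAffineMap Z₂) :
    (fun x j => f (Z₁ x) j + g (Z₂ x) j) ∈ NNaux k (W₁ + W₂) L p := by
  induction L generalizing m₁ m₂ p with
  | zero => exact (IsAffineMap.comp hf hZ₁).add (IsAffineMap.comp hg hZ₂)
  | succ L ih =>
    obtain ⟨N₁, h1, hN₁, A, f, hA, hf, rfl⟩ := hf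
    obtain ⟨N₂, -, hN₂, B, g, hB, hg, rfl⟩ := hg
    refine ⟨N₁ + N₂, by omega, by omega, _, _, (hA.comp hZ₁).append (hB.comp hZ₂),
      ih hf hg (IsAffineMap.reindex (Fin.castAdd N₂)) (IsAffineMap.reindex (Fin.natAdd N₁)), ?_⟩
    simp

/-- The network `f` is run first, while the affine data `U` is carried along as the difference of
its positive and negative parts; the network `q` is then applied to `U` corrected by the output
of `f`. -/
theorem NNaux_carry {k l W W' L L' m e p : ℕ} {f : (Fin m → ℝ) → (Fin k → ℝ)}
    {q : (Fin e → ℝ) → (Fin l → ℝ)} (hf : f ∈ NNaux k W L m) (hq : q ∈ NNaux l W' L' e)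
    (hW : W + 2 * e ≤ W') {V : (Fin k → ℝ) → (Fin e → ℝ)} (hV : IsAffineMap V)
    {Z : (Fin p → ℝ) → (Fin m → ℝ)} {U : (Fin p → ℝ) → (Fin e → ℝ)}
    (hZ : IsAffineMap Z) (hU : IsAffineMap U) :
    (fun x => q fun i => U x i + V (f (Z x)) i) ∈ NNaux l W' (L + L') p := by
  induction L generalizing m p with
  | zero =>
    rw [Nat.zero_add]
    exact NNaux_comp_affine hq (hU.add (hV.comp (IsAffineMap.comp hf hZ)))
  | succ L ih =>
    obtain ⟨N, h1, hN, A, f, hA, hf, rfl⟩ := hf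
    rw [Nat.succ_add]
    refine ⟨N + (e + e), by omega, by omega, _, _, (hA.comp hZ).append (hU.append hU.neg),
      ih hf (IsAffineMap.reindex (Fin.castAdd (e + e)))
        ((IsAffineMap.reindex fun i => Fin.natAdd N (Fin.castAdd e i)).sub
          (IsAffineMap.reindex fun i => Fin.natAdd N (Fin.natAdd e i))), ?_⟩
    simp only [Fin.append_left, Fin.append_right, relu_sub_relu_neg]

theorem NNaux_sum_parallel {ι : Type*} {k L d : ℕ} {s : Finset ι} (hs : s.Nonempty)
    {W : ι → ℕ} {f : ι → (Fin d → ℝ) → (Fin k → ℝ)} (hf : ∀ i, f i ∈ NNaux k (W i) L d) :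
    (fun x j => ∑ i ∈ s, f i x j) ∈ NNaux k (∑ i ∈ s, W i) L d := by
  induction hs using Finset.Nonempty.cons_induction with
  | singleton i => simpa using hf i
  | cons i s hi hs ih =>
    simpa only [Finset.sum_cons] using
      NNaux_add_comp (hf i) ih IsAffineMap.id IsAffineMap.id

/-- Networks run one after another, on a state consisting of the input and the partial sum. -/
theorem NNaux_sum_sequential {ι : Type*} {k d W' : ℕ} (s : Finset ι)
    {W L : ι → ℕ} {f : ι → (Fin d → ℝ) → (Fin k → ℝ)} (hf : ∀ i, f i ∈ NNaux k (W i) (L i) d)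
    (hW : ∀ i, W i + 2 * (d + k) ≤ W') :
    (fun (y : Fin (d + k) → ℝ) j =>
      y (Fin.natAdd d j) + ∑ i ∈ s, f i (fun a => y (Fin.castAdd k a)) j) ∈
      NNaux k W' (∑ i ∈ s, L i) (d + k) := by
  classical
  induction s using Finset.induction_on with
  | empty =>
    simp only [Finset.sum_empty, add_zero]
    exact IsAffineMap.reindex (Fin.natAdd d)
  | insert i s hi ih =>
    have := NNaux_carry (hf i) ih (hW i)
      ((IsAffineMap.const (0 : Fin d → ℝ)).append IsAffineMap.id)
      (IsAffineMap.reindex (Fin.castAdd k)) IsAffineMap.id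
    simpa [Finset.sum_insert hi, add_assoc] using this


theorem nn_summation (n d k : ℕ) (hn : 1 ≤ n)
    (W L : Fin n → ℕ) (hW : ∀ i, 1 ≤ W i) (hL : ∀ i, 1 ≤ L i)
    (f : Fin n → (Fin d → ℝ) → (Fin k → ℝ)) (hf : ∀ i, f i ∈ NN d k (W i) (L i)) :
    (fun x j => ∑ i, f i x j) ∈ NN d k (∑ i, W i) (Finset.univ.sup L) ∧
    (fun x j => ∑ i, f i x j) ∈ NN d k (Finset.univ.sup W + 2 * d + 2 * k) (∑ i, L i) := by
  constructor
  · have : Nonempty (Fin n) := ⟨⟨0, hn⟩⟩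
    exact NNaux_sum_parallel Finset.univ_nonempty fun i =>
      NNaux_depth_mono (hL i) (Finset.le_sup (Finset.mem_univ i)) (hf i)
  · have hW' : ∀ i, W i + 2 * (d + k) ≤ Finset.univ.sup W + 2 * d + 2 * k := fun i => by
      have := Finset.le_sup (f := W) (Finset.mem_univ i)
      omega
    simpa using! NNaux_comp_affine (NNaux_sum_sequential Finset.univ hf hW')
      (IsAffineMap.id.append (IsAffineMap.const (0 : Fin k → ℝ)))
end
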